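/- Let (R, m) be a commutative Noetherian local ring and let C be a semidualizing R-module. Consider the statements: (i) R is Gorenstein; (ii) the C-injective dimension cid_R(H^n_𝔞(C)) is finite for all proper ideals 𝔞 of R such that R is relative Cohen-Macaulay with respect to 𝔞 with ht_R 𝔞 = n; (iii) cid_R(H^n_𝔞(C)) is finite for some such ideal 𝔞. Then (i) implies (ii), (ii) implies (iii), and if R is Cohen-Macaulay then (iii) implies (i). -/

import Mathlib

/-!
Definitions needed to state results of "On flat and Gorenstein flat dimensions of
local cohomology modules" by M.R. Zargar and H. Zakeri.
-/

open CategoryTheory IsLocalRing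

universe u

namespace Paper

variable (R : Type u) [CommRing R]

/-! ## Resolution/coresolution dimensions with respect to a class of modules -/

/-- `ResDimLE R P n M` : `M` admits a resolution `0 → Xₙ → ⋯ → X₀ → M → 0`
with each `Xᵢ` in the class `P`. -/
def ResDimLE (P : ModuleCat.{u} R → Prop) : ℕ → ModuleCat.{u} R → Prop
  | 0, M => P M
  | n + 1, M => ResDimLE P n M ∨
      ∃ (X : ModuleCat.{u} R) (f : X →ₗ[R] M), P X ∧ Function.Surjective f ∧
        ResDimLE P n (ModuleCat.of R (LinearMap.ker f))

/-- `CoresDimLE R P n M` : `M` admits a coresolution `0 → M → X₀ → ⋯ → Xₙ → 0`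
with each `Xᵢ` in the class `P`. -/
def CoresDimLE (P : ModuleCat.{u} R → Prop) : ℕ → ModuleCat.{u} R → Prop
  | 0, M => P M
  | n + 1, M => CoresDimLE P n M ∨
      ∃ (X : ModuleCat.{u} R) (f : M →ₗ[R] X), P X ∧ Function.Injective f ∧
        CoresDimLE P n (ModuleCat.of R (X ⧸ LinearMap.range f))

/-- The resolution dimension of `M` with respect to the class `P`, as an
extended natural number (`⊤` if there is no finite resolution). -/
noncomputable def ResDim (P : ModuleCat.{u} R → Prop) (M : ModuleCat.{u} R) : ℕ∞ :=
  sInf {n : ℕ∞ | ∃ k : ℕ, (k : ℕ∞) = n ∧ ResDimLE R P k M}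

/-- The coresolution dimension of `M` with respect to the class `P`. -/
noncomputable def CoresDim (P : ModuleCat.{u} R → Prop) (M : ModuleCat.{u} R) : ℕ∞ :=
  sInf {n : ℕ∞ | ∃ k : ℕ, (k : ℕ∞) = n ∧ CoresDimLE R P k M}

/-- Flat dimension `fd_R M`. -/
noncomputable def flatDim (M : Type u) [AddCommGroup M] [Module R M] : ℕ∞ :=
  ResDim R (fun N => Module.Flat R N) (ModuleCat.of R M)

/-- Projective dimension `pd_R M`. -/
noncomputable def projDim (M : Type u) [AddCommGroup M] [Module R M] : ℕ∞ :=
  ResDim R (fun N => Module.Projective R N) (ModuleCat.of R M)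

/-- Injective dimension `id_R M`. -/
noncomputable def injDim (M : Type u) [AddCommGroup M] [Module R M] : ℕ∞ :=
  CoresDim R (fun N => Module.Injective R N) (ModuleCat.of R M)

/-! ## Local cohomology -/

/-- The local cohomology module `H^i_𝔞(M)`, as an object of `ModuleCat R`. -/
noncomputable def lcoh (𝔞 : Ideal R) (i : ℕ) (M : Type u) [AddCommGroup M] [Module R M] :
    ModuleCat.{u} R :=
  (localCohomology 𝔞 i).obj (ModuleCat.of R M)

/-- `M` is relative Cohen-Macaulay with respect to `𝔞` with `ht_M 𝔞 = n`, i.e. the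
`n`-th local cohomology of `M` with respect to `𝔞` is the only non-vanishing one. -/
def IsRelCM (𝔞 : Ideal R) (n : ℕ) (M : Type u) [AddCommGroup M] [Module R M] : Prop :=
  (∀ i : ℕ, i ≠ n → Subsingleton (lcoh R 𝔞 i M)) ∧ ¬ Subsingleton (lcoh R 𝔞 n M)

/-! ## Depth, dimension, Cohen-Macaulay -/

/-- The depth of a module over a local ring: the supremum of the lengths of
`M`-regular sequences contained in the maximal ideal. -/
noncomputable def depth [IsLocalRing R] (M : Type u) [AddCommGroup M] [Module R M] : ℕ∞ :=
  sSup {n : ℕ∞ | ∃ rs : List R, (rs.length : ℕ∞) = n ∧ (∀ x ∈ rs, x ∈ maximalIdeal R) ∧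
    RingTheory.Sequence.IsRegular M rs}

/-- The (Krull) dimension of a module: the Krull dimension of `R` modulo
the annihilator of `M` (`⊥` for the zero module). -/
noncomputable def moduleDim (M : Type u) [AddCommGroup M] [Module R M] : WithBot ℕ∞ :=
  ringKrullDim (R ⧸ Module.annihilator R M)

/-- A finitely generated module over a local ring is Cohen-Macaulay
if its depth equals its dimension. -/
def IsCohenMacaulayModule [IsLocalRing R] (M : Type u) [AddCommGroup M] [Module R M] : Prop :=
  (depth R M : WithBot ℕ∞) = moduleDim R M

/-- A local ring is Cohen-Macaulay if it is so as a module over itself. -/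
def IsCohenMacaulayRing [IsLocalRing R] : Prop := IsCohenMacaulayModule R R

/-- A local ring is Gorenstein if it has finite injective dimension over itself. -/
def IsGorensteinRing : Prop := injDim R R ≠ ⊤

/-! ## Ext, Tor, semidualizing modules -/

/-- `Ext^i_R(A, B)`. -/
noncomputable def ext (i : ℕ) (A B : Type u) [AddCommGroup A] [Module R A]
    [AddCommGroup B] [Module R B] : ModuleCat.{u} R :=
  ((Ext R (ModuleCat.{u} R) i).obj (Opposite.op (ModuleCat.of R A))).obj (ModuleCat.of R B)

/-- `Tor^R_p(A, B)` indexed by `p : ℤ`, with the convention that it vanishes in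
negative degrees. -/
noncomputable def tor (p : ℤ) (A B : Type u) [AddCommGroup A] [Module R A]
    [AddCommGroup B] [Module R B] : ModuleCat.{u} R :=
  if 0 ≤ p then ((Tor (ModuleCat.{u} R) p.toNat).obj (ModuleCat.of R A)).obj (ModuleCat.of R B)
  else ModuleCat.of R PUnit

/-- A finitely generated module `C` is semidualizing if the natural map
`R → Hom_R(C, C)` is bijective and `Ext^i_R(C, C) = 0` for all `i ≥ 1`. -/
def IsSemidualizing (C : Type u) [AddCommGroup C] [Module R C] : Prop :=
  Module.Finite R C ∧
  Function.Bijective (fun r : R => (r • LinearMap.id : C →ₗ[R] C)) ∧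
  ∀ i : ℕ, 1 ≤ i → Subsingleton (ext R i C C)

/-! ## Gorenstein homological classes -/

/-- `N` is Gorenstein injective: it is the kernel of the `0`-th differential of some
exact complex `Y` of injective modules which stays exact under `Hom(I, -)` for every
injective module `I`. (The complex is written cohomologically.) -/
def IsGorensteinInjective (N : Type u) [AddCommGroup N] [Module R N] : Prop :=
  ∃ (Y : ℤ → ModuleCat.{u} R) (d : ∀ i : ℤ, Y i →ₗ[R] Y (i + 1)),
    (∀ i, Module.Injective R (Y i)) ∧
    (∀ i, Function.Exact (d i) (d (i + 1))) ∧
    (∀ (I : ModuleCat.{u} R), Module.Injective R I →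
      ∀ (i : ℤ) (g : I →ₗ[R] Y (i + 1)), (d (i + 1)).comp g = 0 →
        ∃ h : I →ₗ[R] Y i, (d i).comp h = g) ∧
    ∃ ι : N →ₗ[R] Y 0, Function.Injective ι ∧ Function.Exact ι (d 0)

/-- `N` is Gorenstein projective: it is the cokernel of a differential of some
exact complex `X` of projective modules which stays exact under `Hom(-, P)` for
every projective module `P`. -/
def IsGorensteinProjective (N : Type u) [AddCommGroup N] [Module R N] : Prop :=
  ∃ (X : ℤ → ModuleCat.{u} R) (d : ∀ i : ℤ, X i →ₗ[R] X (i + 1)),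
    (∀ i, Module.Projective R (X i)) ∧
    (∀ i, Function.Exact (d i) (d (i + 1))) ∧
    (∀ (P : ModuleCat.{u} R), Module.Projective R P →
      ∀ (i : ℤ) (g : X (i + 1) →ₗ[R] P), g.comp (d i) = 0 →
        ∃ h : X (i + 1 + 1) →ₗ[R] P, h.comp (d (i + 1)) = g) ∧
    ∃ π : X 0 →ₗ[R] N, Function.Surjective π ∧ Function.Exact (d (-1)) π

/-- `N` is Gorenstein flat: it is the cokernel of a differential of some exact
complex `Z` of flat modules which stays exact under `- ⊗ I` for every injective
module `I`. -/
def IsGorensteinFlat (N : Type u) [AddCommGroup N] [Module R N] : Prop :=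
  ∃ (Z : ℤ → ModuleCat.{u} R) (d : ∀ i : ℤ, Z i →ₗ[R] Z (i + 1)),
    (∀ i, Module.Flat R (Z i)) ∧
    (∀ i, Function.Exact (d i) (d (i + 1))) ∧
    (∀ (I : ModuleCat.{u} R), Module.Injective R I →
      ∀ i : ℤ, Function.Exact (LinearMap.rTensor (R := R) I (d i))
        (LinearMap.rTensor (R := R) I (d (i + 1)))) ∧
    ∃ π : Z 0 →ₗ[R] N, Function.Surjective π ∧ Function.Exact (d (-1)) π

/-- Gorenstein injective dimension `Gid_R M`. -/
noncomputable def GinjDim (M : Type u) [AddCommGroup M] [Module R M] : ℕ∞ :=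
  CoresDim R (fun N => IsGorensteinInjective R N) (ModuleCat.of R M)

/-- Gorenstein projective dimension `Gpd_R M`. -/
noncomputable def GprojDim (M : Type u) [AddCommGroup M] [Module R M] : ℕ∞ :=
  ResDim R (fun N => IsGorensteinProjective R N) (ModuleCat.of R M)

/-- Gorenstein flat dimension `Gfd_R M`. -/
noncomputable def GflatDim (M : Type u) [AddCommGroup M] [Module R M] : ℕ∞ :=
  ResDim R (fun N => IsGorensteinFlat R N) (ModuleCat.of R M)

/-! ## `C`-injective, `C`-projective, `C`-flat modules and the `G_C`-classes -/

/-- `N` is `C`-injective if `N ≅ Hom_R(C, I)` for some injective module `I`. -/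
def IsCInjective (C : Type u) [AddCommGroup C] [Module R C]
    (N : Type u) [AddCommGroup N] [Module R N] : Prop :=
  ∃ I : ModuleCat.{u} R, Module.Injective R I ∧ Nonempty (N ≃ₗ[R] (C →ₗ[R] I))

/-- `N` is `C`-projective if `N ≅ C ⊗_R P` for some projective module `P`. -/
def IsCProjective (C : Type u) [AddCommGroup C] [Module R C]
    (N : Type u) [AddCommGroup N] [Module R N] : Prop :=
  ∃ P : ModuleCat.{u} R, Module.Projective R P ∧ Nonempty (N ≃ₗ[R] TensorProduct R C P)

/-- `N` is `C`-flat if `N ≅ C ⊗_R F` for some flat module `F`. -/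
def IsCFlat (C : Type u) [AddCommGroup C] [Module R C]
    (N : Type u) [AddCommGroup N] [Module R N] : Prop :=
  ∃ F : ModuleCat.{u} R, Module.Flat R F ∧ Nonempty (N ≃ₗ[R] TensorProduct R C F)

/-- `C`-injective dimension `cid_R M`. -/
noncomputable def cInjDim (C : Type u) [AddCommGroup C] [Module R C]
    (M : Type u) [AddCommGroup M] [Module R M] : ℕ∞ :=
  CoresDim R (fun N => IsCInjective R C N) (ModuleCat.of R M)

/-- `C`-projective dimension `cpd_R M`. -/
noncomputable def cProjDim (C : Type u) [AddCommGroup C] [Module R C]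
    (M : Type u) [AddCommGroup M] [Module R M] : ℕ∞ :=
  ResDim R (fun N => IsCProjective R C N) (ModuleCat.of R M)

/-- `N` is `G_C`-injective: `N` is the kernel of the `0`-th differential of an exact
complex `Y` (a complete `I_C I`-coresolution) with `Y i` injective in degrees belonging
to the coresolution part and `C`-injective elsewhere, such that `Hom(I', Y)` is exact
for every `C`-injective module `I'`. -/
def IsGCInjective (C : Type u) [AddCommGroup C] [Module R C]
    (N : Type u) [AddCommGroup N] [Module R N] : Prop :=
  ∃ (Y : ℤ → ModuleCat.{u} R) (d : ∀ i : ℤ, Y i →ₗ[R] Y (i + 1)),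
    (∀ i : ℤ, 0 ≤ i → Module.Injective R (Y i)) ∧
    (∀ i : ℤ, i < 0 → IsCInjective R C (Y i)) ∧
    (∀ i, Function.Exact (d i) (d (i + 1))) ∧
    (∀ (I : ModuleCat.{u} R), IsCInjective R C I →
      ∀ (i : ℤ) (g : I →ₗ[R] Y (i + 1)), (d (i + 1)).comp g = 0 →
        ∃ h : I →ₗ[R] Y i, (d i).comp h = g) ∧
    ∃ ι : N →ₗ[R] Y 0, Function.Injective ι ∧ Function.Exact ι (d 0)

/-- `N` is `G_C`-projective: the cokernel of the degree `0` differential of a complete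
`P_C P`-resolution. -/
def IsGCProjective (C : Type u) [AddCommGroup C] [Module R C]
    (N : Type u) [AddCommGroup N] [Module R N] : Prop :=
  ∃ (X : ℤ → ModuleCat.{u} R) (d : ∀ i : ℤ, X i →ₗ[R] X (i + 1)),
    (∀ i : ℤ, i ≤ 0 → Module.Projective R (X i)) ∧
    (∀ i : ℤ, 0 < i → IsCProjective R C (X i)) ∧
    (∀ i, Function.Exact (d i) (d (i + 1))) ∧
    (∀ (Q : ModuleCat.{u} R), IsCProjective R C Q →
      ∀ (i : ℤ) (g : X (i + 1) →ₗ[R] Q), g.comp (d i) = 0 →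
        ∃ h : X (i + 1 + 1) →ₗ[R] Q, h.comp (d (i + 1)) = g) ∧
    ∃ π : X 0 →ₗ[R] N, Function.Surjective π ∧ Function.Exact (d (-1)) π

/-- `N` is `G_C`-flat: the cokernel of the degree `0` differential of a complete
`F_C F`-resolution. -/
def IsGCFlat (C : Type u) [AddCommGroup C] [Module R C]
    (N : Type u) [AddCommGroup N] [Module R N] : Prop :=
  ∃ (Z : ℤ → ModuleCat.{u} R) (d : ∀ i : ℤ, Z i →ₗ[R] Z (i + 1)),
    (∀ i : ℤ, i ≤ 0 → Module.Flat R (Z i)) ∧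
    (∀ i : ℤ, 0 < i → IsCFlat R C (Z i)) ∧
    (∀ i, Function.Exact (d i) (d (i + 1))) ∧
    (∀ (J : ModuleCat.{u} R), IsCInjective R C J →
      ∀ i : ℤ, Function.Exact (LinearMap.rTensor (R := R) J (d i))
        (LinearMap.rTensor (R := R) J (d (i + 1)))) ∧
    ∃ π : Z 0 →ₗ[R] N, Function.Surjective π ∧ Function.Exact (d (-1)) π

/-- `G_C`-injective dimension `Gid_C M`. -/
noncomputable def GCinjDim (C : Type u) [AddCommGroup C] [Module R C]
    (M : Type u) [AddCommGroup M] [Module R M] : ℕ∞ :=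
  CoresDim R (fun N => IsGCInjective R C N) (ModuleCat.of R M)

/-- `G_C`-projective dimension `G_C-pd_R M`. -/
noncomputable def GCprojDim (C : Type u) [AddCommGroup C] [Module R C]
    (M : Type u) [AddCommGroup M] [Module R M] : ℕ∞ :=
  ResDim R (fun N => IsGCProjective R C N) (ModuleCat.of R M)

/-- `G_C`-flat dimension `G_C-fd_R M`. -/
noncomputable def GCflatDim (C : Type u) [AddCommGroup C] [Module R C]
    (M : Type u) [AddCommGroup M] [Module R M] : ℕ∞ :=
  ResDim R (fun N => IsGCFlat R C N) (ModuleCat.of R M)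

end Paper

open Paper IsLocalRing

section Part1
open CategoryTheory IsLocalRing
open Opposite

section Gen
variable {D : Type*} [Category* D] [Abelian D]

noncomputable def gMor (K : ChainComplex D ℕ) {J : D} (n : ℕ) (a : K.X n ⟶ J)
    (ha : K.d (n+1) n ≫ a = 0) : K.homology n ⟶ J :=
  K.homologyι n ≫ K.descOpcycles a (n+1) (by simp) ha

lemma gMor_add (K : ChainComplex D ℕ) {J : D} (n : ℕ) (a b : K.X n ⟶ J)
    (ha : K.d (n+1) n ≫ a = 0) (hb : K.d (n+1) n ≫ b = 0) (hab : K.d (n+1) n ≫ (a + b) = 0) :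
    gMor K n (a + b) hab = gMor K n a ha + gMor K n b hb := by
  rw [gMor, gMor, gMor, ← Preadditive.comp_add]
  congr 1
  rw [← cancel_epi (K.pOpcycles n)]
  simp

lemma gMor_zero (K : ChainComplex D ℕ) {J : D} (n : ℕ) (a : K.X n ⟶ J) (h : a = 0)
    (ha : K.d (n+1) n ≫ a = 0) : gMor K n a ha = 0 := by
  subst h
  have := gMor_add K n (0 : K.X n ⟶ J) 0 ha ha (by simp)
  simp only [add_zero] at this
  exact left_eq_add.1 this

lemma gMor_comp (K : ChainComplex D ℕ) {J J' : D} (n : ℕ) (a : K.X n ⟶ J) (r : J ⟶ J')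
    (ha : K.d (n+1) n ≫ a = 0) (hab : K.d (n+1) n ≫ (a ≫ r) = 0) :
    gMor K n (a ≫ r) hab = gMor K n a ha ≫ r := by
  rw [gMor, gMor, Category.assoc]
  congr 1
  rw [← cancel_epi (K.pOpcycles n)]
  simp

lemma gMor_surj (K : ChainComplex D ℕ) {J : D} [Injective J] (n : ℕ) (g : K.homology n ⟶ J) :
    ∃ a ha, g = gMor K n a ha := by
  refine ⟨K.pOpcycles n ≫ Injective.factorThru g (K.homologyι n), by simp, ?_⟩
  rw [gMor]
  have : K.descOpcycles (K.pOpcycles n ≫ Injective.factorThru g (K.homologyι n)) (n+1) (by simp)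
     (by simp) = Injective.factorThru g (K.homologyι n) := by
    rw [← cancel_epi (K.pOpcycles n)]
    simp
  rw [this]
  simp

lemma gMor_eq_zero (K : ChainComplex D ℕ) {J : D} [Injective J] (n : ℕ) (a : K.X (n+1) ⟶ J)
    (ha : K.d (n+1+1) (n+1) ≫ a = 0) :
    gMor K (n+1) a ha = 0 ↔ ∃ b : K.X n ⟶ J, K.d (n+1) n ≫ b = a := by
  constructor
  · intro h
    have hex : (ShortComplex.mk (K.homologyι (n+1)) (K.fromOpcycles (n+1) n)
        (by simp)).Exact := by
      apply ShortComplex.exact_of_f_is_kernel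
      exact K.homologyIsKernel (n+1) n (by simp)
    refine ⟨hex.descToInjective _ h, ?_⟩
    have := hex.comp_descToInjective _ h
    dsimp only at this
    have h2 := congrArg (fun k => K.pOpcycles (n+1) ≫ k) this
    simpa using h2
  · rintro ⟨b, rfl⟩
    have : K.descOpcycles (K.d (n+1) n ≫ b) (n+1+1) (by simp) ha = K.fromOpcycles (n+1) n ≫ b := by
      rw [← cancel_epi (K.pOpcycles (n+1))]
      simp
    rw [gMor, this]
    simp

lemma gMor_eq_zero_zero (K : ChainComplex D ℕ) {J : D} (a : K.X 0 ⟶ J)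
    (ha : K.d (0+1) 0 ≫ a = 0) (h : gMor K 0 a ha = 0) : a = 0 := by
  have : IsIso (K.homologyι 0) := K.isIso_homologyι 0 _ rfl (by simp)
  have h2 : K.descOpcycles a (0+1) (by simp) ha = 0 := by
    rw [← cancel_epi (K.homologyι 0)]
    rw [gMor] at h
    rw [h]; simp
  have := congrArg (fun k => K.pOpcycles 0 ≫ k) h2
  simpa using this

lemma gMor_natural {K L : ChainComplex D ℕ} (φ : K ⟶ L) {J : D} (n : ℕ) (a : L.X n ⟶ J)
    (ha : L.d (n+1) n ≫ a = 0) (ha' : K.d (n+1) n ≫ φ.f n ≫ a = 0) :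
    HomologicalComplex.homologyMap φ n ≫ gMor L n a ha = gMor K n (φ.f n ≫ a) ha' := by
  rw [gMor, gMor, HomologicalComplex.homologyι_naturality_assoc]
  congr 1
  rw [← cancel_epi (K.pOpcycles n)]
  simp

end Gen

section OldExt
variable {R : Type u} [CommRing R]

/-- the functor whose left derived functors are the old Ext -/
noncomputable abbrev yF (Y : ModuleCat.{u} R) : ModuleCat.{u} R ⥤ (ModuleCat.{u} R)ᵒᵖ :=
  ((linearYoneda R (ModuleCat.{u} R)).obj Y).rightOp

noncomputable abbrev yK {X : ModuleCat.{u} R} (P : ProjectiveResolution X) (Y : ModuleCat.{u} R) :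
    ChainComplex (ModuleCat.{u} R)ᵒᵖ ℕ :=
  ((yF Y).mapHomologicalComplex _).obj P.complex

noncomputable def toOp {A Y : ModuleCat.{u} R} (f : A ⟶ Y) : (yF Y).obj A ⟶ op (ModuleCat.of R R) :=
  (ModuleCat.ofHom (LinearMap.toSpanSingleton R (A ⟶ Y) f)).op

lemma toOp_unop {A Y : ModuleCat.{u} R} (f : A ⟶ Y) :
    ((toOp f).unop : ModuleCat.of R R ⟶ ModuleCat.of R (A ⟶ Y)) =
      ModuleCat.ofHom (LinearMap.toSpanSingleton R (A ⟶ Y) f) := rfl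

lemma map_toOp {A B Y : ModuleCat.{u} R} (g : A ⟶ B) (f : B ⟶ Y) :
    (yF Y).map g ≫ toOp f = toOp (g ≫ f) := by
  apply Quiver.Hom.unop_inj
  apply ModuleCat.hom_ext
  apply LinearMap.ext_ring
  change g ≫ ((1 : R) • f) = (1 : R) • (g ≫ f)
  simp

lemma toOp_zero {A Y : ModuleCat.{u} R} : toOp (0 : A ⟶ Y) = 0 := by
  apply Quiver.Hom.unop_inj
  apply ModuleCat.hom_ext
  apply LinearMap.ext_ring
  change (1 : R) • (0 : A ⟶ Y) = 0
  simp

lemma toOp_surj {A Y : ModuleCat.{u} R} (g : (yF Y).obj A ⟶ op (ModuleCat.of R R)) :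
    ∃ f : A ⟶ Y, g = toOp f := by
  refine ⟨g.unop (1 : R), ?_⟩
  apply Quiver.Hom.unop_inj
  apply ModuleCat.hom_ext
  apply LinearMap.ext_ring
  exact (one_smul R (g.unop (1 : R) : A ⟶ Y)).symm

lemma toOp_inj {A Y : ModuleCat.{u} R} {f g : A ⟶ Y} (h : toOp f = toOp g) : f = g := by
  have : (1 : R) • f = (1 : R) • g := congrArg (fun k => k.unop (1 : R)) h
  simpa using this

lemma toOp_add {A Y : ModuleCat.{u} R} (f g : A ⟶ Y) : toOp (f + g) = toOp f + toOp g := by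
  apply Quiver.Hom.unop_inj
  apply ModuleCat.hom_ext
  apply LinearMap.ext_ring
  exact smul_add (1 : R) f g

lemma toOp_smul {A Y : ModuleCat.{u} R} (r : R) (f : A ⟶ Y) :
    toOp (r • f) = toOp f ≫ (ModuleCat.ofHom (r • LinearMap.id : R →ₗ[R] R)).op := by
  apply Quiver.Hom.unop_inj
  apply ModuleCat.hom_ext
  apply LinearMap.ext_ring
  change (1 : R) • (r • f) = (r • (1 : R)) • f
  simp

lemma opR_injective : Injective (op (ModuleCat.of R R)) := by
  have : Projective (ModuleCat.of R R) :=
    (IsProjective.iff_projective (R := R) R).1 inferInstance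
  infer_instance

/-- `toOp` with the right type -/
noncomputable def tK {X : ModuleCat.{u} R} (P : ProjectiveResolution X) (Y : ModuleCat.{u} R)
    (n : ℕ) (f : P.complex.X n ⟶ Y) : (yK P Y).X n ⟶ op (ModuleCat.of R R) := toOp f

section
variable {X : ModuleCat.{u} R} (P : ProjectiveResolution X) (Y : ModuleCat.{u} R) (n : ℕ)

lemma tK_add (f g : P.complex.X n ⟶ Y) : tK P Y n (f + g) = tK P Y n f + tK P Y n g := toOp_add f g
lemma tK_smul (r : R) (f : P.complex.X n ⟶ Y) : tK P Y n (r • f) =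
    tK P Y n f ≫ (ModuleCat.ofHom (r • LinearMap.id : R →ₗ[R] R)).op := toOp_smul r f
lemma tK_zero : tK P Y n 0 = 0 := toOp_zero
lemma tK_d (i j : ℕ) (f : P.complex.X j ⟶ Y) :
  (yK P Y).d i j ≫ tK P Y j f = tK P Y i (P.complex.d i j ≫ f) := map_toOp _ _
lemma tK_inj {f g : P.complex.X n ⟶ Y} (h : tK P Y n f = tK P Y n g) : f = g := toOp_inj h
lemma tK_surj (a : (yK P Y).X n ⟶ op (ModuleCat.of R R)) : ∃ f, a = tK P Y n f := toOp_surj a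

noncomputable def oIso : ((yF Y).leftDerived n).obj X ≅ (yK P Y).homology n :=
  P.isoLeftDerivedObj (yF Y) n

variable {Y n} in
lemma tK_cocycle {f : P.complex.X n ⟶ Y} (hf : P.complex.d (n+1) n ≫ f = 0) :
    (yK P Y).d (n+1) n ≫ tK P Y n f = 0 := by rw [tK_d, hf, tK_zero]

noncomputable def oldMor (f : P.complex.X n ⟶ Y) (hf : P.complex.d (n+1) n ≫ f = 0) :
    ((yF Y).leftDerived n).obj X ⟶ op (ModuleCat.of R R) :=
  (oIso P Y n).hom ≫ gMor (yK P Y) n (tK P Y n f) (tK_cocycle P hf)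

lemma oldMor_add (f g : P.complex.X n ⟶ Y) (hf : P.complex.d (n+1) n ≫ f = 0)
    (hg : P.complex.d (n+1) n ≫ g = 0) (hfg : P.complex.d (n+1) n ≫ (f + g) = 0) :
    oldMor P Y n (f + g) hfg = oldMor P Y n f hf + oldMor P Y n g hg := by
  rw [oldMor, oldMor, oldMor, ← Preadditive.comp_add, ← gMor_add]
  · congr 2
    exact tK_add P Y n f g
  · rw [← tK_add, tK_d, hfg, tK_zero]

lemma oldMor_smul (r : R) (f : P.complex.X n ⟶ Y) (hf : P.complex.d (n+1) n ≫ f = 0)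
    (hfg : P.complex.d (n+1) n ≫ (r • f) = 0) :
    oldMor P Y n (r • f) hfg =
      oldMor P Y n f hf ≫ (ModuleCat.ofHom (r • LinearMap.id : R →ₗ[R] R)).op := by
  rw [oldMor, oldMor, Category.assoc, ← gMor_comp]
  · congr 2
    exact tK_smul P Y n r f
  · rw [← tK_smul, tK_d, hfg, tK_zero]

lemma oldMor_surj (g : ((yF Y).leftDerived n).obj X ⟶ op (ModuleCat.of R R)) :
    ∃ f hf, g = oldMor P Y n f hf := by
  have := opR_injective (R := R)
  obtain ⟨a, ha, h⟩ := gMor_surj (yK P Y) n ((oIso P Y n).inv ≫ g)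
  obtain ⟨f, rfl⟩ := tK_surj P Y n a
  refine ⟨f, ?_, ?_⟩
  · apply tK_inj
    rw [← tK_d, ha, tK_zero]
  · rw [oldMor, ← h]; simp

lemma oldMor_eq_zero (f : P.complex.X (n+1) ⟶ Y) (hf : P.complex.d (n+1+1) (n+1) ≫ f = 0) :
    oldMor P Y (n+1) f hf = 0 ↔ ∃ g : P.complex.X n ⟶ Y, P.complex.d (n+1) n ≫ g = f := by
  have := opR_injective (R := R)
  rw [oldMor, Preadditive.IsIso.comp_left_eq_zero, gMor_eq_zero]
  constructor
  · rintro ⟨b, hb⟩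
    obtain ⟨g, rfl⟩ := tK_surj P Y n b
    exact ⟨g, tK_inj P Y _ (by rw [← hb, tK_d])⟩
  · rintro ⟨g, rfl⟩
    exact ⟨tK P Y n g, by rw [tK_d]⟩

lemma oldMor_eq_zero_zero (f : P.complex.X 0 ⟶ Y) (hf : P.complex.d (0+1) 0 ≫ f = 0)
    (h : oldMor P Y 0 f hf = 0) : f = 0 := by
  rw [oldMor, Preadditive.IsIso.comp_left_eq_zero] at h
  apply tK_inj P Y 0
  rw [gMor_eq_zero_zero _ _ _ h, tK_zero]

end

lemma oldMor_natural {X X' : ModuleCat.{u} R} (g : X ⟶ X') (P : ProjectiveResolution X)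
    (Q : ProjectiveResolution X') (φ : P.complex ⟶ Q.complex)
    (comm : φ.f 0 ≫ Q.π.f 0 = P.π.f 0 ≫ g)
    (Y : ModuleCat.{u} R) (n : ℕ)
    (f : Q.complex.X n ⟶ Y) (hf : Q.complex.d (n+1) n ≫ f = 0)
    (hf' : P.complex.d (n+1) n ≫ φ.f n ≫ f = 0) :
    ((yF Y).leftDerived n).map g ≫ oldMor Q Y n f hf = oldMor P Y n (φ.f n ≫ f) hf' := by
  have key : ((yF Y).leftDerived n).map g ≫ (oIso Q Y n).hom = (oIso P Y n).hom ≫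
      HomologicalComplex.homologyMap (((yF Y).mapHomologicalComplex _).map φ) n :=
    ProjectiveResolution.isoLeftDerivedObj_hom_naturality g P Q φ comm (yF Y) n
  have e : (((yF Y).mapHomologicalComplex _).map φ).f n ≫ tK Q Y n f = tK P Y n (φ.f n ≫ f) :=
    map_toOp _ _
  rw [oldMor, ← Category.assoc, key, Category.assoc, oldMor, gMor_natural]
  · congr 2
  · rw [e, tK_d, hf', tK_zero]

end OldExt

end Part1

section Part2
open CategoryTheory IsLocalRing
open Opposite

section Compare
variable {R : Type u} [CommRing R]

/-- two surjections with the same kernel have equivalent targets -/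
lemma equiv_of_surj {Z A B : Type*} [AddCommGroup Z] [Module R Z] [AddCommGroup A] [Module R A]
    [AddCommGroup B] [Module R B] (f : Z →ₗ[R] A) (g : Z →ₗ[R] B) (hf : Function.Surjective f)
    (hg : Function.Surjective g) (h : ∀ z, f z = 0 ↔ g z = 0) :
    ∃ e : A ≃ₗ[R] B, ∀ z, e (f z) = g z := by
  have hk : LinearMap.ker f = LinearMap.ker g := by ext z; exact h z
  refine ⟨(f.quotKerEquivOfSurjective hf).symm.trans
    ((Submodule.quotEquivOfEq _ _ hk).trans (g.quotKerEquivOfSurjective hg)), fun z => ?_⟩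
  have : (f.quotKerEquivOfSurjective hf).symm (f z) = Submodule.Quotient.mk z := by
    rw [LinearEquiv.symm_apply_eq]; rfl
  simp [this]

/-- cocycles -/
def coZ {X : ModuleCat.{u} R} (P : ProjectiveResolution X) (Y : ModuleCat.{u} R) (n : ℕ) :
    Submodule R (P.complex.X n ⟶ Y) where
  carrier := {f | P.complex.d (n+1) n ≫ f = 0}
  add_mem' := by
    intro a b ha hb
    have ha : P.complex.d (n+1) n ≫ a = 0 := ha
    have hb : P.complex.d (n+1) n ≫ b = 0 := hb
    change _ ≫ _ = 0
    rw [Preadditive.comp_add, ha, hb, add_zero]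
  zero_mem' := by simp
  smul_mem' := by
    intro r a ha
    have ha : P.complex.d (n+1) n ≫ a = 0 := ha
    change _ ≫ _ = 0
    rw [Linear.comp_smul, ha, smul_zero]

lemma coZ_prop {X : ModuleCat.{u} R} {P : ProjectiveResolution X} {Y : ModuleCat.{u} R} {n : ℕ}
    (z : coZ P Y n) : P.complex.d (n+1) n ≫ z.1 = 0 := z.2

noncomputable abbrev oExt (n : ℕ) (X Y : ModuleCat.{u} R) : ModuleCat.{u} R :=
  ((Ext R (ModuleCat.{u} R) n).obj (op X)).obj Y

noncomputable def oldElt {X : ModuleCat.{u} R} (P : ProjectiveResolution X) (Y : ModuleCat.{u} R)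
    (n : ℕ) : coZ P Y n →ₗ[R] oExt n X Y where
  toFun f := (oldMor P Y n f.1 (coZ_prop f)).unop.hom (1 : R)
  map_add' f g := by
    have : oldMor P Y n (f + g).1 (coZ_prop (f+g)) = _ := oldMor_add P Y n f.1 g.1 (coZ_prop f) (coZ_prop g) (coZ_prop (f+g))
    rw [this]; rfl
  map_smul' r f := by
    have : oldMor P Y n (r • f).1 (coZ_prop (r • f)) = _ := oldMor_smul P Y n r f.1 (coZ_prop f) (coZ_prop (r • f))
    rw [this]
    have h2 := (oldMor P Y n f.1 (coZ_prop f)).unop.hom.map_smul r (1 : R)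
    exact h2

lemma unop_one_eq_zero {M : (ModuleCat.{u} R)ᵒᵖ} (g : M ⟶ op (ModuleCat.of R R)) :
    g.unop.hom (1 : R) = 0 ↔ g = 0 := by
  constructor
  · intro h
    apply Quiver.Hom.unop_inj
    apply ModuleCat.hom_ext
    apply LinearMap.ext_ring
    exact h
  · rintro rfl; rfl

lemma oldElt_surj {X : ModuleCat.{u} R} (P : ProjectiveResolution X) (Y : ModuleCat.{u} R)
    (n : ℕ) : Function.Surjective (oldElt P Y n) := by
  intro x
  obtain ⟨f, hf, h⟩ := oldMor_surj P Y n
    ((ModuleCat.ofHom (LinearMap.toSpanSingleton R (oExt n X Y) x)).op)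
  refine ⟨⟨f, hf⟩, ?_⟩
  change (oldMor P Y n f hf).unop.hom (1 : R) = x
  rw [← h]
  exact one_smul R x

noncomputable def newElt {X : ModuleCat.{u} R} (P : ProjectiveResolution X) (Y : ModuleCat.{u} R)
    (n : ℕ) : coZ P Y n →ₗ[R] Abelian.Ext X Y n where
  toFun f := P.extMk f.1 (n+1) rfl (coZ_prop f)
  map_add' f g := by
    rw [P.add_extMk]; rfl
  map_smul' r f := by
    rw [RingHom.id_apply, Abelian.Ext.smul_eq_comp_mk₀, P.extMk_comp_mk₀]
    simp

lemma newElt_surj {X : ModuleCat.{u} R} (P : ProjectiveResolution X) (Y : ModuleCat.{u} R)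
    (n : ℕ) : Function.Surjective (newElt P Y n) := by
  intro x
  obtain ⟨f, hf, h⟩ := P.extMk_surjective x (n+1) rfl
  exact ⟨⟨f, hf⟩, h⟩

lemma extMk_zero_inj {X : ModuleCat.{u} R} (P : ProjectiveResolution X) (Y : ModuleCat.{u} R)
    (f : P.complex.X 0 ⟶ Y) (hf : P.complex.d (0+1) 0 ≫ f = 0)
    (h : P.extMk f (0+1) rfl hf = 0) : f = 0 := by
  rw [← P.extEquivCohomologyClass.apply_eq_iff_eq, P.extEquivCohomologyClass_extMk,
    P.extEquivCohomologyClass_zero,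
    CochainComplex.HomComplex.CohomologyClass.mk_eq_zero_iff] at h
  rw [CochainComplex.HomComplex.Cocycle.toSingleMk_mem_coboundaries_iff _ _ _ _ _ 1 (by simp)] at h
  obtain ⟨g, hg⟩ := h
  have hz : Limits.IsZero (P.cochainComplex.X 1) :=
    P.cochainComplex.isZero_of_isStrictlyLE 0 1 (by simp)
  have : g = 0 := hz.eq_of_src _ _
  rw [this, Limits.comp_zero] at hg
  rw [← cancel_epi (P.cochainComplexXIso (-((0:ℕ):ℤ)) 0 rfl).hom, ← hg]
  simp

lemma old_new_ker_aux {X : ModuleCat.{u} R} (P : ProjectiveResolution X) (Y : ModuleCat.{u} R)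
    (n : ℕ) (f : P.complex.X n ⟶ Y) (hf : P.complex.d (n+1) n ≫ f = 0) :
    P.extMk f (n+1) rfl hf = 0 ↔ oldMor P Y n f hf = 0 := by
  cases n with
  | zero =>
    constructor
    · intro h
      obtain rfl := extMk_zero_inj P Y f hf h
      rw [oldMor]
      rw [gMor_zero _ _ _ (tK_zero P Y 0), Limits.comp_zero]
    · intro h
      obtain rfl := oldMor_eq_zero_zero P Y f hf h
      simp
  | succ n =>
    rw [oldMor_eq_zero, P.extMk_eq_zero_iff f (n+1+1) rfl hf n rfl]

lemma old_new_ker {X : ModuleCat.{u} R} (P : ProjectiveResolution X) (Y : ModuleCat.{u} R)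
    (n : ℕ) (z : coZ P Y n) : newElt P Y n z = 0 ↔ oldElt P Y n z = 0 := by
  have h1 : oldElt P Y n z = 0 ↔ oldMor P Y n z.1 (coZ_prop z) = 0 :=
    unop_one_eq_zero (oldMor P Y n z.1 (coZ_prop z))
  have h2 : newElt P Y n z = 0 ↔ P.extMk z.1 (n+1) rfl (coZ_prop z) = 0 := Iff.rfl
  rw [h1, h2]
  exact old_new_ker_aux P Y n _ _

lemma exists_compare {X : ModuleCat.{u} R} (P : ProjectiveResolution X) (Y : ModuleCat.{u} R)
    (n : ℕ) : ∃ e : Abelian.Ext X Y n ≃ₗ[R] oExt n X Y, ∀ z, e (newElt P Y n z) = oldElt P Y n z :=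
  equiv_of_surj _ _ (newElt_surj P Y n) (oldElt_surj P Y n) (old_new_ker P Y n)

noncomputable def cmpExt (X Y : ModuleCat.{u} R) (n : ℕ) : Abelian.Ext X Y n ≃ₗ[R] oExt n X Y :=
  (exists_compare (projectiveResolution X) Y n).choose

lemma cmp_natural {X X' : ModuleCat.{u} R} (g : X ⟶ X') (Y : ModuleCat.{u} R) (n : ℕ)
    (ξ : Abelian.Ext X' Y n) :
    cmpExt X Y n ((Abelian.Ext.mk₀ g).comp ξ (zero_add n)) =
      (((Ext R (ModuleCat.{u} R) n).map g.op).app Y).hom (cmpExt X' Y n ξ) := by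
  obtain ⟨z, rfl⟩ := newElt_surj (projectiveResolution X') Y n ξ
  have hspec := (exists_compare (projectiveResolution X') Y n).choose_spec z
  change cmpExt X' Y n _ = _ at hspec
  rw [hspec]
  let φ := ProjectiveResolution.lift g (projectiveResolution X) (projectiveResolution X')
  have comm : φ.f 0 ≫ (projectiveResolution X').π.f 0 = (projectiveResolution X).π.f 0 ≫ g :=
    ProjectiveResolution.lift_commutes_zero g _ _
  have h1 := ProjectiveResolution.mk₀_comp_extMk z.1 (n+1) rfl (coZ_prop z)
    (R' := projectiveResolution X) (g := g) ⟨φ, comm⟩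
  have hz : (projectiveResolution X).complex.d (n+1) n ≫ φ.f n ≫ z.1 = 0 := by
    have : (projectiveResolution X').complex.d (n+1) n ≫ z.1 = 0 := z.2
    rw [← φ.comm_assoc, this, Limits.comp_zero]
  change cmpExt X Y n ((Abelian.Ext.mk₀ g).comp ((projectiveResolution X').extMk z.1 (n+1) rfl (coZ_prop z)) _)
    = _
  rw [h1]
  have hspec2 := (exists_compare (projectiveResolution X) Y n).choose_spec ⟨φ.f n ≫ z.1, hz⟩
  refine hspec2.trans ?_
  have h3 := oldMor_natural g _ _ φ comm Y n z.1 (coZ_prop z) hz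
  change (oldMor _ Y n _ hz).unop.hom (1 : R) = _
  rw [← h3]
  rfl

end Compare

end Part2

section Part3
open CategoryTheory IsLocalRing
open Opposite

section ColimEval
open Limits
variable {R : Type u} [CommRing R] {J : Type} [SmallCategory J] [IsFiltered J]

instance forget_pres : PreservesColimitsOfShape J (forget (ModuleCat.{u} R)) := by
  have : PreservesFilteredColimitsOfSize.{u, u} (forget (ModuleCat.{u} R)) := inferInstance
  have : PreservesFilteredColimitsOfSize.{0, 0} (forget (ModuleCat.{u} R)) :=
    preservesFilteredColimitsOfSize_shrink.{0, u, 0, u} _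
  infer_instance

noncomputable def evCocone (F : J ⥤ ModuleCat.{u} R ⥤ ModuleCat.{u} R) (M : ModuleCat.{u} R) :
    IsColimit (((evaluation _ _).obj M).mapCocone (colimit.cocone F)) :=
  isColimitOfPreserves ((evaluation _ _).obj M) (colimit.isColimit F)

lemma ev_surj (F : J ⥤ ModuleCat.{u} R ⥤ ModuleCat.{u} R) (M : ModuleCat.{u} R)
    (x : ((colimit F).obj M : ModuleCat.{u} R)) :
    ∃ (j : J) (y : (F.obj j).obj M), ((colimit.ι F j).app M).hom y = x := by
  obtain ⟨j, y, h⟩ := Concrete.isColimit_exists_rep _ (evCocone F M) x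
  exact ⟨j, y, h⟩

lemma ev_zero (F : J ⥤ ModuleCat.{u} R ⥤ ModuleCat.{u} R) (M : ModuleCat.{u} R) (j : J)
    (y : (F.obj j).obj M) (h : ((colimit.ι F j).app M).hom y = 0) :
    ∃ (k : J) (f : j ⟶ k), ((F.map f).app M).hom y = 0 := by
  obtain ⟨k, f, g, h⟩ := Concrete.isColimit_exists_of_rep_eq _ (evCocone F M) (i := j) (j := j) y
    (0 : (F.obj j).obj M) (by
      refine Eq.trans h ?_
      exact (map_zero ((colimit.ι F j).app M).hom).symm)
  refine ⟨k, f, ?_⟩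
  refine Eq.trans h ?_
  exact (map_zero ((F.map g).app M).hom)

lemma ev_comp (F : J ⥤ ModuleCat.{u} R ⥤ ModuleCat.{u} R) (M : ModuleCat.{u} R) {j k : J}
    (f : j ⟶ k) (y : (F.obj j).obj M) :
    ((colimit.ι F k).app M).hom (((F.map f).app M).hom y) = ((colimit.ι F j).app M).hom y := by
  have h := congrArg (fun t : F.obj j ⟶ colimit F => (NatTrans.app t M).hom y) (colimit.w F f)
  exact h

end ColimEval

section LC
variable {R : Type u} [CommRing R]

noncomputable abbrev qM (𝔞 : Ideal R) (t : ℕ) : ModuleCat.{u} R := ModuleCat.of R (R ⧸ 𝔞 ^ t)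

noncomputable def qT (𝔞 : Ideal R) {s t : ℕ} (h : t ≤ s) : qM 𝔞 s ⟶ qM 𝔞 t :=
  ModuleCat.ofHom (Submodule.mapQ _ _ LinearMap.id (Ideal.pow_le_pow_right h))

abbrev EX (A B : ModuleCat.{u} R) (i : ℕ) := Abelian.Ext A B i

/-- restriction `Ext^i(R/𝔞^t, M) → Ext^i(R/𝔞^s, M)` -/
noncomputable def rs (𝔞 : Ideal R) {s t : ℕ} (h : t ≤ s) (M : ModuleCat.{u} R) (i : ℕ)
    (ξ : EX (qM 𝔞 t) M i) : EX (qM 𝔞 s) M i :=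
  (Abelian.Ext.mk₀ (qT 𝔞 h)).comp ξ (zero_add i)

noncomputable def lI (𝔞 : Ideal R) (i : ℕ) (M : Type u) [AddCommGroup M] [Module R M] (t : ℕ) :
    EX (qM 𝔞 t) (ModuleCat.of R M) i →ₗ[R] lcoh R 𝔞 i M :=
  ((Limits.colimit.ι (localCohomology.diagram (localCohomology.idealPowersDiagram 𝔞) i)
    (op (op t))).app (ModuleCat.of R M)).hom ∘ₗ (cmpExt (qM 𝔞 t) (ModuleCat.of R M) i).toLinearMap

variable (𝔞 : Ideal R) (i : ℕ) (M : Type u) [AddCommGroup M] [Module R M]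

lemma lI_rs {s t : ℕ} (h : t ≤ s) (ξ : EX (qM 𝔞 t) (ModuleCat.of R M) i) :
    lI 𝔞 i M s (rs 𝔞 h _ i ξ) = lI 𝔞 i M t ξ := by
  have h1 := cmp_natural (qT 𝔞 h) (ModuleCat.of R M) i ξ
  let f : (op s : ℕᵒᵖ) ⟶ (op t : ℕᵒᵖ) := (homOfLE h).op
  have h2 := ev_comp (localCohomology.diagram (localCohomology.idealPowersDiagram 𝔞) i)
    (ModuleCat.of R M) (f.op) (cmpExt (qM 𝔞 t) (ModuleCat.of R M) i ξ)
  refine Eq.trans ?_ h2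
  exact congrArg _ h1

lemma lI_surj (x : lcoh R 𝔞 i M) : ∃ t ξ, lI 𝔞 i M t ξ = x := by
  obtain ⟨j, y, h⟩ := ev_surj (localCohomology.diagram (localCohomology.idealPowersDiagram 𝔞) i)
    (ModuleCat.of R M) x
  refine ⟨j.unop.unop, (cmpExt (qM 𝔞 j.unop.unop) (ModuleCat.of R M) i).symm y, ?_⟩
  refine Eq.trans ?_ h
  exact congrArg _ ((cmpExt (qM 𝔞 j.unop.unop) (ModuleCat.of R M) i).apply_symm_apply y)

lemma lI_zero {t : ℕ} (ξ : EX (qM 𝔞 t) (ModuleCat.of R M) i) (h : lI 𝔞 i M t ξ = 0) :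
    ∃ s, ∃ h : t ≤ s, rs 𝔞 h _ i ξ = 0 := by
  obtain ⟨k, f, h⟩ := ev_zero (localCohomology.diagram (localCohomology.idealPowersDiagram 𝔞) i)
    (ModuleCat.of R M) (op (op t)) (cmpExt (qM 𝔞 t) (ModuleCat.of R M) i ξ) h
  have hts : t ≤ k.unop.unop := leOfHom f.unop.unop
  refine ⟨k.unop.unop, hts, ?_⟩
  have h1 := cmp_natural (qT 𝔞 hts) (ModuleCat.of R M) i ξ
  have h3 := h1.trans h
  exact (LinearEquiv.map_eq_zero_iff _).mp h3

/-- Two jointly surjective compatible families with the same kernels. -/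
lemma equiv_of_families {Z : ℕ → Type*} [∀ t, AddCommGroup (Z t)] [∀ t, Module R (Z t)]
    {A B : Type*} [AddCommGroup A] [Module R A] [AddCommGroup B] [Module R B]
    (f : ∀ t, Z t →ₗ[R] A) (g : ∀ t, Z t →ₗ[R] B)
    (hT : ∀ t s, t ≤ s → ∀ z : Z t, ∃ z' : Z s, f s z' = f t z ∧ g s z' = g t z)
    (hf : ∀ a, ∃ t z, f t z = a) (hg : ∀ b, ∃ t z, g t z = b)
    (hk : ∀ t z, f t z = 0 ↔ g t z = 0) : Nonempty (A ≃ₗ[R] B) := by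
  classical
  let F : (DirectSum ℕ Z) →ₗ[R] A := DirectSum.toModule R ℕ A f
  let G : (DirectSum ℕ Z) →ₗ[R] B := DirectSum.toModule R ℕ B g
  have hF : ∀ t z, F (DirectSum.lof R ℕ Z t z) = f t z := fun t z => DirectSum.toModule_lof _ _ _
  have hG : ∀ t z, G (DirectSum.lof R ℕ Z t z) = g t z := fun t z => DirectSum.toModule_lof _ _ _
  have key : ∀ x, ∃ t z, F x = f t z ∧ G x = g t z := by
    intro x
    induction x using DirectSum.induction_on with
    | zero => exact ⟨0, 0, by simp, by simp⟩
    | of t z => exact ⟨t, z, hF t z, hG t z⟩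
    | add x y hx hy =>
      obtain ⟨t, z, h1, h2⟩ := hx
      obtain ⟨t', z', h1', h2'⟩ := hy
      obtain ⟨w, h3, h4⟩ := hT t (max t t') (le_max_left _ _) z
      obtain ⟨w', h3', h4'⟩ := hT t' (max t t') (le_max_right _ _) z'
      refine ⟨max t t', w + w', ?_, ?_⟩
      · simp [h1, h1', h3, h3']
      · simp [h2, h2', h4, h4']
  obtain ⟨e, -⟩ := equiv_of_surj F G
    (fun a => by obtain ⟨t, z, h⟩ := hf a; exact ⟨_, (hF t z).trans h⟩)
    (fun a => by obtain ⟨t, z, h⟩ := hg a; exact ⟨_, (hG t z).trans h⟩)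
    (fun x => by
      obtain ⟨t, z, h1, h2⟩ := key x
      rw [h1, h2]; exact hk t z)
  exact ⟨e⟩

end LC

end Part3

section Part4
open CategoryTheory IsLocalRing
open Opposite

section XTdef
variable (R : Type u) [CommRing R]

abbrev XT (i : ℕ) (A B : Type u) [AddCommGroup A] [Module R A] [AddCommGroup B] [Module R B] :
    Type u := Abelian.Ext (ModuleCat.of R A) (ModuleCat.of R B) i

variable {R}
variable {A B D M N N' N'' : Type u} [AddCommGroup A] [Module R A] [AddCommGroup B] [Module R B]
  [AddCommGroup D] [Module R D] [AddCommGroup M] [Module R M] [AddCommGroup N] [Module R N]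
  [AddCommGroup N'] [Module R N'] [AddCommGroup N''] [Module R N'']

structure SES (f : A →ₗ[R] B) (g : B →ₗ[R] D) : Prop where
  inj : Function.Injective f
  surj : Function.Surjective g
  ex : Function.Exact f g

section
variable {f : A →ₗ[R] B} {g : B →ₗ[R] D}

lemma SES.comp_zero (h : SES f g) : g ∘ₗ f = 0 := h.ex.linearMap_comp_eq_zero

lemma SES.apply (h : SES f g) (a : A) : g (f a) = 0 := (h.ex _).2 ⟨a, rfl⟩

abbrev SES.sc (h : SES f g) : ShortComplex (ModuleCat.{u} R) :=
  ShortComplex.mk (ModuleCat.ofHom f) (ModuleCat.ofHom g)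
    (by rw [← ModuleCat.ofHom_comp, h.comp_zero]; rfl)

lemma SES.shortExact (h : SES f g) : h.sc.ShortExact where
  exact := by
    rw [ShortComplex.ShortExact.moduleCat_exact_iff_function_exact]
    exact h.ex
  mono_f := (ModuleCat.mono_iff_injective _).2 h.inj
  epi_g := (ModuleCat.epi_iff_surjective _).2 h.surj
end

lemma SES.of_surj (g : B →ₗ[R] D) (hg : Function.Surjective g) :
    SES (LinearMap.ker g).subtype g :=
  ⟨Subtype.val_injective, hg, LinearMap.exact_subtype_ker_map g⟩

lemma SES.of_inj (f : A →ₗ[R] B) (hf : Function.Injective f) :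
    SES f (LinearMap.range f).mkQ :=
  ⟨hf, Submodule.mkQ_surjective _, LinearMap.exact_map_mkQ_range f⟩

/-- pushforward -/
noncomputable def pf (i : ℕ) (N : Type u) [AddCommGroup N] [Module R N] (f : A →ₗ[R] B) :
    XT R i N A →ₗ[R] XT R i N B :=
  (Abelian.Ext.mk₀ (ModuleCat.ofHom f)).postcompOfLinear R _ (add_zero i)

/-- pullback -/
noncomputable def pb (i : ℕ) (M : Type u) [AddCommGroup M] [Module R M] (f : A →ₗ[R] B) :
    XT R i B M →ₗ[R] XT R i A M :=
  (Abelian.Ext.mk₀ (ModuleCat.ofHom f)).precompOfLinear R _ (zero_add i)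

noncomputable def dC {f : A →ₗ[R] B} {g : B →ₗ[R] D} (h : SES f g) (i : ℕ) (N : Type u)
    [AddCommGroup N] [Module R N] : XT R i N D →ₗ[R] XT R (i+1) N A :=
  h.shortExact.extClass.postcompOfLinear R _ rfl

noncomputable def dV {f : A →ₗ[R] B} {g : B →ₗ[R] D} (h : SES f g) (i : ℕ) (M : Type u)
    [AddCommGroup M] [Module R M] : XT R i A M →ₗ[R] XT R (i+1) D M :=
  h.shortExact.extClass.precompOfLinear R _ (add_comm 1 i)

lemma pf_def (i : ℕ) (f : A →ₗ[R] B) (ξ : XT R i N A) :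
    pf i N f ξ = Abelian.Ext.comp ξ (Abelian.Ext.mk₀ (ModuleCat.ofHom f)) (add_zero i) := rfl

lemma pb_def (i : ℕ) (f : A →ₗ[R] B) (ξ : XT R i B M) :
    pb i M f ξ = Abelian.Ext.comp (Abelian.Ext.mk₀ (ModuleCat.ofHom f)) ξ (zero_add i) := rfl

lemma dC_def {f : A →ₗ[R] B} {g : B →ₗ[R] D} (h : SES f g) (i : ℕ) (ξ : XT R i N D) :
    dC h i N ξ = Abelian.Ext.comp ξ h.shortExact.extClass rfl := rfl

section
variable {f : A →ₗ[R] B} {g : B →ₗ[R] D} (h : SES f g) (i : ℕ)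

lemma exC2 (h : SES f g) (i : ℕ) : Function.Exact (pf i N f) (pf i N g) := by
  intro x
  constructor
  · intro hx
    exact Abelian.Ext.covariant_sequence_exact₂ _ h.shortExact x hx
  · rintro ⟨y, rfl⟩
    have := ((ShortComplex.ab_exact_iff_function_exact _).1
      (Abelian.Ext.covariant_sequence_exact₂' (ModuleCat.of R N) h.shortExact i))
    exact this.apply_apply_eq_zero y

lemma exC3 : Function.Exact (pf i N g) (dC h i N) := by
  intro x
  constructor
  · intro hx
    exact Abelian.Ext.covariant_sequence_exact₃ _ h.shortExact x rfl hx
  · rintro ⟨y, rfl⟩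
    have := ((ShortComplex.ab_exact_iff_function_exact _).1
      (Abelian.Ext.covariant_sequence_exact₃' (ModuleCat.of R N) h.shortExact i (i+1) rfl))
    exact this.apply_apply_eq_zero y

lemma exC1 : Function.Exact (dC h i N) (pf (i+1) N f) := by
  intro x
  constructor
  · intro hx
    exact Abelian.Ext.covariant_sequence_exact₁ _ h.shortExact x hx rfl
  · rintro ⟨y, rfl⟩
    have := ((ShortComplex.ab_exact_iff_function_exact _).1
      (Abelian.Ext.covariant_sequence_exact₁' (ModuleCat.of R N) h.shortExact i (i+1) rfl))
    exact this.apply_apply_eq_zero y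

lemma exV2 (h : SES f g) (i : ℕ) : Function.Exact (pb i M g) (pb i M f) := by
  intro x
  constructor
  · intro hx
    exact Abelian.Ext.contravariant_sequence_exact₂ h.shortExact _ x hx
  · rintro ⟨y, rfl⟩
    have := ((ShortComplex.ab_exact_iff_function_exact _).1
      (Abelian.Ext.contravariant_sequence_exact₂' h.shortExact (ModuleCat.of R M) i))
    exact this.apply_apply_eq_zero y

lemma exV1 : Function.Exact (pb i M f) (dV h i M) := by
  intro x
  constructor
  · intro hx
    exact Abelian.Ext.contravariant_sequence_exact₁ h.shortExact _ x (add_comm 1 i) hx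
  · rintro ⟨y, rfl⟩
    have := ((ShortComplex.ab_exact_iff_function_exact _).1
      (Abelian.Ext.contravariant_sequence_exact₁' h.shortExact (ModuleCat.of R M) i (i+1) (add_comm 1 i)))
    exact this.apply_apply_eq_zero y

lemma exV3 : Function.Exact (dV h i M) (pb (i+1) M g) := by
  intro x
  constructor
  · intro hx
    exact Abelian.Ext.contravariant_sequence_exact₃ h.shortExact _ x hx (add_comm 1 i)
  · rintro ⟨y, rfl⟩
    have := ((ShortComplex.ab_exact_iff_function_exact _).1
      (Abelian.Ext.contravariant_sequence_exact₃' h.shortExact (ModuleCat.of R M) i (i+1) (add_comm 1 i)))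
    exact this.apply_apply_eq_zero y

lemma pb_dC (φ : N →ₗ[R] N') (ξ : XT R i N' D) :
    pb (i+1) A φ (dC h i N' ξ) = dC h i N (pb i D φ ξ) := by
  rw [pb_def, dC_def, dC_def, pb_def]
  exact (Abelian.Ext.comp_assoc _ _ _ _ _ (by omega)).symm

end

lemma pb_pf (i : ℕ) (φ : N →ₗ[R] N') (f : A →ₗ[R] B) (ξ : XT R i N' A) :
    pb i B φ (pf i N' f ξ) = pf i N f (pb i A φ ξ) := by
  rw [pb_def, pf_def, pf_def, pb_def]
  exact (Abelian.Ext.comp_assoc _ _ _ _ _ (by omega)).symm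

lemma pf_comp (i : ℕ) (f : A →ₗ[R] B) (g : B →ₗ[R] D) (ξ : XT R i N A) :
    pf i N (g ∘ₗ f) ξ = pf i N g (pf i N f ξ) := by
  rw [pf_def, pf_def, pf_def]
  rw [Abelian.Ext.comp_assoc_of_third_deg_zero, Abelian.Ext.mk₀_comp_mk₀]
  rfl

lemma pb_comp (i : ℕ) (f : A →ₗ[R] B) (g : B →ₗ[R] D) (ξ : XT R i D M) :
    pb i M (g ∘ₗ f) ξ = pb i M f (pb i M g ξ) := by
  rw [pb_def, pb_def, pb_def]
  rw [Abelian.Ext.mk₀_comp_mk₀_assoc]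
  rfl

lemma pf_id (i : ℕ) (ξ : XT R i N A) : pf i N (LinearMap.id : A →ₗ[R] A) ξ = ξ := by
  exact Abelian.Ext.comp_mk₀_id ξ

lemma pb_id (i : ℕ) (ξ : XT R i A M) : pb i M (LinearMap.id : A →ₗ[R] A) ξ = ξ := by
  exact Abelian.Ext.mk₀_id_comp ξ

lemma pb_zero (i : ℕ) (ξ : XT R i B M) : pb i M (0 : A →ₗ[R] B) ξ = 0 := by
  rw [pb_def, ModuleCat.ofHom_zero, Abelian.Ext.mk₀_zero, Abelian.Ext.zero_comp]

lemma pf_smul (i : ℕ) (r : R) (f : A →ₗ[R] B) (ξ : XT R i N A) :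
    pf i N (r • f) ξ = r • pf i N f ξ := by
  rw [pf_def, pf_def, show ModuleCat.ofHom (r • f) = r • ModuleCat.ofHom f from rfl]
  rw [Abelian.Ext.mk₀_smul, Abelian.Ext.comp_smul]

lemma pb_smul (i : ℕ) (r : R) (f : A →ₗ[R] B) (ξ : XT R i B M) :
    pb i M (r • f) ξ = r • pb i M f ξ := by
  rw [pb_def, pb_def, show ModuleCat.ofHom (r • f) = r • ModuleCat.ofHom f from rfl]
  rw [Abelian.Ext.mk₀_smul, Abelian.Ext.smul_comp]

noncomputable def h0 : (A →ₗ[R] B) ≃ₗ[R] XT R 0 A B :=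
  (ModuleCat.homLinearEquiv (S := R) (M := ModuleCat.of R A) (N := ModuleCat.of R B)).symm.trans
    (Abelian.Ext.linearEquiv₀ (R := R)).symm

lemma h0_apply (f : A →ₗ[R] B) : h0 f = Abelian.Ext.mk₀ (ModuleCat.ofHom f) := rfl

lemma pf_h0 (f : A →ₗ[R] B) (g : B →ₗ[R] D) : pf 0 A g (h0 f) = h0 (g ∘ₗ f) := by
  exact Abelian.Ext.mk₀_comp_mk₀ _ _

lemma pb_h0 (f : A →ₗ[R] B) (g : B →ₗ[R] D) : pb 0 D f (h0 g) = h0 (g ∘ₗ f) := by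
  exact Abelian.Ext.mk₀_comp_mk₀ _ _

noncomputable def pfE (i : ℕ) (N : Type u) [AddCommGroup N] [Module R N] (e : A ≃ₗ[R] B) :
    XT R i N A ≃ₗ[R] XT R i N B :=
  LinearEquiv.ofLinear (pf i N e.toLinearMap) (pf i N e.symm.toLinearMap)
    (by ext ξ; simp [← pf_comp, pf_id]) (by ext ξ; simp [← pf_comp, pf_id])

noncomputable def pbE (i : ℕ) (M : Type u) [AddCommGroup M] [Module R M] (e : A ≃ₗ[R] B) :
    XT R i A M ≃ₗ[R] XT R i B M :=
  LinearEquiv.ofLinear (pb i M e.symm.toLinearMap) (pb i M e.toLinearMap)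
    (by ext ξ; simp [← pb_comp, pb_id]) (by ext ξ; simp [← pb_comp, pb_id])

lemma xt_inj [Module.Injective R B] (i : ℕ) : Subsingleton (XT R (i+1) A B) := by
  have : Injective (ModuleCat.of R B) := (Module.injective_iff_injective_object R B).1 inferInstance
  exact subsingleton_of_forall_eq 0 fun x => Abelian.Ext.eq_zero_of_injective x

lemma xt_proj [Module.Projective R A] (i : ℕ) : Subsingleton (XT R (i+1) A B) := by
  have : Projective (ModuleCat.of R A) := (IsProjective.iff_projective (R := R) A).1 inferInstance
  exact subsingleton_of_forall_eq 0 fun x => Abelian.Ext.eq_zero_of_projective x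

lemma xt_sub_left [Subsingleton A] (i : ℕ) : Subsingleton (XT R i A B) := by
  refine subsingleton_of_forall_eq 0 fun x => ?_
  rw [← pb_id i x, Subsingleton.elim (LinearMap.id : A →ₗ[R] A) 0, pb_zero]

lemma xt_sub_right [Subsingleton B] (i : ℕ) : Subsingleton (XT R i A B) := by
  refine subsingleton_of_forall_eq 0 fun x => ?_
  rw [← pf_id i x, Subsingleton.elim (LinearMap.id : B →ₗ[R] B) ((0:R) • LinearMap.id), pf_smul, zero_smul]

lemma exists_inj_embed (M : Type u) [AddCommGroup M] [Module R M] :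
    ∃ (J : Type u) (_ : AddCommGroup J) (_ : Module R J) (f : M →ₗ[R] J),
      Module.Injective R J ∧ Function.Injective f := by
  let J := Injective.under (ModuleCat.of R M)
  let f := Injective.ι (ModuleCat.of R M)
  have : Injective (ModuleCat.of R J) := inferInstanceAs (Injective (Injective.under _))
  refine ⟨J, inferInstance, inferInstance, f.hom, ?_, ?_⟩
  · exact (Module.injective_iff_injective_object R J).2 this
  · exact (ModuleCat.mono_iff_injective _).1 inferInstance

/-- exactness vanishing helper -/
lemma sub_mid {X Y Z : Type*} [AddCommGroup X] [AddCommGroup Y] [AddCommGroup Z] [Module R X]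
    [Module R Y] [Module R Z] {f : X →ₗ[R] Y} {g : Y →ₗ[R] Z} (h : Function.Exact f g)
    (hX : Subsingleton X) (hZ : Subsingleton Z) : Subsingleton Y := by
  refine subsingleton_of_forall_eq 0 fun y => ?_
  obtain ⟨x, rfl⟩ := (h y).1 (Subsingleton.elim _ _)
  rw [Subsingleton.elim x 0, map_zero]

lemma inj_of_sub {X Y Z : Type*} [AddCommGroup X] [AddCommGroup Y] [AddCommGroup Z] [Module R X]
    [Module R Y] [Module R Z] {f : X →ₗ[R] Y} {g : Y →ₗ[R] Z} (h : Function.Exact f g)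
    (hX : Subsingleton X) : Function.Injective g := by
  rw [injective_iff_map_eq_zero]
  intro y hy
  obtain ⟨x, rfl⟩ := (h y).1 hy
  rw [Subsingleton.elim x 0, map_zero]

lemma surj_of_sub {X Y Z : Type*} [AddCommGroup X] [AddCommGroup Y] [AddCommGroup Z] [Module R X]
    [Module R Y] [Module R Z] {f : X →ₗ[R] Y} {g : Y →ₗ[R] Z} (h : Function.Exact f g)
    (hZ : Subsingleton Z) : Function.Surjective f := by
  intro y
  exact (h y).1 (Subsingleton.elim _ _)

section
variable {f : A →ₗ[R] B} {g : B →ₗ[R] D} (h : SES f g) (i : ℕ)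

noncomputable def dCE (h1 : Subsingleton (XT R i N B)) (h2 : Subsingleton (XT R (i+1) N B)) :
    XT R i N D ≃ₗ[R] XT R (i+1) N A :=
  LinearEquiv.ofBijective (dC h i N) ⟨inj_of_sub (exC3 h i) h1, surj_of_sub (exC1 h i) h2⟩

noncomputable def dVE (h1 : Subsingleton (XT R i B M)) (h2 : Subsingleton (XT R (i+1) B M)) :
    XT R i A M ≃ₗ[R] XT R (i+1) D M :=
  LinearEquiv.ofBijective (dV h i M) ⟨inj_of_sub (exV1 h i) h1, surj_of_sub (exV3 h i) h2⟩

end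

end XTdef

end Part4

section Part5
open CategoryTheory IsLocalRing
open Opposite

section LC2
variable {R : Type u} [CommRing R]

/-- The `𝔞`-torsion submodule. -/
def gam (𝔞 : Ideal R) (M : Type*) [AddCommGroup M] [Module R M] : Submodule R M where
  carrier := {m | ∃ t : ℕ, ∀ a ∈ 𝔞 ^ t, a • m = 0}
  add_mem' := by
    rintro x y ⟨t, ht⟩ ⟨s, hs⟩
    refine ⟨t + s, fun a ha => ?_⟩
    rw [smul_add, ht a (Ideal.pow_le_pow_right (Nat.le_add_right _ _) ha),
      hs a (Ideal.pow_le_pow_right (Nat.le_add_left _ _) ha), add_zero]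
  zero_mem' := ⟨0, fun a _ => smul_zero a⟩
  smul_mem' := by
    rintro r x ⟨t, ht⟩
    refine ⟨t, fun a ha => ?_⟩
    rw [smul_comm, ht a ha, smul_zero]

lemma mem_gam {𝔞 : Ideal R} {M : Type*} [AddCommGroup M] [Module R M] {m : M} :
    m ∈ gam 𝔞 M ↔ ∃ t : ℕ, ∀ a ∈ 𝔞 ^ t, a • m = 0 := Iff.rfl

lemma gam_map {𝔞 : Ideal R} {M N : Type*} [AddCommGroup M] [Module R M] [AddCommGroup N]
    [Module R N] (f : M →ₗ[R] N) {m : M} (h : m ∈ gam 𝔞 M) : f m ∈ gam 𝔞 N := by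
  obtain ⟨t, ht⟩ := h
  exact ⟨t, fun a ha => by rw [← map_smul, ht a ha, map_zero]⟩

lemma gam_of_inj {𝔞 : Ideal R} {M N : Type*} [AddCommGroup M] [Module R M] [AddCommGroup N]
    [Module R N] (f : M →ₗ[R] N) (hf : Function.Injective f) {m : M} (h : f m ∈ gam 𝔞 N) :
    m ∈ gam 𝔞 M := by
  obtain ⟨t, ht⟩ := h
  exact ⟨t, fun a ha => hf (by rw [map_smul, ht a ha, map_zero])⟩

/-- transition maps -/
abbrev qL (𝔞 : Ideal R) {s t : ℕ} (h : t ≤ s) : (R ⧸ 𝔞 ^ s) →ₗ[R] (R ⧸ 𝔞 ^ t) :=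
  Submodule.mapQ _ _ LinearMap.id (Ideal.pow_le_pow_right h)

lemma qL_one (𝔞 : Ideal R) {s t : ℕ} (h : t ≤ s) : qL 𝔞 h 1 = 1 := rfl

lemma qL_comp (𝔞 : Ideal R) {s t r : ℕ} (h : t ≤ s) (h' : s ≤ r) :
    qL 𝔞 h ∘ₗ qL 𝔞 h' = qL 𝔞 (h.trans h') := by
  apply Submodule.linearMap_qext; rfl

lemma hom_quot_ext {I : Ideal R} {M : Type*} [AddCommGroup M] [Module R M]
    {f g : (R ⧸ I) →ₗ[R] M} (h : f 1 = g 1) : f = g := by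
  apply Submodule.linearMap_qext
  apply LinearMap.ext_ring
  exact h

lemma hom_quot_exists {I : Ideal R} {M : Type*} [AddCommGroup M] [Module R M] (m : M)
    (h : ∀ a ∈ I, a • m = 0) : ∃ f : (R ⧸ I) →ₗ[R] M, f 1 = m :=
  ⟨Submodule.liftQ I (LinearMap.toSpanSingleton R M m) (fun a ha => h a ha), by
    change LinearMap.toSpanSingleton R M m 1 = m; simp⟩

lemma hom_quot_kill {I : Ideal R} {M : Type*} [AddCommGroup M] [Module R M]
    (f : (R ⧸ I) →ₗ[R] M) (a : R) (ha : a ∈ I) : a • f 1 = 0 := by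
  rw [← map_smul]
  have : a • (1 : R ⧸ I) = 0 := by
    rw [Algebra.smul_def, mul_one]
    exact Ideal.Quotient.eq_zero_iff_mem.2 ha
  rw [this, map_zero]

variable (𝔞 : Ideal R)

def evG (M : Type u) [AddCommGroup M] [Module R M] (t : ℕ) :
    ((R ⧸ 𝔞 ^ t) →ₗ[R] M) →ₗ[R] gam 𝔞 M where
  toFun f := ⟨f 1, t, fun a ha => hom_quot_kill f a ha⟩
  map_add' _ _ := rfl
  map_smul' _ _ := rfl

variable (i : ℕ) (M : Type u) [AddCommGroup M] [Module R M]

noncomputable abbrev lJ (t : ℕ) : XT R i (R ⧸ 𝔞 ^ t) M →ₗ[R] lcoh R 𝔞 i M := lI 𝔞 i M t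

lemma lJ_pb {s t : ℕ} (h : t ≤ s) (ξ : XT R i (R ⧸ 𝔞 ^ t) M) :
    lJ 𝔞 i M s (pb i M (qL 𝔞 h) ξ) = lJ 𝔞 i M t ξ := lI_rs 𝔞 i M h ξ

lemma lJ_zero {t : ℕ} (ξ : XT R i (R ⧸ 𝔞 ^ t) M) (h : lJ 𝔞 i M t ξ = 0) :
    ∃ s, ∃ h : t ≤ s, pb i M (qL 𝔞 h) ξ = 0 := lI_zero 𝔞 i M ξ h

lemma lJ_eq_zero_iff {t : ℕ} (ξ : XT R i (R ⧸ 𝔞 ^ t) M) : lJ 𝔞 i M t ξ = 0 ↔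
    ∃ s, ∃ h : t ≤ s, pb i M (qL 𝔞 h) ξ = 0 :=
  ⟨lJ_zero 𝔞 i M ξ, fun ⟨s, h, h'⟩ => by rw [← lJ_pb 𝔞 i M h, h', map_zero]⟩

lemma lJ_surj (x : lcoh R 𝔞 i M) : ∃ t ξ, lJ 𝔞 i M t ξ = x := lI_surj 𝔞 i M x

lemma lc_vanish_iff : Subsingleton (lcoh R 𝔞 i M) ↔
    ∀ t (ξ : XT R i (R ⧸ 𝔞 ^ t) M), ∃ s, ∃ h : t ≤ s, pb i M (qL 𝔞 h) ξ = 0 := by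
  constructor
  · intro _ t ξ
    exact lJ_zero 𝔞 i M ξ (Subsingleton.elim _ _)
  · intro h
    refine subsingleton_of_forall_eq 0 fun x => ?_
    obtain ⟨t, ξ, rfl⟩ := lJ_surj 𝔞 i M x
    exact (lJ_eq_zero_iff 𝔞 i M ξ).2 (h t ξ)

lemma lc0 : Nonempty (lcoh R 𝔞 0 M ≃ₗ[R] gam 𝔞 M) := by
  refine equiv_of_families (fun t => lJ 𝔞 0 M t ∘ₗ h0.toLinearMap) (fun t => evG 𝔞 M t) ?_ ?_ ?_ ?_
  · intro t s h z
    refine ⟨z ∘ₗ qL 𝔞 h, ?_, rfl⟩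
    change lJ 𝔞 0 M s (h0 _) = lJ 𝔞 0 M t (h0 z)
    rw [← pb_h0, lJ_pb]
  · intro x
    obtain ⟨t, ξ, rfl⟩ := lJ_surj 𝔞 0 M x
    exact ⟨t, h0.symm ξ, by simp⟩
  · rintro ⟨m, t, ht⟩
    obtain ⟨f, hf⟩ := hom_quot_exists m ht
    exact ⟨t, f, Subtype.ext hf⟩
  · intro t z
    change lJ 𝔞 0 M t (h0 z) = 0 ↔ _
    rw [lJ_eq_zero_iff]
    constructor
    · rintro ⟨s, h, h'⟩
      rw [pb_h0, LinearEquiv.map_eq_zero_iff] at h'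
      apply Subtype.ext
      exact congrArg (fun f => f 1) h'
    · intro h
      have : z = 0 := hom_quot_ext (congrArg Subtype.val h)
      exact ⟨t, le_rfl, by rw [this, map_zero, map_zero]⟩

variable {𝔞} {M}
variable {J M' : Type u} [AddCommGroup J] [Module R J] [AddCommGroup M'] [Module R M']

lemma lc_shift [Module.Injective R J] {f : M →ₗ[R] J} {g : J →ₗ[R] M'} (h : SES f g) :
    Nonempty (lcoh R 𝔞 (i+1) M' ≃ₗ[R] lcoh R 𝔞 (i+2) M) := by
  have inj : ∀ t, Function.Injective (dC h (i+1) (R ⧸ 𝔞 ^ t)) :=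
    fun t => inj_of_sub (exC3 h (i+1)) (xt_inj i)
  have sur : ∀ t, Function.Surjective (dC h (i+1) (R ⧸ 𝔞 ^ t)) :=
    fun t => surj_of_sub (exC1 h (i+1)) (xt_inj (i+1))
  refine equiv_of_families (fun t => lJ 𝔞 (i+1) M' t)
    (fun t => lJ 𝔞 (i+2) M t ∘ₗ dC h (i+1) _) ?_ ?_ ?_ ?_
  · intro t s hs z
    refine ⟨pb _ _ (qL 𝔞 hs) z, lJ_pb _ _ _ hs z, ?_⟩
    change lJ 𝔞 (i+2) M s _ = lJ 𝔞 (i+2) M t _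
    rw [← pb_dC, lJ_pb]
  · intro x; exact lJ_surj _ _ _ x
  · intro x
    obtain ⟨t, ξ, rfl⟩ := lJ_surj _ _ _ x
    obtain ⟨z, rfl⟩ := sur t ξ
    exact ⟨t, z, rfl⟩
  · intro t z
    change _ ↔ lJ 𝔞 (i+2) M t (dC h (i+1) _ z) = 0
    rw [lJ_eq_zero_iff, lJ_eq_zero_iff]
    refine exists_congr fun s => exists_congr fun hs => ?_
    rw [pb_dC, map_eq_zero_iff _ (inj s)]

lemma lc1_iff [Module.Injective R J] {f : M →ₗ[R] J} {g : J →ₗ[R] M'} (h : SES f g) :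
    Subsingleton (lcoh R 𝔞 1 M) ↔ ∀ m ∈ gam 𝔞 M', ∃ j ∈ gam 𝔞 J, g j = m := by
  rw [lc_vanish_iff]
  constructor
  · rintro hv m ⟨t, ht⟩
    obtain ⟨z, rfl⟩ := hom_quot_exists m ht
    obtain ⟨s, hs, h'⟩ := hv t (dC h 0 _ (h0 z))
    rw [pb_dC, pb_h0] at h'
    obtain ⟨w, hw⟩ := (exC3 h 0 _).1 h'
    obtain ⟨w, rfl⟩ := h0.surjective w
    rw [pf_h0] at hw
    have := h0.injective hw
    refine ⟨w 1, (evG 𝔞 J s w).2, ?_⟩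
    exact congrArg (fun f => f 1) this
  · intro hg t ξ
    obtain ⟨z, rfl⟩ := surj_of_sub (exC1 (N := R ⧸ 𝔞 ^ t) h 0) (xt_inj 0) ξ
    obtain ⟨z, rfl⟩ := h0.surjective z
    obtain ⟨j, ⟨s, hs⟩, hj⟩ := hg (z 1) (evG 𝔞 M' t z).2
    obtain ⟨w, rfl⟩ := hom_quot_exists (I := 𝔞 ^ (t + s)) j
      (fun a ha => hs a (Ideal.pow_le_pow_right (Nat.le_add_left _ _) ha))
    refine ⟨t + s, Nat.le_add_right _ _, ?_⟩
    rw [pb_dC, pb_h0]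
    apply (exC3 h 0 _).2
    refine ⟨h0 w, ?_⟩
    rw [pf_h0]
    congr 1
    apply hom_quot_ext
    exact hj

lemma lc1_shift [Module.Injective R J] {f : M →ₗ[R] J} {g : J →ₗ[R] M'} (h : SES f g)
    (hJ : gam 𝔞 J = ⊥) : Nonempty (lcoh R 𝔞 0 M' ≃ₗ[R] lcoh R 𝔞 1 M) := by
  have hz : ∀ t, Subsingleton (XT R 0 (R ⧸ 𝔞 ^ t) J) := by
    intro t
    refine subsingleton_of_forall_eq 0 fun x => ?_
    obtain ⟨w, rfl⟩ := h0.surjective x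
    have : w 1 ∈ gam 𝔞 J := (evG 𝔞 J t w).2
    rw [hJ, Submodule.mem_bot] at this
    have : w = 0 := hom_quot_ext this
    rw [this, map_zero]
  have inj : ∀ t, Function.Injective (dC h 0 (R ⧸ 𝔞 ^ t)) :=
    fun t => inj_of_sub (exC3 h 0) (hz t)
  have sur : ∀ t, Function.Surjective (dC h 0 (R ⧸ 𝔞 ^ t)) :=
    fun t => surj_of_sub (exC1 h 0) (xt_inj 0)
  refine equiv_of_families (fun t => lJ 𝔞 0 M' t)
    (fun t => lJ 𝔞 1 M t ∘ₗ dC h 0 _) ?_ ?_ ?_ ?_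
  · intro t s hs z
    refine ⟨pb _ _ (qL 𝔞 hs) z, lJ_pb _ _ _ hs z, ?_⟩
    change lJ 𝔞 1 M s _ = lJ 𝔞 1 M t _
    rw [← pb_dC, lJ_pb]
  · intro x; exact lJ_surj _ _ _ x
  · intro x
    obtain ⟨t, ξ, rfl⟩ := lJ_surj _ _ _ x
    obtain ⟨z, rfl⟩ := sur t ξ
    exact ⟨t, z, rfl⟩
  · intro t z
    change _ ↔ lJ 𝔞 1 M t (dC h 0 _ z) = 0
    rw [lJ_eq_zero_iff, lJ_eq_zero_iff]
    refine exists_congr fun s => exists_congr fun hs => ?_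
    rw [pb_dC, map_eq_zero_iff _ (inj s)]

/-- shift in all degrees for torsion-free injective -/
lemma lc_shift' [Module.Injective R J] {f : M →ₗ[R] J} {g : J →ₗ[R] M'} (h : SES f g)
    (hJ : gam 𝔞 J = ⊥) (i : ℕ) : Nonempty (lcoh R 𝔞 i M' ≃ₗ[R] lcoh R 𝔞 (i+1) M) := by
  cases i with
  | zero => exact lc1_shift h hJ
  | succ i => exact lc_shift i h

/-- iso invariance -/
lemma lc_iso (e : M ≃ₗ[R] M') : Nonempty (lcoh R 𝔞 i M ≃ₗ[R] lcoh R 𝔞 i M') :=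
  ⟨((localCohomology 𝔞 i).mapIso (e.toModuleIso (X₁ := M) (X₂ := M'))).toLinearEquiv⟩

variable {A B D : Type u} [AddCommGroup A] [Module R A] [AddCommGroup B] [Module R B]
  [AddCommGroup D] [Module R D] {f : A →ₗ[R] B} {g : B →ₗ[R] D}

lemma lc_ext (h : SES f g) (hA : Subsingleton (lcoh R 𝔞 i A)) (hD : Subsingleton (lcoh R 𝔞 i D)) :
    Subsingleton (lcoh R 𝔞 i B) := by
  rw [lc_vanish_iff] at *
  intro t ξ
  obtain ⟨s, hs, h1⟩ := hD t (pf i _ g ξ)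
  rw [pb_pf] at h1
  obtain ⟨η, hη⟩ := (exC2 h i _).1 h1
  obtain ⟨r, hr, h2⟩ := hA s η
  refine ⟨r, hs.trans hr, ?_⟩
  rw [← qL_comp 𝔞 hs hr, pb_comp, ← hη, pb_pf, h2, map_zero]

lemma lc_coker (h : SES f g) (hB : Subsingleton (lcoh R 𝔞 i B))
    (hA : Subsingleton (lcoh R 𝔞 (i+1) A)) : Subsingleton (lcoh R 𝔞 i D) := by
  rw [lc_vanish_iff] at *
  intro t ξ
  obtain ⟨s, hs, h1⟩ := hA t (dC h i _ ξ)
  rw [pb_dC] at h1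
  obtain ⟨η, hη⟩ := (exC3 h i _).1 h1
  obtain ⟨r, hr, h2⟩ := hB s η
  refine ⟨r, hs.trans hr, ?_⟩
  rw [← qL_comp 𝔞 hs hr, pb_comp, ← hη, pb_pf, h2, map_zero]

lemma lc_inj [Module.Injective R J] (i : ℕ) : Subsingleton (lcoh R 𝔞 (i+1) J) := by
  rw [lc_vanish_iff]
  intro t ξ
  have := xt_inj (R := R) (A := R ⧸ 𝔞 ^ t) (B := J) i
  exact ⟨t, le_rfl, by rw [Subsingleton.elim ξ 0, map_zero]⟩

end LC2

end Part5

section Part6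
open CategoryTheory IsLocalRing
open Opposite

section Gam
variable {R : Type u} [CommRing R]

lemma inj_of_retract {A B : Type u} [AddCommGroup A] [Module R A] [AddCommGroup B] [Module R B]
    [hB : Module.Injective R B] (i : A →ₗ[R] B) (r : B →ₗ[R] A) (h : ∀ a, r (i a) = a) :
    Module.Injective R A where
  out X Y _ _ _ _ f hf g := by
    obtain ⟨k, hk⟩ := hB.out f hf (i ∘ₗ g)
    exact ⟨r ∘ₗ k, fun x => by simp [hk, h]⟩

lemma inj_of_equiv {A B : Type u} [AddCommGroup A] [Module R A] [AddCommGroup B] [Module R B]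
    [hB : Module.Injective R B] (e : A ≃ₗ[R] B) : Module.Injective R A :=
  inj_of_retract e.toLinearMap e.symm.toLinearMap (by simp)

lemma gam_injective [IsNoetherianRing R] (𝔞 : Ideal R) (J : Type u) [AddCommGroup J] [Module R J]
    [hJ : Module.Injective R J] : Module.Injective R (gam 𝔞 J) := by
  apply Module.Baer.injective
  intro I g
  -- a power killing the image
  have h1 : ∃ t : ℕ, ∀ x : I, ∀ a ∈ 𝔞 ^ t, a • g x = 0 := by
    obtain ⟨S, hS⟩ := (isNoetherian_def.1 (inferInstance : IsNoetherian R I)) (⊤ : Submodule R I)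
    choose T hT using fun x : I => (g x).2
    refine ⟨S.sup T, fun x => ?_⟩
    have hx : x ∈ Submodule.span R (S : Set I) := by rw [hS]; trivial
    induction hx using Submodule.span_induction with
    | mem x hx =>
      intro a ha
      apply Subtype.ext
      exact hT x a (Ideal.pow_le_pow_right (Finset.le_sup hx) ha)
    | zero => intro a _; simp
    | add x y _ _ hx hy => intro a ha; rw [map_add, smul_add, hx a ha, hy a ha, add_zero]
    | smul r x _ hx => intro a ha; rw [map_smul, smul_comm, hx a ha, smul_zero]
  obtain ⟨t, ht⟩ := h1
  obtain ⟨k, hk⟩ := Ideal.exists_pow_inf_eq_pow_smul 𝔞 (I : Submodule R R)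
  let n := k + t
  have h2 : ∀ x : I, (x : R) ∈ 𝔞 ^ n → g x = 0 := by
    intro x hx
    have h3 : (x : R) ∈ 𝔞 ^ n • (⊤ : Submodule R R) ⊓ I := by
      refine ⟨?_, x.2⟩
      rw [smul_eq_mul, Ideal.mul_top]; exact hx
    rw [hk n (Nat.le_add_right _ _), Nat.add_sub_cancel_left] at h3
    have h4 : (x : R) ∈ 𝔞 ^ t • (I : Submodule R R) := Submodule.smul_mono le_rfl inf_le_right h3
    have h5 : ∀ y ∈ 𝔞 ^ t • (I : Submodule R R), ∃ hy : y ∈ I, g ⟨y, hy⟩ = 0 := by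
      intro y hy
      induction hy using Submodule.smul_induction_on' with
      | smul a ha b hb =>
        refine ⟨I.mul_mem_left a hb, ?_⟩
        have := ht ⟨b, hb⟩ a ha
        rw [← map_smul] at this
        exact this
      | add y _ z _ hy hz =>
        obtain ⟨hy, h1⟩ := hy
        obtain ⟨hz, h2⟩ := hz
        refine ⟨I.add_mem hy hz, ?_⟩
        have : g (⟨y, hy⟩ + ⟨z, hz⟩) = 0 := by rw [map_add, h1, h2, add_zero]
        exact this
    exact (h5 _ h4).2
  let P : Submodule R I := Submodule.comap (Submodule.subtype I) (𝔞 ^ n : Ideal R)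
  let ι : (I ⧸ P) →ₗ[R] (R ⧸ 𝔞 ^ n) := Submodule.mapQ P (𝔞 ^ n : Ideal R) (Submodule.subtype I) le_rfl
  have hι : Function.Injective ι := by
    rw [← LinearMap.ker_eq_bot, Submodule.ker_mapQ]
    exact Submodule.mkQ_map_self P
  let g' : (I ⧸ P) →ₗ[R] J := Submodule.liftQ P ((gam 𝔞 J).subtype ∘ₗ g) (by
    intro x hx
    have := h2 x hx
    simp [this])
  obtain ⟨h, hh⟩ := hJ.out ι hι g'
  have hmem : h 1 ∈ gam 𝔞 J := ⟨n, fun a ha => hom_quot_kill h a ha⟩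
  refine ⟨LinearMap.toSpanSingleton R _ ⟨h 1, hmem⟩, fun x hx => ?_⟩
  apply Subtype.ext
  have h6 := hh (Submodule.Quotient.mk ⟨x, hx⟩)
  have h7 : ι (Submodule.Quotient.mk ⟨x, hx⟩) = x • (1 : R ⧸ 𝔞 ^ n) := by
    rw [Algebra.smul_def, mul_one]; rfl
  rw [h7, map_smul] at h6
  exact h6

lemma exists_inj_embed_gam [IsNoetherianRing R] (𝔞 : Ideal R) (M : Type u) [AddCommGroup M]
    [Module R M] (hM : gam 𝔞 M = ⊥) :
    ∃ (J : Type u) (_ : AddCommGroup J) (_ : Module R J) (f : M →ₗ[R] J),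
      Module.Injective R J ∧ Function.Injective f ∧ gam 𝔞 J = ⊥ := by
  obtain ⟨J, _, _, f, hJ, hf⟩ := exists_inj_embed (R := R) M
  obtain ⟨p, hp⟩ := (gam_injective 𝔞 J).out (gam 𝔞 J).subtype Subtype.val_injective LinearMap.id
  have hp' : ∀ x (hx : x ∈ gam 𝔞 J), p x = ⟨x, hx⟩ := fun x hx => hp ⟨x, hx⟩
  let r : J →ₗ[R] LinearMap.ker p :=
    (LinearMap.id - (gam 𝔞 J).subtype ∘ₗ p).codRestrict _ (by
      intro x
      have := hp' (p x : J) (p x).2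
      simp [this])
  refine ⟨LinearMap.ker p, inferInstance, inferInstance, r ∘ₗ f, ?_, ?_, ?_⟩
  · refine inj_of_retract (LinearMap.ker p).subtype r fun a => ?_
    apply Subtype.ext
    have : p a = 0 := a.2
    change (a : J) - ((p a : gam 𝔞 J) : J) = a
    rw [this]; simp
  · rw [injective_iff_map_eq_zero]
    intro x hx
    have h1 : f x - p (f x) = 0 := congrArg Subtype.val hx
    have h2 : f x ∈ gam 𝔞 J := by rw [sub_eq_zero.1 h1]; exact (p (f x)).2
    have h3 := gam_of_inj f hf h2
    rw [hM] at h3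
    exact h3
  · rw [eq_bot_iff]
    intro x hx
    have h1 : (x : J) ∈ gam 𝔞 J := gam_map (LinearMap.ker p).subtype hx
    have h2 := hp' x h1
    have h3 : p x = 0 := x.2
    rw [h3] at h2
    apply Subtype.ext
    exact (congrArg Subtype.val h2).symm

lemma gam_eq_bot_iff (𝔞 : Ideal R) (M : Type u) [AddCommGroup M] [Module R M] :
    gam 𝔞 M = ⊥ ↔ Subsingleton (lcoh R 𝔞 0 M) := by
  obtain ⟨e⟩ := lc0 𝔞 M
  rw [e.toEquiv.subsingleton_congr]
  exact (Submodule.subsingleton_iff_eq_bot).symm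

/-- Finite injective dimension via Ext. -/
def iD (R : Type u) [CommRing R] (n : ℕ) (M : Type u) [AddCommGroup M] [Module R M] : Prop :=
  ∀ (N : Type u) [AddCommGroup N] [Module R N], Subsingleton (XT R (n+1) N M)

variable {M M' : Type u} [AddCommGroup M] [Module R M] [AddCommGroup M'] [Module R M']

lemma iD.iso {n : ℕ} (h : iD R n M) (e : M ≃ₗ[R] M') : iD R n M' := by
  intro N _ _
  have := h N
  exact (pfE (n+1) N e.symm).toEquiv.subsingleton

lemma iD.succ {n : ℕ} (h : iD R n M) : iD R (n+1) M := by
  intro N _ _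
  let F := N →₀ R
  let p : F →ₗ[R] N := Finsupp.linearCombination R id
  have hp : Function.Surjective p := Finsupp.linearCombination_id_surjective R N
  have hs := SES.of_surj p hp
  have h1 := h (LinearMap.ker p)
  exact sub_mid (exV3 hs (n+1)) h1 (xt_proj (n+1))

lemma iD.mono {n m : ℕ} (h : iD R n M) (hnm : n ≤ m) : iD R m M := by
  induction hnm with
  | refl => exact h
  | step _ ih => exact ih.succ

/-- weak version: cyclic modules only -/
def fD (R : Type u) [CommRing R] (n : ℕ) (M : Type u) [AddCommGroup M] [Module R M] : Prop :=
  ∀ (I : Ideal R), Subsingleton (XT R (n+1) (R ⧸ I) M)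

lemma iD.fD {n : ℕ} (h : iD R n M) : fD R n M := fun I => h _

lemma inj_of_fD (h : fD R 0 M) : Module.Injective R M := by
  apply Module.Baer.injective
  intro I g
  have hs : SES (Submodule.subtype I) (Submodule.mkQ I) :=
    ⟨Subtype.val_injective, Submodule.mkQ_surjective _, LinearMap.exact_subtype_mkQ I⟩
  have := h I
  obtain ⟨z, hz⟩ := surj_of_sub (exV1 (M := M) hs 0) this (h0 g)
  obtain ⟨z, rfl⟩ := h0.surjective z
  rw [pb_h0] at hz
  have := h0.injective hz
  exact ⟨z, fun x hx => congrArg (fun f => f ⟨x, hx⟩) this⟩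

lemma SES.shiftF {J : Type u} [AddCommGroup J] [Module R J] [Module.Injective R J]
    {f : M →ₗ[R] J} {g : J →ₗ[R] M'} (h : SES f g) {n : ℕ} (hM : fD R (n+1) M) : fD R n M' := by
  intro I
  have := hM I
  exact (dCE h (n+1) (xt_inj n) (xt_inj (n+1))).toEquiv.subsingleton

lemma SES.shiftI {J : Type u} [AddCommGroup J] [Module R J] [Module.Injective R J]
    {f : M →ₗ[R] J} {g : J →ₗ[R] M'} (h : SES f g) {n : ℕ} (hM : iD R (n+1) M) : iD R n M' := by
  intro N _ _
  have := hM N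
  exact (dCE h (n+1) (xt_inj n) (xt_inj (n+1))).toEquiv.subsingleton

lemma SES.unshiftI {J : Type u} [AddCommGroup J] [Module R J] [Module.Injective R J]
    {f : M →ₗ[R] J} {g : J →ₗ[R] M'} (h : SES f g) {n : ℕ} (hM : iD R n M') : iD R (n+1) M := by
  intro N _ _
  have := hM N
  exact (dCE h (n+1) (xt_inj n) (xt_inj (n+1))).symm.toEquiv.subsingleton

lemma cores_of_fD (n : ℕ) : ∀ (M : Type u) [AddCommGroup M] [Module R M], fD R n M →
    CoresDimLE R (fun N => Module.Injective R N) n (ModuleCat.of R M) := by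
  induction n with
  | zero => intro M _ _ h; exact inj_of_fD h
  | succ n ih =>
    intro M _ _ h
    obtain ⟨J, _, _, f, hJ, hf⟩ := exists_inj_embed (R := R) M
    right
    exact ⟨ModuleCat.of R J, f, hJ, hf, ih _ ((SES.of_inj f hf).shiftF h)⟩

lemma iD_of_inj (h : Module.Injective R M) : iD R 0 M := fun _ _ _ => xt_inj 0

lemma iD_of_cores (n : ℕ) : ∀ (M : ModuleCat.{u} R),
    CoresDimLE R (fun N => Module.Injective R N) n M → iD R n M := by
  induction n with
  | zero => intro M h; exact iD_of_inj h
  | succ n ih =>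
    intro M h
    rcases h with h | ⟨X, f, hX, hf, h⟩
    · exact (ih M h).succ
    · have hX : Module.Injective R X := hX
      exact (SES.of_inj f hf).unshiftI (ih _ h)

lemma coresDim_ne_top (P : ModuleCat.{u} R → Prop) (M : ModuleCat.{u} R) :
    CoresDim R P M ≠ ⊤ ↔ ∃ k, CoresDimLE R P k M := by
  constructor
  · intro h
    by_contra hc
    apply h
    push Not at hc
    rw [CoresDim]
    have : {n : ℕ∞ | ∃ k : ℕ, (k : ℕ∞) = n ∧ CoresDimLE R P k M} = ∅ := by
      ext n
      simp only [Set.mem_setOf_eq, Set.mem_empty_iff_false, iff_false]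
      rintro ⟨k, -, h⟩
      exact hc k h
    rw [this, sInf_empty]
  · rintro ⟨k, hk⟩
    have : CoresDim R P M ≤ k := sInf_le ⟨k, rfl, hk⟩
    exact ne_top_of_le_ne_top (ENat.coe_ne_top k) this

lemma injDim_ne_top : injDim R M ≠ ⊤ ↔ ∃ k, iD R k M := by
  rw [injDim, coresDim_ne_top]
  exact exists_congr fun k => ⟨fun h => iD_of_cores k _ h, fun h => cores_of_fD k M h.fD⟩

end Gam

end Part6

section Part7
open CategoryTheory IsLocalRing
open Opposite

section GamS
variable {R : Type u} [CommRing R] {𝔞 : Ideal R}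

/-- restriction to torsion -/
def gamR (𝔞 : Ideal R) {M N : Type u} [AddCommGroup M] [Module R M] [AddCommGroup N] [Module R N]
    (f : M →ₗ[R] N) : gam 𝔞 M →ₗ[R] gam 𝔞 N := f.restrict fun _ hx => gam_map f hx

lemma gamR_coe {M N : Type u} [AddCommGroup M] [Module R M] [AddCommGroup N] [Module R N]
    (f : M →ₗ[R] N) (x : gam 𝔞 M) : (gamR 𝔞 f x : N) = f x := rfl

variable {M J M' : Type u} [AddCommGroup M] [Module R M] [AddCommGroup J] [Module R J]
  [AddCommGroup M'] [Module R M']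

lemma gam_ses [Module.Injective R J] {f : M →ₗ[R] J} {g : J →ₗ[R] M'} (h : SES f g)
    (h1 : Subsingleton (lcoh R 𝔞 1 M)) : SES (gamR 𝔞 f) (gamR 𝔞 g) where
  inj := by
    intro x y hxy
    exact Subtype.ext (h.inj (congrArg Subtype.val hxy))
  surj := by
    intro m
    obtain ⟨j, hj, hm⟩ := (lc1_iff h).1 h1 m.1 m.2
    exact ⟨⟨j, hj⟩, Subtype.ext hm⟩
  ex := by
    intro x
    constructor
    · intro hx
      obtain ⟨y, hy⟩ := (h.ex x.1).1 (congrArg Subtype.val hx)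
      refine ⟨⟨y, gam_of_inj f h.inj (hy ▸ x.2)⟩, Subtype.ext hy⟩
    · rintro ⟨y, rfl⟩
      exact Subtype.ext (h.apply y.1)

lemma lc_pos_shift [Module.Injective R J] {f : M →ₗ[R] J} {g : J →ₗ[R] M'} (h : SES f g)
    (hM : ∀ i, Subsingleton (lcoh R 𝔞 (i+1) M)) (i : ℕ) : Subsingleton (lcoh R 𝔞 (i+1) M') := by
  obtain ⟨e⟩ := lc_shift (𝔞 := 𝔞) i h
  have := hM (i+1)
  exact e.toEquiv.subsingleton

lemma gam_iD [IsNoetherianRing R] (k : ℕ) : ∀ (M : Type u) [AddCommGroup M] [Module R M],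
    (∀ i, Subsingleton (lcoh R 𝔞 (i+1) M)) → iD R k M → iD R k (gam 𝔞 M) := by
  induction k with
  | zero =>
    intro M _ _ h hM
    have := inj_of_fD hM.fD
    exact iD_of_inj (gam_injective 𝔞 M)
  | succ k ih =>
    intro M _ _ h hM
    obtain ⟨J, _, _, f, hJ, hf⟩ := exists_inj_embed (R := R) M
    have hs := SES.of_inj f hf
    have hg := gam_ses (𝔞 := 𝔞) hs (h 0)
    have := gam_injective 𝔞 J
    exact hg.unshiftI (ih _ (lc_pos_shift hs h) (hs.shiftI hM))

/-- (S1) -/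
lemma lc_iD [IsNoetherianRing R] (n : ℕ) : ∀ (M : Type u) [AddCommGroup M] [Module R M],
    (∀ i, i ≠ n → Subsingleton (lcoh R 𝔞 i M)) → (∃ k, iD R k M) → ∃ k, iD R k (lcoh R 𝔞 n M) := by
  induction n with
  | zero =>
    rintro M _ _ h ⟨k, hk⟩
    obtain ⟨e⟩ := lc0 𝔞 M
    exact ⟨k, (gam_iD k M (fun i => h _ (Nat.succ_ne_zero i)) hk).iso e.symm⟩
  | succ n ih =>
    rintro M _ _ h ⟨k, hk⟩
    have hg : gam 𝔞 M = ⊥ := (gam_eq_bot_iff 𝔞 M).2 (h 0 (Nat.succ_ne_zero n).symm)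
    obtain ⟨J, _, _, f, hJ, hf, hJ0⟩ := exists_inj_embed_gam 𝔞 M hg
    have hs := SES.of_inj f hf
    obtain ⟨k', hk'⟩ := ih _ (fun i hi => by
      obtain ⟨e⟩ := lc_shift' hs hJ0 i
      have := h (i+1) (by omega)
      exact e.toEquiv.subsingleton) ⟨k, hs.shiftI (hk.succ)⟩
    obtain ⟨e⟩ := lc_shift' hs hJ0 n
    exact ⟨k', hk'.iso e⟩

variable {N : Type u} [AddCommGroup N] [Module R N]

lemma hom_mem_gam {s : ℕ} (hN : ∀ a ∈ 𝔞 ^ s, ∀ x : N, a • x = 0) (φ : N →ₗ[R] M) (x : N) :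
    φ x ∈ gam 𝔞 M := ⟨s, fun a ha => by rw [← map_smul, hN a ha, map_zero]⟩

/-- corestriction -/
def toG {s : ℕ} (hN : ∀ a ∈ 𝔞 ^ s, ∀ x : N, a • x = 0) (φ : N →ₗ[R] M) : N →ₗ[R] gam 𝔞 M :=
  φ.codRestrict _ (hom_mem_gam hN φ)

lemma S2_zero [IsNoetherianRing R] {s : ℕ} (hN : ∀ a ∈ 𝔞 ^ s, ∀ x : N, a • x = 0) :
    ∀ (i : ℕ) (M : Type u) [AddCommGroup M] [Module R M],
    (∀ i, Subsingleton (lcoh R 𝔞 (i+1) M)) → Nonempty (XT R i N (gam 𝔞 M) ≃ₗ[R] XT R i N M)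
  | 0 => by
    intro M _ _ h
    refine ⟨LinearEquiv.ofBijective (pf 0 N (gam 𝔞 M).subtype) ⟨?_, ?_⟩⟩
    · rw [injective_iff_map_eq_zero]
      intro x hx
      obtain ⟨z, rfl⟩ := h0.surjective x
      rw [pf_h0, LinearEquiv.map_eq_zero_iff] at hx
      have : z = 0 := by
        ext y
        exact congrArg (fun f => f y) hx
      rw [this, map_zero]
    · intro x
      obtain ⟨z, rfl⟩ := h0.surjective x
      refine ⟨h0 (toG hN z), ?_⟩
      rw [pf_h0]
      rfl
  | 1 => by
    intro M _ _ h
    obtain ⟨J, _, _, f, hJ, hf⟩ := exists_inj_embed (R := R) M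
    have hs := SES.of_inj f hf
    have hg := gam_ses (𝔞 := 𝔞) hs (h 0)
    have hJ' := gam_injective 𝔞 J
    let G := gam 𝔞 (J ⧸ LinearMap.range f)
    let F1 : (N →ₗ[R] G) →ₗ[R] XT R 1 N (gam 𝔞 M) := dC hg 0 N ∘ₗ h0.toLinearMap
    let F2 : (N →ₗ[R] G) →ₗ[R] XT R 1 N M := dC hs 0 N ∘ₗ h0.toLinearMap ∘ₗ
      LinearMap.compRight R (G.subtype)
    have e1 : ∀ z, F1 z = dC hg 0 N (h0 z) := fun _ => rfl
    have e2 : ∀ z, F2 z = dC hs 0 N (h0 (G.subtype ∘ₗ z)) := fun _ => rfl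
    obtain ⟨e, -⟩ := equiv_of_surj (R := R) (Z := N →ₗ[R] G) (A := XT R 1 N (gam 𝔞 M)) (B := XT R 1 N M) F1 F2 (by
        show Function.Surjective F1
        intro x
        obtain ⟨y, rfl⟩ := surj_of_sub (exC1 (N := N) hg 0) (xt_inj 0) x
        obtain ⟨z, rfl⟩ := h0.surjective y
        exact ⟨z, rfl⟩) (by
        show Function.Surjective F2
        intro x
        obtain ⟨y, rfl⟩ := surj_of_sub (exC1 (N := N) hs 0) (xt_inj 0) x
        obtain ⟨z, rfl⟩ := h0.surjective y
        exact ⟨toG hN z, rfl⟩) (by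
        show ∀ z, F1 z = 0 ↔ F2 z = 0
        intro z
        rw [e1, e2, exC3 hg 0 _, exC3 hs 0 _]
        constructor
        · rintro ⟨w, hw⟩
          obtain ⟨w, rfl⟩ := h0.surjective w
          refine ⟨h0 ((gam 𝔞 J).subtype ∘ₗ w), ?_⟩
          rw [pf_h0] at hw ⊢
          have := h0.injective hw
          rw [← this]
          rfl
        · rintro ⟨w, hw⟩
          obtain ⟨w, rfl⟩ := h0.surjective w
          refine ⟨h0 (toG hN w), ?_⟩
          rw [pf_h0] at hw ⊢
          have := h0.injective hw
          congr 1
          ext y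
          exact congrArg (fun f => f y) this)
    exact ⟨e⟩
  | (i+2) => by
    intro M _ _ h
    obtain ⟨J, _, _, f, hJ, hf⟩ := exists_inj_embed (R := R) M
    have hs := SES.of_inj f hf
    have hg := gam_ses (𝔞 := 𝔞) hs (h 0)
    have hJ' := gam_injective 𝔞 J
    obtain ⟨e⟩ := S2_zero hN (i+1) _ (lc_pos_shift hs h)
    exact ⟨(dCE hg (i+1) (xt_inj i) (xt_inj (i+1))).symm.trans
      (e.trans (dCE hs (i+1) (xt_inj i) (xt_inj (i+1))))⟩

lemma xt0_of_gam {s : ℕ} (hN : ∀ a ∈ 𝔞 ^ s, ∀ x : N, a • x = 0) (hJ : gam 𝔞 M = ⊥) :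
    Subsingleton (XT R 0 N M) := by
  refine subsingleton_of_forall_eq 0 fun x => ?_
  obtain ⟨w, rfl⟩ := h0.surjective x
  have : w = 0 := by
    ext y
    have := hom_mem_gam hN w y
    rw [hJ, Submodule.mem_bot] at this
    exact this
  rw [this, map_zero]

/-- (S2) -/
lemma S2 [IsNoetherianRing R] {s : ℕ} (hN : ∀ a ∈ 𝔞 ^ s, ∀ x : N, a • x = 0) (n : ℕ) :
    ∀ (M : Type u) [AddCommGroup M] [Module R M], (∀ i, i ≠ n → Subsingleton (lcoh R 𝔞 i M)) →
    (∀ i, Nonempty (XT R i N (lcoh R 𝔞 n M) ≃ₗ[R] XT R (i+n) N M)) ∧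
      ∀ j, j < n → Subsingleton (XT R j N M) := by
  induction n with
  | zero =>
    intro M _ _ h
    obtain ⟨e⟩ := lc0 𝔞 M
    refine ⟨fun i => ?_, fun j hj => absurd hj (Nat.not_lt_zero j)⟩
    obtain ⟨e'⟩ := S2_zero hN i M (fun i => h _ (Nat.succ_ne_zero i))
    exact ⟨(pfE i N e).trans e'⟩
  | succ n ih =>
    intro M _ _ h
    have hg : gam 𝔞 M = ⊥ := (gam_eq_bot_iff 𝔞 M).2 (h 0 (Nat.succ_ne_zero n).symm)
    obtain ⟨J, _, _, f, hJ, hf, hJ0⟩ := exists_inj_embed_gam 𝔞 M hg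
    have hs := SES.of_inj f hf
    have hsub : ∀ i, Subsingleton (XT R i N J) := by
      intro i
      cases i with
      | zero => exact xt0_of_gam hN hJ0
      | succ i => exact xt_inj i
    obtain ⟨h1, h2⟩ := ih _ (fun i hi => by
      obtain ⟨e⟩ := lc_shift' hs hJ0 i
      have := h (i+1) (by omega)
      exact e.toEquiv.subsingleton)
    obtain ⟨e⟩ := lc_shift' hs hJ0 n
    constructor
    · intro i
      obtain ⟨e1⟩ := h1 i
      exact ⟨(pfE i N e.symm).trans (e1.trans (dCE hs (i+n) (hsub _) (hsub _)))⟩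
    · intro j hj
      cases j with
      | zero => exact xt0_of_gam hN hg
      | succ j =>
        have := h2 j (by omega)
        exact (dCE hs j (hsub _) (hsub _)).symm.toEquiv.subsingleton

end GamS

end Part7

section Part8
open CategoryTheory IsLocalRing
open Opposite

section CD
variable {R : Type u} [CommRing R] {𝔞 : Ideal R}

lemma inj_factor {A B G : Type u} [AddCommGroup A] [Module R A] [AddCommGroup B] [Module R B]
    [AddCommGroup G] [Module R G] [hG : Module.Injective R G] (a : A →ₗ[R] B) (b : A →ₗ[R] G)
    (h : ∀ x, a x = 0 → b x = 0) : ∃ c : B →ₗ[R] G, ∀ x, c (a x) = b x := by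
  obtain ⟨c, hc⟩ := hG.out ((LinearMap.ker a).liftQ a le_rfl)
    (by rw [← LinearMap.ker_eq_bot, Submodule.ker_liftQ_eq_bot]; exact le_rfl)
    ((LinearMap.ker a).liftQ b (fun x hx => h x hx))
  exact ⟨c, fun x => hc (Submodule.Quotient.mk x)⟩

lemma inj_div [IsNoetherianRing R] {G : Type u} [AddCommGroup G] [Module R G]
    [hG : Module.Injective R G] (x : R) (w : G) (k : ℕ) :
    ∃ (v : G) (l : ℕ), x ^ l • (w - x ^ k • v) = 0 := by
  let F : ℕ →o Submodule R R := ⟨fun j => LinearMap.ker (LinearMap.lsmul R R (x ^ j)), by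
    intro i j hij r hr
    obtain ⟨d, rfl⟩ := Nat.exists_eq_add_of_le hij
    simp only [LinearMap.mem_ker, LinearMap.lsmul_apply, smul_eq_mul] at hr ⊢
    rw [pow_add, mul_comm (x ^ i), mul_assoc, hr, mul_zero]⟩
  obtain ⟨l, hl⟩ := (monotone_stabilizes_iff_noetherian (R := R) (M := R)).2 inferInstance F
  obtain ⟨c, hc⟩ := inj_factor (LinearMap.lsmul R R (x ^ (l + k)))
    (LinearMap.toSpanSingleton R G (x ^ l • w)) (by
      intro r hr
      have h1 : r ∈ F (l + k) := hr
      rw [← hl (l + k) (Nat.le_add_right _ _)] at h1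
      have h2 : x ^ l * r = 0 := h1
      rw [LinearMap.toSpanSingleton_apply, smul_smul, mul_comm, h2, zero_smul])
  refine ⟨c 1, l, ?_⟩
  have := hc 1
  simp only [LinearMap.lsmul_apply, LinearMap.toSpanSingleton_apply, map_smul, one_smul] at this
  rw [smul_sub, smul_smul, ← pow_add, this, sub_self]

lemma gam_mono {𝔟 : Ideal R} (h : 𝔞 ≤ 𝔟) {M : Type u} [AddCommGroup M] [Module R M] {m : M}
    (hm : m ∈ gam 𝔟 M) : m ∈ gam 𝔞 M := by
  obtain ⟨t, ht⟩ := hm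
  exact ⟨t, fun a ha => ht a (Ideal.pow_right_mono h t ha)⟩

lemma gam_sup_span {x : R} {M : Type u} [AddCommGroup M] [Module R M] {m : M}
    (hm : m ∈ gam 𝔞 M) (k : ℕ) (hx : x ^ k • m = 0) : m ∈ gam (𝔞 ⊔ Ideal.span {x}) M := by
  obtain ⟨t, ht⟩ := hm
  refine ⟨t + k, fun a ha => ?_⟩
  have h1 := Ideal.sup_pow_add_le_pow_sup_pow ha
  rw [Ideal.span_singleton_pow] at h1
  obtain ⟨b, hb, c, hc, rfl⟩ := Submodule.mem_sup.1 h1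
  obtain ⟨d, rfl⟩ := Ideal.mem_span_singleton'.1 hc
  rw [add_smul, ht b hb, mul_smul, hx, smul_zero, add_zero]

lemma lc_step2 [IsNoetherianRing R] (x : R) (A : Type u) [AddCommGroup A] [Module R A]
    (h1 : Subsingleton (lcoh R 𝔞 1 A)) (h2 : Subsingleton (lcoh R 𝔞 2 A)) :
    Subsingleton (lcoh R (𝔞 ⊔ Ideal.span {x}) 2 A) := by
  obtain ⟨J, _, _, f, hJ, hf⟩ := exists_inj_embed (R := R) A
  have hs := SES.of_inj f hf
  obtain ⟨J', _, _, f', hJ', hf'⟩ := exists_inj_embed (R := R) (J ⧸ LinearMap.range f)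
  have hs' := SES.of_inj f' hf'
  set g := (LinearMap.range f).mkQ
  set g' := (LinearMap.range f').mkQ
  obtain ⟨e⟩ := lc_shift (𝔞 := 𝔞) 0 hs
  obtain ⟨e'⟩ := lc_shift (𝔞 := 𝔞 ⊔ Ideal.span {x}) 0 hs
  have hB : Subsingleton (lcoh R 𝔞 1 (J ⧸ LinearMap.range f)) := e.toEquiv.subsingleton
  rw [lc1_iff hs] at h1
  rw [lc1_iff hs'] at hB
  suffices Subsingleton (lcoh R (𝔞 ⊔ Ideal.span {x}) 1 (J ⧸ LinearMap.range f)) from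
    e'.symm.toEquiv.subsingleton
  rw [lc1_iff hs']
  intro z hz
  obtain ⟨y, hy, rfl⟩ := hB z (gam_mono le_sup_left hz)
  obtain ⟨k, hk⟩ := gam_mono (𝔞 := Ideal.span {x}) le_sup_right hz
  have hk := hk (x ^ k) (Ideal.pow_mem_pow (Ideal.mem_span_singleton_self x) k)
  rw [← map_smul] at hk
  obtain ⟨b, hb⟩ := (hs'.ex _).1 hk
  have hbg : b ∈ gam 𝔞 (J ⧸ LinearMap.range f) :=
    gam_of_inj f' hf' (hb ▸ Submodule.smul_mem _ _ hy)
  obtain ⟨w, hw, rfl⟩ := h1 b hbg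
  have := gam_injective 𝔞 J
  obtain ⟨v, l, hv⟩ := inj_div x (⟨w, hw⟩ : gam 𝔞 J) k
  have hv' : x ^ l • (w - x ^ k • (v : J)) = 0 := congrArg Subtype.val hv
  refine ⟨y - f' (g v), ?_, ?_⟩
  · refine gam_sup_span (Submodule.sub_mem _ hy (gam_map f' (gam_map g v.2))) (l + k) ?_
    have h3 := congrArg (fun q => f' (g q)) hv'
    simp only [map_smul, map_sub, map_zero] at h3
    rw [hb] at h3
    rw [pow_add, mul_smul, smul_sub]
    exact h3
  · rw [map_sub, hs'.apply, sub_zero]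

lemma lc_step [IsNoetherianRing R] (x : R) (r : ℕ) : ∀ (A : Type u) [AddCommGroup A] [Module R A],
    Subsingleton (lcoh R 𝔞 (r+1) A) → Subsingleton (lcoh R 𝔞 (r+2) A) →
    Subsingleton (lcoh R (𝔞 ⊔ Ideal.span {x}) (r+2) A) := by
  induction r with
  | zero => intro A _ _ h1 h2; exact lc_step2 x A h1 h2
  | succ r ih =>
    intro A _ _ h1 h2
    obtain ⟨J, _, _, f, hJ, hf⟩ := exists_inj_embed (R := R) A
    have hs := SES.of_inj f hf
    obtain ⟨e1⟩ := lc_shift (𝔞 := 𝔞) r hs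
    obtain ⟨e2⟩ := lc_shift (𝔞 := 𝔞) (r+1) hs
    obtain ⟨e3⟩ := lc_shift (𝔞 := 𝔞 ⊔ Ideal.span {x}) (r+1) hs
    have := ih _ e1.toEquiv.subsingleton e2.toEquiv.subsingleton
    exact e3.symm.toEquiv.subsingleton

lemma lc_bound_mono {r : ℕ}
    (h : ∀ (A : Type u) [AddCommGroup A] [Module R A], Subsingleton (lcoh R 𝔞 (r+1) A)) (d : ℕ) :
    ∀ (A : Type u) [AddCommGroup A] [Module R A], Subsingleton (lcoh R 𝔞 (r+d+1) A) := by
  induction d with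
  | zero => exact h
  | succ d ih =>
    intro A _ _
    obtain ⟨J, _, _, f, hJ, hf⟩ := exists_inj_embed (R := R) A
    obtain ⟨e⟩ := lc_shift (𝔞 := 𝔞) (r+d) (SES.of_inj f hf)
    have := ih (J ⧸ LinearMap.range f)
    exact e.symm.toEquiv.subsingleton

lemma lc_bot (i : ℕ) (A : Type u) [AddCommGroup A] [Module R A] :
    Subsingleton (lcoh R (⊥ : Ideal R) (i+1) A) := by
  rw [lc_vanish_iff]
  intro t ξ
  refine ⟨t+1, Nat.le_succ t, ?_⟩
  have h1 : (⊥ : Ideal R) ^ (t+1) = ⊥ := by rw [pow_succ, Ideal.mul_bot]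
  have : Module.Projective R (R ⧸ (⊥ : Ideal R) ^ (t+1)) :=
    Module.Projective.of_equiv (Submodule.quotEquivOfEqBot ((⊥ : Ideal R) ^ (t+1)) h1).symm
  have := xt_proj (R := R) (A := R ⧸ (⊥ : Ideal R) ^ (t+1)) (B := A) i
  exact Subsingleton.elim _ _

lemma lc_bound [IsNoetherianRing R] (𝔞 : Ideal R) : ∃ r : ℕ, ∀ (A : Type u) [AddCommGroup A]
    [Module R A], Subsingleton (lcoh R 𝔞 (r+1) A) := by
  classical
  obtain ⟨S, rfl⟩ := (isNoetherian_def.1 (inferInstance : IsNoetherian R R)) 𝔞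
  induction S using Finset.induction_on with
  | empty =>
    refine ⟨0, fun A _ _ => ?_⟩
    rw [Finset.coe_empty, Submodule.span_empty]
    exact lc_bot 0 A
  | insert x S _ ih =>
    obtain ⟨r, hr⟩ := ih
    refine ⟨r+1, fun A _ _ => ?_⟩
    have := lc_step x r A (hr A) (lc_bound_mono hr 1 A)
    rw [sup_comm] at this
    rw [Finset.coe_insert, Submodule.span_insert]
    exact this

lemma lc_fg_vanish [IsNoetherianRing R] {n : ℕ}
    (h : ∀ i, n < i → Subsingleton (lcoh R 𝔞 i R)) :
    ∀ (i : ℕ), n < i → ∀ (M : Type u) [AddCommGroup M] [Module R M] [Module.Finite R M],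
      Subsingleton (lcoh R 𝔞 i M) := by
  obtain ⟨r, hr⟩ := lc_bound 𝔞
  have key : ∀ j i : ℕ, n < i → r < i + j → ∀ (M : Type u) [AddCommGroup M] [Module R M]
      [Module.Finite R M], Subsingleton (lcoh R 𝔞 i M) := by
    intro j
    induction j with
    | zero =>
      intro i _ hi M _ _ _
      obtain ⟨d, rfl⟩ := Nat.exists_eq_add_of_lt (show r < i from hi)
      exact lc_bound_mono hr d M
    | succ j ih =>
      intro i hi hij M _ _ hM
      induction hM using IsNoetherianRing.induction_on_isQuotientEquivQuotientPrime R with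
      | subsingleton N =>
        rw [lc_vanish_iff]
        intro t ξ
        have := xt_sub_right (R := R) (A := R ⧸ 𝔞 ^ t) (B := N) i
        exact ⟨t, le_rfl, Subsingleton.elim _ _⟩
      | quotient N p e =>
        obtain ⟨e⟩ := lc_iso (𝔞 := 𝔞) i e
        have hs : SES (Submodule.subtype p.1) (Submodule.mkQ p.1) :=
          ⟨Subtype.val_injective, Submodule.mkQ_surjective _, LinearMap.exact_subtype_mkQ _⟩
        have := lc_coker i hs (h i hi) (ih (i+1) (by omega) (by omega) _)
        exact e.toEquiv.subsingleton
      | exact A B D f g hf hg hfg hA hD => exact lc_ext i ⟨hf, hg, hfg⟩ hA hD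
  intro i hi M _ _ _
  exact key (r+1) i hi (by omega) M

end CD

end Part8

section Part9
open CategoryTheory IsLocalRing
open Opposite

section Bass
variable {R : Type u} [CommRing R]

lemma xt_finite [IsNoetherianRing R] (i : ℕ) (N M : Type u) [AddCommGroup N] [Module R N]
    [AddCommGroup M] [Module R M] [Module.Finite R N] [Module.Finite R M] :
    Module.Finite R (XT R i N M) :=
  ModuleCat.finite_ext R (ModuleCat.of R N) (ModuleCat.of R M) i

lemma nak [IsLocalRing R] {X : Type u} [AddCommGroup X] [Module R X] [Module.Finite R X] {x : R}
    (hx : x ∈ maximalIdeal R) (h : ∀ z : X, ∃ y : X, x • y = z) : Subsingleton X := by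
  have h1 : (⊤ : Submodule R X) = ⊥ := by
    refine Submodule.eq_bot_of_le_smul_of_le_jacobson_bot (Ideal.span {x}) ⊤
      Module.Finite.fg_top ?_ ?_
    · intro z _
      obtain ⟨y, rfl⟩ := h z
      exact Submodule.smul_mem_smul (Ideal.mem_span_singleton_self x) trivial
    · rw [IsLocalRing.jacobson_eq_maximalIdeal ⊥ bot_ne_top, Ideal.span_singleton_le_iff_mem]
      exact hx
  exact subsingleton_of_forall_eq 0 fun z => by
    have : z ∈ (⊤ : Submodule R X) := trivial
    rw [h1] at this; exact this

lemma cyc_ses (I K : Ideal R) (a : R) (hK : ∀ r, r ∈ K ↔ a * r ∈ I) :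
    SES (Submodule.mapQ K I (LinearMap.lsmul R R a) (fun r hr => (hK r).1 hr))
      (Submodule.mapQ I (I ⊔ Ideal.span {a}) LinearMap.id (le_sup_left : I ≤ I ⊔ Ideal.span {a})) where
  inj := by
    rw [injective_iff_map_eq_zero]
    intro x
    obtain ⟨r, rfl⟩ := Submodule.mkQ_surjective _ x
    intro h
    have h1 : a * r ∈ I := (Submodule.Quotient.mk_eq_zero I).1 h
    exact (Submodule.Quotient.mk_eq_zero K).2 ((hK r).2 h1)
  surj := by
    intro x
    obtain ⟨r, rfl⟩ := Submodule.mkQ_surjective _ x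
    exact ⟨Submodule.Quotient.mk r, rfl⟩
  ex := by
    intro x
    obtain ⟨r, rfl⟩ := Submodule.mkQ_surjective _ x
    constructor
    · intro h
      have h1 : r ∈ I ⊔ Ideal.span {a} := (Submodule.Quotient.mk_eq_zero (I ⊔ Ideal.span {a})).1 h
      obtain ⟨b, hb, c, hc, rfl⟩ := Submodule.mem_sup.1 h1
      obtain ⟨d, rfl⟩ := Ideal.mem_span_singleton'.1 hc
      refine ⟨Submodule.Quotient.mk d, ?_⟩
      change (Submodule.Quotient.mk (a * d) : R ⧸ I) = Submodule.Quotient.mk (b + d * a)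
      rw [Submodule.Quotient.eq]
      have : a * d - (b + d * a) = -b := by ring
      rw [this]; exact I.neg_mem hb
    · rintro ⟨y, hy⟩
      obtain ⟨d, rfl⟩ := Submodule.mkQ_surjective _ y
      rw [← hy]
      change (Submodule.Quotient.mk (a * d) : R ⧸ (I ⊔ Ideal.span {a})) = 0
      rw [Submodule.Quotient.mk_eq_zero]
      exact Ideal.mem_sup_right (Ideal.mul_mem_right _ _ (Ideal.mem_span_singleton_self a))

lemma bass [IsNoetherianRing R] [IsLocalRing R] (M : Type u) [AddCommGroup M] [Module R M]
    [Module.Finite R M] (t : ℕ)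
    (h : ∀ i, t ≤ i → Subsingleton (XT R i (R ⧸ maximalIdeal R) M)) (I : Ideal R) :
    ∀ i, t ≤ i → Subsingleton (XT R i (R ⧸ I) M) := by
  refine IsNoetherian.induction (R := R) (M := R)
    (P := fun I : Ideal R => ∀ i, t ≤ i → Subsingleton (XT R i (R ⧸ I) M)) ?_ I
  intro (I : Ideal R) ih i hi
  have hlt : ∀ a, a ∉ I → I < I ⊔ Ideal.span {a} := by
    intro a ha
    refine lt_of_le_of_ne le_sup_left fun he => ha ?_
    rw [he]; exact Ideal.mem_sup_right (Ideal.mem_span_singleton_self a)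
  by_cases htop : I = ⊤
  · have : Subsingleton (R ⧸ I) := Ideal.Quotient.subsingleton_iff.2 htop
    exact xt_sub_left i
  by_cases hp : I.IsPrime
  · by_cases hm : maximalIdeal R ≤ I
    · have : I = maximalIdeal R := le_antisymm (IsLocalRing.le_maximalIdeal htop) hm
      subst this
      exact h i hi
    · obtain ⟨x, hx, hxI⟩ := Set.not_subset.1 hm
      have hs := cyc_ses I I x (fun r => ⟨fun hr => I.mul_mem_left x hr,
        fun hr => (hp.mem_or_mem hr).resolve_left hxI⟩)
      have h1 := ih _ (hlt x hxI) (i+1) (by omega)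
      have h2 := surj_of_sub (exV1 (M := M) hs i) h1
      have := xt_finite (R := R) i (R ⧸ I) M
      refine nak (R := R) hx fun z => ?_
      obtain ⟨y, rfl⟩ := h2 z
      refine ⟨y, ?_⟩
      have h3 : Submodule.mapQ I I (LinearMap.lsmul R R x) (fun r hr => I.mul_mem_left x hr) =
          x • (LinearMap.id : (R ⧸ I) →ₗ[R] (R ⧸ I)) := by
        apply Submodule.linearMap_qext; rfl
      rw [h3, pb_smul, pb_id]
  · have : ∃ a b, a ∉ I ∧ b ∉ I ∧ a * b ∈ I := by
      by_contra hc
      push Not at hc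
      exact hp ⟨htop, fun {a b} hab => by
        by_contra hd
        push Not at hd
        exact hc a b hd.1 hd.2 hab⟩
    obtain ⟨a, b, ha, hb, hab⟩ := this
    let K : Ideal R := Submodule.comap (LinearMap.lsmul R R a) I
    have hs := cyc_ses I K a (fun r => Iff.rfl)
    have hK : I < K := by
      refine lt_of_le_of_ne (fun r hr => I.mul_mem_left a hr) fun he => hb ?_
      rw [he]; exact hab
    exact sub_mid (exV2 hs i) (ih _ (hlt a ha) i hi) (ih _ hK i hi)

end Bass

end Part9

section Part10
open CategoryTheory IsLocalRing
open Opposite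
open TensorProduct

section ZZ
variable {R : Type u} [CommRing R] {C : Type u} [AddCommGroup C] [Module R C]

lemma exists_hom_resField [Module.Finite R C] (p : Ideal R)
    [hp : p.IsPrime] (hC : Module.annihilator R C ≤ p) : ∃ (ψ : C →ₗ[R] p.ResidueField), ψ ≠ 0 := by
  have h1 : (⟨p, hp⟩ : PrimeSpectrum R) ∈ Module.support R C := by
    rw [Module.support_eq_zeroLocus]
    exact hC
  rw [Module.mem_support_iff_nontrivial_residueField_tensorProduct] at h1
  have h1 : Nontrivial (p.ResidueField ⊗[R] C) := h1
  obtain ⟨v, hv⟩ := exists_ne (0 : p.ResidueField ⊗[R] C)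
  have h2 : ∃ l : Module.Dual p.ResidueField (p.ResidueField ⊗[R] C), l v ≠ 0 := by
    by_contra hc
    push Not at hc
    exact hv ((Module.forall_dual_apply_eq_zero_iff p.ResidueField v).1 hc)
  obtain ⟨l, hl⟩ := h2
  refine ⟨(l.restrictScalars R) ∘ₗ TensorProduct.mk R p.ResidueField C 1, fun h0 => hl ?_⟩
  have h3 : ∀ c : C, l (1 ⊗ₜ c) = 0 := fun c => congrArg (fun f => f c) h0
  induction v using TensorProduct.induction_on with
  | zero => exact map_zero l
  | tmul a c =>
    have : a ⊗ₜ[R] c = a • ((1 : p.ResidueField) ⊗ₜ[R] c) := by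
      rw [TensorProduct.smul_tmul', smul_eq_mul, mul_one]
    rw [this, map_smul, h3, smul_zero]
  | add x y hx hy =>
    rw [map_add]
    have hx' : l x = 0 := by
      by_cases hxx : x = 0
      · rw [hxx, map_zero]
      · by_contra hc; exact hc (hx hxx hc)
    have hy' : l y = 0 := by
      by_cases hxx : y = 0
      · rw [hxx, map_zero]
      · by_contra hc; exact hc (hy hxx hc)
    rw [hx', hy', add_zero]

lemma exists_hom_quot_prime [Module.Finite R C] (p : Ideal R)
    [hp : p.IsPrime] (hC : Module.annihilator R C ≤ p) : ∃ (φ : C →ₗ[R] (R ⧸ p)), φ ≠ 0 := by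
  classical
  obtain ⟨ψ, hψ⟩ := exists_hom_resField p hC
  obtain ⟨S, hS⟩ := (Module.Finite.fg_top : (⊤ : Submodule R C).FG)
  obtain ⟨b, hb⟩ := IsLocalization.exist_integer_multiples_of_finset
    (nonZeroDivisors (R ⧸ p)) (S.image ψ : Finset p.ResidueField)
  obtain ⟨r, hr⟩ := Ideal.Quotient.mk_surjective (b : R ⧸ p)
  let ι : (R ⧸ p) →ₗ[R] p.ResidueField := (Algebra.linearMap (R ⧸ p) p.ResidueField).restrictScalars R
  have hι : Function.Injective ι := IsFractionRing.injective (R ⧸ p) p.ResidueField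
  have hrb : ∀ z : p.ResidueField, r • z = (b : R ⧸ p) • z := by
    intro z
    rw [← hr]
    exact (algebraMap_smul (R ⧸ p) r z).symm
  have hmem : ∀ c : C, (r • ψ) c ∈ LinearMap.range ι := by
    intro c
    have hc : c ∈ Submodule.span R (S : Set C) := by rw [hS]; trivial
    induction hc using Submodule.span_induction with
    | mem x hx =>
      obtain ⟨y, hy⟩ := hb (ψ x) (Finset.mem_image_of_mem _ hx)
      exact ⟨y, by rw [LinearMap.smul_apply, hrb, ← hy]; rfl⟩
    | zero => rw [map_zero]; exact Submodule.zero_mem _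
    | add x y _ _ hx hy => rw [map_add]; exact Submodule.add_mem _ hx hy
    | smul a x _ hx => rw [map_smul]; exact Submodule.smul_mem _ _ hx
  refine ⟨(LinearEquiv.ofInjective ι hι).symm.toLinearMap ∘ₗ (r • ψ).codRestrict _ hmem, ?_⟩
  intro h0
  apply hψ
  ext c
  have h1 := congrArg (fun f => f c) h0
  simp only [LinearMap.comp_apply, LinearMap.zero_apply, LinearEquiv.coe_coe,
    LinearEquiv.map_eq_zero_iff] at h1
  have h2 : r • ψ c = 0 := congrArg Subtype.val h1
  rw [hrb, Algebra.smul_def] at h2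
  rcases mul_eq_zero.1 h2 with h3 | h3
  · exfalso
    have h4 : (b : R ⧸ p) = 0 := hι (by rw [map_zero]; exact h3)
    exact nonZeroDivisors.coe_ne_zero b h4
  · exact h3

/-- (Z) -/
lemma hom_faithful [IsNoetherianRing R] [Module.Finite R C] (hC : Module.annihilator R C = ⊥)
    (K : Type u) [AddCommGroup K] [Module R K] (h : ∀ φ : C →ₗ[R] K, φ = 0) : Subsingleton K := by
  by_contra hK
  rw [not_subsingleton_iff_nontrivial] at hK
  obtain ⟨p, hp⟩ := associatedPrimes.nonempty R K
  obtain ⟨hp1, x, hx⟩ := (isAssociatedPrime_iff).1 hp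
  obtain ⟨φ, hφ⟩ := exists_hom_quot_prime p (hC.trans_le bot_le)
  have hx' : ∀ a, a ∈ p ↔ a • x = 0 := by
    intro a; rw [hx, Submodule.mem_colon_singleton, Submodule.mem_bot]
  let ι : (R ⧸ p) →ₗ[R] K := Submodule.liftQ p (LinearMap.toSpanSingleton R K x)
    (fun a ha => (hx' a).1 ha)
  have hι : Function.Injective ι := by
    rw [injective_iff_map_eq_zero]
    intro y
    obtain ⟨r, rfl⟩ := Submodule.mkQ_surjective _ y
    intro hr
    exact (Submodule.Quotient.mk_eq_zero p).2 ((hx' r).2 hr)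
  apply hφ
  ext c
  have := congrArg (fun f => f c) (h (ι ∘ₗ φ))
  exact hι (by rw [LinearMap.zero_apply, map_zero]; exact this)

lemma semid_ann (hC : IsSemidualizing R C) : Module.annihilator R C = ⊥ := by
  rw [eq_bot_iff]
  intro r hr
  apply hC.2.1.1
  ext c
  simp [Module.mem_annihilator.1 hr c]

lemma semid_xt (hC : IsSemidualizing R C) (i : ℕ) : Subsingleton (XT R (i+1) C C) := by
  have h := hC.2.2 (i+1) (by omega)
  have e := cmpExt (ModuleCat.of R C) (ModuleCat.of R C) (i+1)
  have h : Subsingleton (oExt (i+1) (ModuleCat.of R C) (ModuleCat.of R C)) := h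
  exact e.toEquiv.subsingleton

/-- `R ≃ End C`. -/
noncomputable def semidE (hC : IsSemidualizing R C) : R ≃ₗ[R] (C →ₗ[R] C) :=
  LinearEquiv.ofBijective ((LinearMap.toSpanSingleton R (C →ₗ[R] C) LinearMap.id)) hC.2.1

lemma hom_flat_inj (F J : Type u) [AddCommGroup F] [Module R F] [AddCommGroup J] [Module R J]
    [Module.Flat R F] [hJ : Module.Injective R J] : Module.Injective R (F →ₗ[R] J) where
  out X Y _ _ _ _ f hf g := by
    obtain ⟨k, hk⟩ := hJ.out (f.rTensor F) (Module.Flat.rTensor_preserves_injective_linearMap f hf)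
      (TensorProduct.lift g)
    refine ⟨TensorProduct.curry k, fun x => ?_⟩
    ext y
    exact hk (x ⊗ₜ y)

section
variable {A B D : Type u} [AddCommGroup A] [Module R A] [AddCommGroup B] [Module R B]
  [AddCommGroup D] [Module R D] {f : A →ₗ[R] B} {g : B →ₗ[R] D}

/-- covariant Hom of a SES -/
lemma SES.homC (h : SES f g) (N : Type u) [AddCommGroup N] [Module R N]
    (h1 : Subsingleton (XT R 1 N A)) :
    SES (f.compRight R : (N →ₗ[R] A) →ₗ[R] (N →ₗ[R] B)) (g.compRight R) where
  inj := by
    intro x y hxy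
    ext n
    exact h.inj (congrArg (fun f => f n) hxy)
  surj := by
    intro x
    obtain ⟨y, hy⟩ := surj_of_sub (exC3 (N := N) h 0) h1 (h0 x)
    obtain ⟨y, rfl⟩ := h0.surjective y
    rw [pf_h0] at hy
    exact ⟨y, h0.injective hy⟩
  ex := by
    intro x
    constructor
    · intro hx
      have : pf 0 N g (h0 x) = 0 := by
        rw [pf_h0]
        have : g ∘ₗ x = 0 := hx
        rw [this, map_zero]
      obtain ⟨y, hy⟩ := (exC2 h 0 _).1 this
      obtain ⟨y, rfl⟩ := h0.surjective y
      rw [pf_h0] at hy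
      exact ⟨y, h0.injective hy⟩
    · rintro ⟨y, rfl⟩
      ext n
      exact h.apply _

/-- contravariant Hom of a SES -/
lemma SES.homV (h : SES f g) (M : Type u) [AddCommGroup M] [Module R M]
    (h1 : Subsingleton (XT R 1 D M)) :
    SES (LinearMap.lcomp R M g) (LinearMap.lcomp R M f) where
  inj := by
    intro x y hxy
    ext d
    obtain ⟨b, rfl⟩ := h.surj d
    exact congrArg (fun f => f b) hxy
  surj := by
    intro x
    obtain ⟨y, hy⟩ := surj_of_sub (exV1 (M := M) h 0) h1 (h0 x)
    obtain ⟨y, rfl⟩ := h0.surjective y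
    rw [pb_h0] at hy
    exact ⟨y, h0.injective hy⟩
  ex := by
    intro x
    constructor
    · intro hx
      have : pb 0 M f (h0 x) = 0 := by
        rw [pb_h0]
        have : x ∘ₗ f = 0 := hx
        rw [this, map_zero]
      obtain ⟨y, hy⟩ := (exV2 h 0 _).1 this
      obtain ⟨y, rfl⟩ := h0.surjective y
      rw [pb_h0] at hy
      exact ⟨y, h0.injective hy⟩
    · rintro ⟨y, rfl⟩
      ext n
      change y (g (f n)) = 0
      rw [h.apply, map_zero]

end

variable {𝔞 : Ideal R}

lemma gam_hom (C M : Type u) [AddCommGroup C] [Module R C] [AddCommGroup M] [Module R M]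
    (h : gam 𝔞 M = ⊥) : gam 𝔞 (C →ₗ[R] M) = ⊥ := by
  rw [eq_bot_iff]
  rintro φ ⟨t, ht⟩
  rw [Submodule.mem_bot]
  ext c
  have : φ c ∈ gam 𝔞 M := ⟨t, fun a ha => by rw [← LinearMap.smul_apply, ht a ha]; rfl⟩
  rw [h] at this
  exact this

lemma xt_homJ {N : Type u} [AddCommGroup N] [Module R N] {s : ℕ}
    (hN : ∀ a ∈ 𝔞 ^ s, ∀ x : N, a • x = 0) (J : Type u) [AddCommGroup J] [Module R J]
    [Module.Injective R J] (hJ : gam 𝔞 J = ⊥) (i : ℕ) :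
    ∀ (C : Type u) [AddCommGroup C] [Module R C], Subsingleton (XT R i N (C →ₗ[R] J)) := by
  induction i with
  | zero => intro C _ _; exact xt0_of_gam hN (gam_hom C J hJ)
  | succ i ih =>
    intro C _ _
    let p : (C →₀ R) →ₗ[R] C := Finsupp.linearCombination R id
    have hp : Function.Surjective p := Finsupp.linearCombination_id_surjective R C
    have hs := (SES.of_surj p hp).homV J (xt_inj 0)
    have := hom_flat_inj (R := R) (C →₀ R) J
    have h1 := ih (LinearMap.ker p)
    exact sub_mid (exC1 hs i) h1 (xt_inj i)

lemma gam_of_hom [IsNoetherianRing R] [Module.Finite R C] (hC : Module.annihilator R C = ⊥)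
    (Q : Type u) [AddCommGroup Q] [Module R Q] (h : gam 𝔞 (C →ₗ[R] Q) = ⊥) : gam 𝔞 Q = ⊥ := by
  rw [← Submodule.subsingleton_iff_eq_bot]
  refine hom_faithful hC _ fun φ => ?_
  have h1 : (gam 𝔞 Q).subtype ∘ₗ φ ∈ gam 𝔞 (C →ₗ[R] Q) := by
    obtain ⟨S, hS⟩ := (Module.Finite.fg_top : (⊤ : Submodule R C).FG)
    choose T hT using fun x : C => (φ x).2
    refine ⟨S.sup T, fun a ha => ?_⟩
    ext x
    have hx : x ∈ Submodule.span R (S : Set C) := by rw [hS]; trivial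
    change a • (φ x : Q) = 0
    induction hx using Submodule.span_induction with
    | mem x hx => exact hT x a (Ideal.pow_le_pow_right (Finset.le_sup hx) ha)
    | zero => simp
    | add x y _ _ hx hy => rw [map_add, Submodule.coe_add, smul_add, hx, hy, add_zero]
    | smul r x _ hx => rw [map_smul, Submodule.coe_smul, smul_comm, hx, smul_zero]
  rw [h] at h1
  ext x
  exact congrArg (fun f => f x) h1

lemma lc_low [IsNoetherianRing R] [Module.Finite R C] (hC : Module.annihilator R C = ⊥) (n : ℕ) :
    ∀ (Q : Type u) [AddCommGroup Q] [Module R Q], (∀ i, Subsingleton (XT R (i+1) C Q)) →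
    (∀ i, i < n → Subsingleton (lcoh R 𝔞 i (C →ₗ[R] Q))) →
    ∀ i, i < n → Subsingleton (lcoh R 𝔞 i Q) := by
  induction n with
  | zero => intro Q _ _ _ _ i hi; exact absurd hi (Nat.not_lt_zero i)
  | succ n ih =>
    intro Q _ _ hQ hl i hi
    have hg : gam 𝔞 Q = ⊥ := gam_of_hom hC Q ((gam_eq_bot_iff 𝔞 _).2 (hl 0 (Nat.succ_pos n)))
    cases i with
    | zero => exact (gam_eq_bot_iff 𝔞 Q).1 hg
    | succ i =>
      obtain ⟨J, _, _, f, hJ, hf, hJ0⟩ := exists_inj_embed_gam 𝔞 Q hg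
      have hs := SES.of_inj f hf
      have hs' := hs.homC C (hQ 0)
      obtain ⟨e⟩ := lc_shift' hs hJ0 i
      have := ih (J ⧸ LinearMap.range f) (fun j => by
          have := hQ (j+1)
          exact (dCE (N := C) hs (j+1) (xt_inj j) (xt_inj (j+1))).toEquiv.subsingleton)
        (fun j hj => by
          refine lc_coker j hs' ?_ (hl (j+1) (by omega))
          rw [lc_vanish_iff]
          intro t ξ
          have := xt_homJ (𝔞 := 𝔞) (N := R ⧸ 𝔞 ^ t) (s := t) (by
            intro a ha x
            obtain ⟨x, rfl⟩ := Submodule.mkQ_surjective _ x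
            exact (Submodule.Quotient.mk_eq_zero (𝔞 ^ t)).2 (Ideal.mul_mem_right x _ ha)) J hJ0 j C
          exact ⟨t, le_rfl, Subsingleton.elim _ _⟩) i (by omega)
      exact e.symm.toEquiv.subsingleton

/-- Step 1 -/
lemma lc_semid [IsNoetherianRing R] (hC : IsSemidualizing R C) {n : ℕ}
    (h : ∀ i, i ≠ n → Subsingleton (lcoh R 𝔞 i R)) (i : ℕ) (hi : i ≠ n) :
    Subsingleton (lcoh R 𝔞 i C) := by
  have := hC.1
  rcases lt_or_gt_of_ne hi with hi | hi
  · refine lc_low (semid_ann hC) n C (semid_xt hC) (fun j hj => ?_) i hi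
    obtain ⟨e⟩ := lc_iso (𝔞 := 𝔞) j (semidE hC)
    have := h j (by omega)
    exact e.symm.toEquiv.subsingleton
  · exact lc_fg_vanish (fun j hj => h j (by omega)) i hi C

end ZZ

end Part10

section Part11
open CategoryTheory IsLocalRing
open Opposite
open TensorProduct

section Theta
variable {R : Type u} [CommRing R]
variable {K L Q I : Type u} [AddCommGroup K] [Module R K] [AddCommGroup L] [Module R L]
  [AddCommGroup Q] [Module R Q] [AddCommGroup I] [Module R I]

variable (R K Q I) in
/-- `K ⊗ Hom(Q,I) → Hom(Hom(K,Q),I)` -/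
noncomputable def theta : K ⊗[R] (Q →ₗ[R] I) →ₗ[R] ((K →ₗ[R] Q) →ₗ[R] I) :=
  TensorProduct.lift
    ((LinearMap.llcomp R (K →ₗ[R] Q) Q I).flip ∘ₗ (LinearMap.applyₗ (R := R) (M := K) (M₂ := Q)))

@[simp] lemma theta_tmul (k : K) (φ : Q →ₗ[R] I) (g : K →ₗ[R] Q) :
    theta R K Q I (k ⊗ₜ φ) g = φ (g k) := rfl

lemma theta_nat (f : K →ₗ[R] L) (z : K ⊗[R] (Q →ₗ[R] I)) (g : L →ₗ[R] Q) :
    theta R L Q I (f.rTensor _ z) g = theta R K Q I z (g ∘ₗ f) := by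
  induction z using TensorProduct.induction_on with
  | zero => simp
  | tmul k φ => simp
  | add x y hx hy => simp only [map_add, LinearMap.add_apply, hx, hy]

lemma theta_free (n : ℕ) : Function.Bijective (theta R (Fin n → R) Q I) := by
  classical
  let inv : (((Fin n → R) →ₗ[R] Q) →ₗ[R] I) → (Fin n → R) ⊗[R] (Q →ₗ[R] I) := fun ψ =>
    ∑ i, (Pi.single i (1:R)) ⊗ₜ[R]
      (ψ ∘ₗ (LinearMap.lcomp R Q (LinearMap.proj i : (Fin n → R) →ₗ[R] R)) ∘ₗ
        (LinearMap.ringLmapEquivSelf R R Q).symm.toLinearMap)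
  have inv_add : ∀ x y, inv (x + y) = inv x + inv y := by
    intro x y
    simp only [inv, LinearMap.add_comp, TensorProduct.tmul_add, Finset.sum_add_distrib]
  refine Function.bijective_iff_has_inverse.2 ⟨inv, ?_, ?_⟩
  · intro z
    induction z using TensorProduct.induction_on with
    | zero => simp [inv]
    | tmul x y =>
      have h1 : ∀ i, (theta R (Fin n → R) Q I (x ⊗ₜ y)) ∘ₗ
        (LinearMap.lcomp R Q (LinearMap.proj i : (Fin n → R) →ₗ[R] R)) ∘ₗ
        (LinearMap.ringLmapEquivSelf R R Q).symm.toLinearMap = x i • y := by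
        intro i
        ext q
        simp
      simp only [inv, h1, ← TensorProduct.smul_tmul]
      rw [← TensorProduct.sum_tmul]
      congr 1
      ext j
      simp [Finset.sum_apply, Pi.single_apply]
    | add x y hx hy => rw [map_add, inv_add, hx, hy]
  · intro ψ
    ext g
    simp only [inv, map_sum, LinearMap.sum_apply, theta_tmul, LinearMap.comp_apply]
    rw [← map_sum]
    congr 1
    ext j
    simp [Pi.single_apply]

lemma exists_free_surj [Module.Finite R K] : ∃ (n : ℕ) (p : (Fin n → R) →ₗ[R] K),
    Function.Surjective p := Module.Finite.exists_fin' R K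

lemma theta_surj [Module.Finite R K] [hI : Module.Injective R I] :
    Function.Surjective (theta R K Q I) := by
  obtain ⟨n, p, hp⟩ := exists_free_surj (R := R) (K := K)
  intro ψ
  have hinj : Function.Injective (LinearMap.lcomp R Q p) := by
    intro a b hab
    ext k
    obtain ⟨k, rfl⟩ := hp k
    exact congrArg (fun f => f k) hab
  obtain ⟨ψ', hψ'⟩ := hI.out _ hinj ψ
  obtain ⟨z, rfl⟩ := (theta_free n).2 ψ'
  refine ⟨p.rTensor _ z, ?_⟩
  ext g
  rw [theta_nat, ← hψ']
  rfl

lemma theta_inj [IsNoetherianRing R] [Module.Finite R K] [hI : Module.Injective R I] :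
    Function.Injective (theta R K Q I) := by
  obtain ⟨n, p, hp⟩ := exists_free_surj (R := R) (K := K)
  rw [injective_iff_map_eq_zero]
  intro x hx
  obtain ⟨x, rfl⟩ := LinearMap.rTensor_surjective (Q →ₗ[R] I) hp x
  let j := (LinearMap.ker p).subtype
  have hs : SES j p := SES.of_surj p hp
  let r := LinearMap.lcomp R Q j
  let ψ := theta R (Fin n → R) Q I x
  have hk : LinearMap.ker r ≤ LinearMap.ker ψ := by
    intro g hg
    have hg' : ∀ y, p y = 0 → g y = 0 := fun y hy => congrArg (fun f => f ⟨y, hy⟩) hg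
    obtain ⟨g', hg'⟩ : ∃ g' : K →ₗ[R] Q, g' ∘ₗ p = g := by
      refine ⟨(LinearMap.ker p).liftQ g (fun y hy => hg' y hy) ∘ₗ
        (p.quotKerEquivOfSurjective hp).symm.toLinearMap, ?_⟩
      ext y
      simp only [LinearMap.comp_apply, LinearEquiv.coe_coe]
      rw [show (p.quotKerEquivOfSurjective hp).symm (p (LinearMap.single R (fun _ => R) y 1))
        = (LinearMap.ker p).mkQ (LinearMap.single R (fun _ => R) y 1) from
          (p.quotKerEquivOfSurjective hp).symm_apply_eq.2 rfl]
      rfl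
    subst hg'
    change theta R (Fin n → R) Q I x (g' ∘ₗ p) = 0
    rw [← theta_nat, hx]; rfl
  obtain ⟨χ, hχ⟩ := inj_factor r ψ (fun a ha => hk ha)
  obtain ⟨z, rfl⟩ := theta_surj χ
  have : x = j.rTensor _ z := by
    apply (theta_free n).1
    ext g
    rw [theta_nat]
    exact (hχ g).symm
  rw [this, ← LinearMap.comp_apply, ← LinearMap.rTensor_comp, hs.comp_zero, LinearMap.rTensor_zero]
  rfl
end Theta

end Part11

section Part12
open CategoryTheory IsLocalRing
open Opposite
open TensorProduct

section TZ
variable {R : Type u} [CommRing R]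
variable {C : Type u} [AddCommGroup C] [Module R C]
variable {A B D : Type u} [AddCommGroup A] [Module R A] [AddCommGroup B] [Module R B]
  [AddCommGroup D] [Module R D] {f : A →ₗ[R] B} {g : B →ₗ[R] D}

variable (R C) in
/-- vanishing of all higher Tor against `C`, phrased through duals -/
def TZ (W : Type u) [AddCommGroup W] [Module R W] : Prop :=
  ∀ (E : Type u) [AddCommGroup E] [Module R E], Module.Injective R E →
    ∀ i, Subsingleton (XT R (i+1) C (W →ₗ[R] E))

lemma SES.dual (h : SES f g) (E : Type u) [AddCommGroup E] [Module R E] [Module.Injective R E] :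
    SES (LinearMap.lcomp R E g) (LinearMap.lcomp R E f) := h.homV E (xt_inj 0)

lemma TZ.lT (h : SES f g) (hD : TZ R C D) : Function.Injective (f.lTensor C) := by
  obtain ⟨E, _, _, ι, hE, hι⟩ := exists_inj_embed (R := R) (C ⊗[R] A)
  obtain ⟨ψ, hψ⟩ := ((h.dual E).homC C (hD E hE 0)).surj (TensorProduct.curry ι)
  have h1 : ι = TensorProduct.lift ψ ∘ₗ f.lTensor C := by
    ext c a
    exact (congrArg (fun k => k c a) hψ).symm
  intro x y hxy
  apply hι
  rw [h1, LinearMap.comp_apply, hxy, LinearMap.comp_apply]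

lemma TZ.ker (h : SES f g) (hB : TZ R C B) (hD : TZ R C D) : TZ R C A := by
  intro E _ _ hE i
  exact sub_mid (exC3 (h.dual E) (i+1)) (hB E hE i) (hD E hE (i+1))

lemma TZ.ext (h : SES f g) (hA : TZ R C A) (hD : TZ R C D) : TZ R C B := by
  intro E _ _ hE i
  exact sub_mid (exC2 (h.dual E) (i+1)) (hD E hE i) (hA E hE i)

lemma TZ.coker (h : SES f g) (hA : TZ R C A) (hB : TZ R C B)
    (hf : Function.Injective (f.lTensor C)) : TZ R C D := by
  intro E _ _ hE i
  cases i with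
  | succ i => exact sub_mid (exC1 (h.dual E) (i+1)) (hA E hE i) (hB E hE (i+1))
  | zero =>
    refine subsingleton_of_forall_eq 0 fun y => ?_
    have := hB E hE 0
    obtain ⟨x, rfl⟩ := (exC1 (N := C) (h.dual E) 0 y).1 (Subsingleton.elim _ _)
    refine (exC3 (h.dual E) 0 x).2 ?_
    obtain ⟨x, rfl⟩ := h0.surjective x
    obtain ⟨k, hk⟩ := hE.out _ hf (TensorProduct.lift x)
    refine ⟨h0 (TensorProduct.curry k), ?_⟩
    rw [pf_h0]
    congr 1
    ext c a
    exact hk (c ⊗ₜ a)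

lemma TZ.of_sub [Subsingleton D] : TZ R C D := by
  intro E _ _ hE i
  exact xt_sub_right _

lemma TZ.ring : TZ R C R := by
  intro E _ _ hE i
  have := hom_flat_inj (R := R) R E
  exact xt_inj i

/-- (L) -/
lemma TZ.homI [IsNoetherianRing R] {Q I : Type u} [AddCommGroup Q] [Module R Q]
    [AddCommGroup I] [Module R I] [hI : Module.Injective R I] (E : Type u) [AddCommGroup E]
    [Module R E] (hE : Module.Injective R E) (i : ℕ) :
    ∀ (C : Type u) [AddCommGroup C] [Module R C] [Module.Finite R C],
    (∀ j, Subsingleton (XT R (j+1) C Q)) →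
      Subsingleton (XT R (i+1) C ((Q →ₗ[R] I) →ₗ[R] E)) := by
  induction i with
  | zero =>
    intro C _ _ _ hC
    obtain ⟨n, p, hp⟩ := exists_free_surj (R := R) (K := C)
    have hs := SES.of_surj p hp
    have hinj : Function.Injective ((LinearMap.ker p).subtype.rTensor (Q →ₗ[R] I)) := by
      rw [injective_iff_map_eq_zero]
      intro z hz
      apply theta_inj
      rw [map_zero]
      ext g
      obtain ⟨g', hg'⟩ := (hs.homV Q (hC 0)).surj g
      rw [← hg']
      change theta R _ Q I z (g' ∘ₗ (LinearMap.ker p).subtype) = 0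
      rw [← theta_nat, hz, map_zero]; rfl
    refine subsingleton_of_forall_eq 0 fun y => ?_
    have := xt_proj (R := R) (A := Fin n → R) (B := (Q →ₗ[R] I) →ₗ[R] E) 0
    obtain ⟨x, rfl⟩ := (exV3 hs 0 y).1 (Subsingleton.elim _ _)
    refine (exV1 hs 0 x).2 ?_
    obtain ⟨x, rfl⟩ := h0.surjective x
    obtain ⟨k, hk⟩ := inj_factor (R := R) (A := (LinearMap.ker p) ⊗[R] (Q →ₗ[R] I))
      (B := (Fin n → R) ⊗[R] (Q →ₗ[R] I)) (G := E)
      ((LinearMap.ker p).subtype.rTensor (Q →ₗ[R] I)) (TensorProduct.lift x)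
      (fun z hz => by
        rw [(injective_iff_map_eq_zero _).1 hinj z hz, map_zero])
    refine ⟨h0 (TensorProduct.curry k), ?_⟩
    rw [pb_h0]
    congr 1
    ext c a
    exact hk (c ⊗ₜ a)
  | succ i ih =>
    intro C _ _ _ hC
    obtain ⟨n, p, hp⟩ := exists_free_surj (R := R) (K := C)
    have hs := SES.of_surj p hp
    have h1 := ih (LinearMap.ker p) (fun j =>
      sub_mid (exV1 (M := Q) hs (j+1)) (xt_proj j) (hC (j+1)))
    exact sub_mid (exV3 hs (i+1)) h1 (xt_proj (i+1))

lemma TZ.L [IsNoetherianRing R] [Module.Finite R C] {Q I : Type u} [AddCommGroup Q] [Module R Q]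
    [AddCommGroup I] [Module R I] [hI : Module.Injective R I]
    (hQ : ∀ j, Subsingleton (XT R (j+1) C Q)) : TZ R C (Q →ₗ[R] I) := by
  intro E _ _ hE i
  exact TZ.homI E hE i C hQ

lemma SES.ten (h : SES f g) (hf : Function.Injective (f.lTensor C)) :
    SES (f.lTensor C) (g.lTensor C) :=
  ⟨hf, LinearMap.lTensor_surjective C h.surj, lTensor_exact C h.ex h.surj⟩

/-- `C ⊗ E = 0` forces `E = 0`. -/
lemma ten_faithful [IsNoetherianRing R] [Module.Finite R C] (hC : Module.annihilator R C = ⊥)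
    (E : Type u) [AddCommGroup E] [Module R E] (h : Subsingleton (C ⊗[R] E)) :
    Subsingleton E := by
  obtain ⟨J, _, _, ι, hJ, hι⟩ := exists_inj_embed (R := R) E
  have h1 : Subsingleton (E →ₗ[R] J) := by
    refine hom_faithful hC _ fun φ => ?_
    ext c e
    have : TensorProduct.lift φ (c ⊗ₜ e) = 0 := by
      rw [Subsingleton.elim (c ⊗ₜ e) 0, map_zero]
    exact this
  refine subsingleton_of_forall_eq 0 fun e => hι ?_
  rw [Subsingleton.elim ι 0]; rfl

end TZ

section BC
variable {R : Type u} [CommRing R]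
variable {C : Type u} [AddCommGroup C] [Module R C]

variable (R C) in
/-- evaluation -/
noncomputable def evM (M : Type u) [AddCommGroup M] [Module R M] : C ⊗[R] (C →ₗ[R] M) →ₗ[R] M :=
  TensorProduct.lift LinearMap.applyₗ

@[simp] lemma evM_tmul {M : Type u} [AddCommGroup M] [Module R M] (c : C) (φ : C →ₗ[R] M) :
  evM R C M (c ⊗ₜ φ) = φ c := rfl

lemma evM_nat {M N : Type u} [AddCommGroup M] [Module R M] [AddCommGroup N] [Module R N]
    (f : M →ₗ[R] N) (z : C ⊗[R] (C →ₗ[R] M)) :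
    evM R C N ((f.compRight R : (C →ₗ[R] M) →ₗ[R] (C →ₗ[R] N)).lTensor C z) = f (evM R C M z) := by
  induction z using TensorProduct.induction_on with
  | zero => simp
  | tmul k φ => rfl
  | add x y hx hy => simp only [map_add, hx, hy]

lemma evM_theta {M : Type u} [AddCommGroup M] [Module R M] (z : C ⊗[R] (C →ₗ[R] M)) :
    evM R C M z = theta R C C M z LinearMap.id := by
  induction z using TensorProduct.induction_on with
  | zero => simp
  | tmul k φ => rfl
  | add x y hx hy => simp only [map_add, hx, hy, LinearMap.add_apply]

lemma bcl_inj [IsNoetherianRing R] (hC : IsSemidualizing R C) (M : Type u) [AddCommGroup M]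
    [Module R M] [Module.Injective R M] :
    TZ R C (C →ₗ[R] M) ∧ Function.Bijective (evM R C M) := by
  have := hC.1
  refine ⟨TZ.L (semid_xt hC), ?_, ?_⟩
  · rw [injective_iff_map_eq_zero]
    intro z hz
    apply theta_inj
    rw [map_zero]
    ext g
    obtain ⟨r, rfl⟩ := hC.2.1.2 g
    change theta R C C M z (r • LinearMap.id) = 0
    rw [map_smul, ← evM_theta, hz, smul_zero]
  · intro m
    obtain ⟨z, hz⟩ := theta_surj (R := R) (K := C) (Q := C) (I := M)
      (LinearMap.toSpanSingleton R M m ∘ₗ (semidE hC).symm.toLinearMap)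
    refine ⟨z, ?_⟩
    rw [evM_theta, hz]
    have : (semidE hC).symm LinearMap.id = 1 := by
      rw [LinearEquiv.symm_apply_eq]
      exact (one_smul R _).symm
    simp [this]

lemma bcl [IsNoetherianRing R] (hC : IsSemidualizing R C) (k : ℕ) :
    ∀ (M : Type u) [AddCommGroup M] [Module R M], iD R k M →
    TZ R C (C →ₗ[R] M) ∧ Function.Bijective (evM R C M) := by
  have := hC.1
  induction k with
  | zero =>
    intro M _ _ hM
    have := inj_of_fD hM.fD
    exact bcl_inj hC M
  | succ k ih =>
    intro M _ _ hM
    obtain ⟨J, _, _, f, hJ, hf⟩ := exists_inj_embed (R := R) M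
    have hs := SES.of_inj f hf
    obtain ⟨hN1, hN2⟩ := ih (J ⧸ LinearMap.range f) (hs.shiftI hM)
    obtain ⟨hJ1, hJ2⟩ := bcl_inj hC J
    let q := (LinearMap.range f).mkQ
    let q' : (C →ₗ[R] J) →ₗ[R] (C →ₗ[R] (J ⧸ LinearMap.range f)) := q.compRight R
    let f' : (C →ₗ[R] M) →ₗ[R] (C →ₗ[R] J) := f.compRight R
    have hq1 : Function.Surjective (q'.lTensor C) := by
      intro z
      obtain ⟨j, hj⟩ := hs.surj (evM R C _ z)
      obtain ⟨w, rfl⟩ := hJ2.2 j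
      refine ⟨w, hN2.1 ?_⟩
      rw [← hj]
      exact evM_nat q w
    have hq2 : Subsingleton ((C →ₗ[R] (J ⧸ LinearMap.range f)) ⧸ LinearMap.range q') := by
      refine ten_faithful (semid_ann hC) _ ?_
      refine subsingleton_of_forall_eq 0 fun z => ?_
      obtain ⟨z, rfl⟩ := LinearMap.lTensor_surjective C (Submodule.mkQ_surjective _) z
      obtain ⟨z, rfl⟩ := hq1 z
      rw [← LinearMap.comp_apply, ← LinearMap.lTensor_comp, LinearMap.range_mkQ_comp,
        LinearMap.lTensor_zero]
      rfl
    have hq3 : Function.Surjective q' := by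
      rw [← LinearMap.range_eq_top]
      exact Submodule.Quotient.subsingleton_iff.1 hq2
    have hs' : SES f' q' := by
      refine ⟨?_, hq3, ?_⟩
      · intro x y hxy
        ext n
        exact hf (congrArg (fun f => f n) hxy)
      · intro x
        constructor
        · intro hx
          have : pf 0 C q (h0 x) = 0 := by
            rw [pf_h0]
            have : q ∘ₗ x = 0 := hx
            rw [this, map_zero]
          obtain ⟨y, hy⟩ := (exC2 hs 0 _).1 this
          obtain ⟨y, rfl⟩ := h0.surjective y
          rw [pf_h0] at hy
          exact ⟨y, h0.injective hy⟩
        · rintro ⟨y, rfl⟩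
          ext n
          exact hs.apply _
    have ht := hs'.ten (TZ.lT hs' hN1)
    refine ⟨TZ.ker hs' hJ1 hN1, ?_, ?_⟩
    · intro x y hxy
      apply ht.inj
      apply hJ2.1
      rw [evM_nat, evM_nat, hxy]
    · intro m
      obtain ⟨z, hz⟩ := hJ2.2 (f m)
      have : q'.lTensor C z = 0 := by
        apply hN2.1
        rw [evM_nat, hz, map_zero]
        exact hs.apply m
      obtain ⟨w, rfl⟩ := (ht.ex z).1 this
      refine ⟨w, hf ?_⟩
      rw [← hz, evM_nat]

/-- Gorenstein implies `C ≅ R`. -/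
lemma semid_of_gor [IsNoetherianRing R] [IsLocalRing R] (hC : IsSemidualizing R C) {k : ℕ}
    (hR : iD R k R) : Nonempty (C ≃ₗ[R] R) := by
  obtain ⟨z, hz⟩ := (bcl hC k R hR).2.2 1
  have h1 : ∃ (c : C) (f : C →ₗ[R] R), IsUnit (f c) := by
    by_contra hc
    push Not at hc
    have : ∀ z, evM R C R z ∈ maximalIdeal R := by
      intro z
      induction z using TensorProduct.induction_on with
      | zero => rw [map_zero]; exact Ideal.zero_mem _
      | tmul c f => exact (mem_maximalIdeal _).2 (hc c f)
      | add x y hx hy => rw [map_add]; exact Ideal.add_mem _ hx hy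
    have h2 := this z
    rw [hz] at h2
    exact (Ideal.ne_top_iff_one _).1 (maximalIdeal.isMaximal R).ne_top h2
  obtain ⟨c, f, hu⟩ := h1
  obtain ⟨u, hu⟩ := hu
  let c' : C := (↑u⁻¹ : R) • c
  have hc' : f c' = 1 := by simp [c', ← hu]
  obtain ⟨r, hr⟩ := hC.2.1.2 (f.smulRight c')
  have hr' : ∀ y, r • y = f y • c' := fun y => congrArg (fun k => k y) hr
  have h3 : r • c' = c' := by rw [hr', hc', one_smul]
  have h4 : r = 1 := by
    have := congrArg f h3
    rw [map_smul, hc', smul_eq_mul, mul_one] at this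
    exact this
  subst h4
  refine ⟨LinearEquiv.ofBijective f ⟨?_, ?_⟩⟩
  · rw [injective_iff_map_eq_zero]
    intro y hy
    rw [← one_smul R y, hr', hy, zero_smul]
  · intro s
    exact ⟨s • c', by rw [map_smul, hc', smul_eq_mul, mul_one]⟩

end BC

end Part12

section Part13
open CategoryTheory IsLocalRing
open Opposite
open TensorProduct

section AC
variable {R : Type u} [CommRing R]
variable {C : Type u} [AddCommGroup C] [Module R C]
variable {A B D : Type u} [AddCommGroup A] [Module R A] [AddCommGroup B] [Module R B]
  [AddCommGroup D] [Module R D] {f : A →ₗ[R] B} {g : B →ₗ[R] D}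

variable (R C) in
noncomputable def unM (W : Type u) [AddCommGroup W] [Module R W] : W →ₗ[R] (C →ₗ[R] C ⊗[R] W) :=
  (TensorProduct.mk R C W).flip

@[simp] lemma unM_apply {W : Type u} [AddCommGroup W] [Module R W] (w : W) (c : C) :
    unM R C W w c = c ⊗ₜ w := rfl

lemma unM_nat (f : A →ₗ[R] B) (a : A) : unM R C B (f a) = f.lTensor C ∘ₗ unM R C A a := by
  ext c; rfl

variable (R C) in
/-- Auslander class -/
structure ACl (W : Type u) [AddCommGroup W] [Module R W] : Prop where
  tz : TZ R C W
  xt : ∀ i, Subsingleton (XT R (i+1) C (C ⊗[R] W))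
  inj : Function.Injective (unM R C W)
  surj : Function.Surjective (unM R C W)

/-- left exactness of Hom -/
lemma SES.lift_hom (h : SES f g) {N : Type u} [AddCommGroup N] [Module R N] (φ : N →ₗ[R] B)
    (hφ : g ∘ₗ φ = 0) : ∃ ψ : N →ₗ[R] A, f ∘ₗ ψ = φ := by
  have : pf 0 N g (h0 φ) = 0 := by rw [pf_h0, hφ, map_zero]
  obtain ⟨y, hy⟩ := (exC2 h 0 _).1 this
  obtain ⟨y, rfl⟩ := h0.surjective y
  rw [pf_h0] at hy
  exact ⟨y, h0.injective hy⟩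

lemma SES.comp_inj (h : SES f g) {N : Type u} [AddCommGroup N] [Module R N] {φ ψ : N →ₗ[R] A}
    (hφ : f ∘ₗ φ = f ∘ₗ ψ) : φ = ψ := by
  ext n
  exact h.inj (congrArg (fun k => k n) hφ)

lemma ACl.of_sub [Subsingleton D] : ACl R C D := by
  have h1 : Subsingleton (C ⊗[R] D) := by
    refine subsingleton_of_forall_eq 0 fun z => ?_
    induction z using TensorProduct.induction_on with
    | zero => rfl
    | tmul c d => rw [Subsingleton.elim d 0, TensorProduct.tmul_zero]
    | add x y hx hy => rw [hx, hy, add_zero]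
  refine ⟨TZ.of_sub, fun i => xt_sub_right _, fun x y _ => Subsingleton.elim _ _, fun φ => ⟨0, ?_⟩⟩
  ext c
  exact Subsingleton.elim _ _

lemma ACl.ker (h : SES f g) (hB : ACl R C B) (hD : ACl R C D) : ACl R C A := by
  have ht : SES (f.lTensor C) (g.lTensor C) := h.ten (TZ.lT h hD.tz)
  have hinj : Function.Injective (unM R C A) := by
    intro x y hxy
    apply h.inj
    apply hB.inj
    rw [unM_nat, unM_nat, hxy]
  refine ⟨TZ.ker h hB.tz hD.tz, ?_, hinj, ?_⟩
  · intro i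
    cases i with
    | succ i => exact sub_mid (exC1 ht (i+1)) (hD.xt i) (hB.xt (i+1))
    | zero =>
      refine subsingleton_of_forall_eq 0 fun y => ?_
      have := hB.xt 0
      obtain ⟨x, rfl⟩ := (exC1 (N := C) ht 0 y).1 (Subsingleton.elim _ _)
      refine (exC3 ht 0 x).2 ?_
      obtain ⟨x, rfl⟩ := h0.surjective x
      obtain ⟨d, rfl⟩ := hD.surj x
      obtain ⟨b, rfl⟩ := h.surj d
      refine ⟨h0 (unM R C B b), ?_⟩
      rw [pf_h0, unM_nat]
  · intro φ
    obtain ⟨b, hb⟩ := hB.surj (f.lTensor C ∘ₗ φ)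
    have : g b = 0 := by
      apply hD.inj
      rw [unM_nat, hb, map_zero, ← LinearMap.comp_assoc, ht.comp_zero, LinearMap.zero_comp]
    obtain ⟨a, rfl⟩ := (h.ex b).1 this
    refine ⟨a, ht.comp_inj ?_⟩
    rw [← unM_nat, hb]

lemma ACl.ext (h : SES f g) (hA : ACl R C A) (hD : ACl R C D) : ACl R C B := by
  have ht : SES (f.lTensor C) (g.lTensor C) := h.ten (TZ.lT h hD.tz)
  refine ⟨TZ.ext h hA.tz hD.tz, fun i => sub_mid (exC2 ht (i+1)) (hA.xt i) (hD.xt i), ?_, ?_⟩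
  · rw [injective_iff_map_eq_zero]
    intro b hb
    have : g b = 0 := by
      apply hD.inj
      rw [unM_nat, hb, map_zero, LinearMap.comp_zero]
    obtain ⟨a, rfl⟩ := (h.ex b).1 this
    have : a = 0 := by
      apply hA.inj
      apply ht.comp_inj
      rw [← unM_nat, hb, map_zero, LinearMap.comp_zero]
    rw [this, map_zero]
  · intro φ
    obtain ⟨d, hd⟩ := hD.surj (g.lTensor C ∘ₗ φ)
    obtain ⟨b, rfl⟩ := h.surj d
    obtain ⟨ψ, hψ⟩ := ht.lift_hom (φ - unM R C B b) (by
      rw [LinearMap.comp_sub, ← unM_nat, hd, sub_self])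
    obtain ⟨a, rfl⟩ := hA.surj ψ
    refine ⟨f a + b, ?_⟩
    rw [map_add, unM_nat, hψ, sub_add_cancel]

lemma ACl.coker_lT [IsNoetherianRing R] [Module.Finite R C] (hC : Module.annihilator R C = ⊥)
    (hf : Function.Injective f) (hA : ACl R C A) (hB : ACl R C B) :
    Function.Injective (f.lTensor C) := by
  rw [← LinearMap.ker_eq_bot, ← Submodule.subsingleton_iff_eq_bot]
  refine hom_faithful hC _ fun φ => ?_
  obtain ⟨a, ha⟩ := hA.surj ((LinearMap.ker (f.lTensor C)).subtype ∘ₗ φ)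
  have : a = 0 := by
    apply hf
    apply hB.inj
    rw [unM_nat, ha, map_zero, map_zero]
    ext c
    exact (φ c).2
  ext c
  have h1 := congrArg (fun k => k c) ha
  rw [this, map_zero] at h1
  exact h1.symm

lemma ACl.coker [IsNoetherianRing R] [Module.Finite R C] (hC : Module.annihilator R C = ⊥)
    (h : SES f g) (hA : ACl R C A) (hB : ACl R C B) : ACl R C D := by
  have hf := ACl.coker_lT hC h.inj hA hB
  have ht : SES (f.lTensor C) (g.lTensor C) := h.ten hf
  refine ⟨TZ.coker h hA.tz hB.tz hf,
    fun i => sub_mid (exC3 ht (i+1)) (hB.xt i) (hA.xt (i+1)), ?_, ?_⟩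
  · rw [injective_iff_map_eq_zero]
    intro d hd
    obtain ⟨b, rfl⟩ := h.surj d
    obtain ⟨ψ, hψ⟩ := ht.lift_hom (unM R C B b) (by rw [← unM_nat, hd])
    obtain ⟨a, rfl⟩ := hA.surj ψ
    rw [← unM_nat] at hψ
    rw [← hB.inj hψ]
    exact h.apply a
  · intro φ
    obtain ⟨ψ, hψ⟩ := (ht.homC C (hA.xt 0)).surj φ
    obtain ⟨b, rfl⟩ := hB.surj ψ
    refine ⟨g b, ?_⟩
    rw [unM_nat]
    exact hψ

lemma ACl.iso (e : A ≃ₗ[R] B) (hB : ACl R C B) : ACl R C A := by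
  refine ACl.ker (D := PUnit.{u+1}) (f := e.toLinearMap) (g := 0)
    ⟨e.injective, fun x => ⟨0, Subsingleton.elim _ _⟩, fun x => ⟨fun _ => e.surjective x, fun _ => rfl⟩⟩
    hB ACl.of_sub

lemma ACl.ring (hC : IsSemidualizing R C) : ACl R C R := by
  have hx : ∀ r c, TensorProduct.rid R C (unM R C R r c) = r • c := fun r c => rfl
  refine ⟨TZ.ring, fun i => ?_, ?_, ?_⟩
  · have := semid_xt hC i
    exact (pfE (i+1) C (TensorProduct.rid R C)).toEquiv.subsingleton
  · intro r s h
    apply hC.2.1.1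
    ext c
    change r • c = s • c
    rw [← hx, ← hx, h]
  · intro φ
    obtain ⟨r, hr⟩ := hC.2.1.2 ((TensorProduct.rid R C).toLinearMap ∘ₗ φ)
    refine ⟨r, ?_⟩
    ext c
    apply (TensorProduct.rid R C).injective
    rw [hx]
    exact congrArg (fun k => k c) hr

/-- `Hom(C ⊗ N, I)` is in the Auslander class when `N` is. -/
lemma ACl.dual [IsNoetherianRing R] [Module.Finite R C] {N I : Type u} [AddCommGroup N]
    [Module R N] [AddCommGroup I] [Module R I] [hI : Module.Injective R I] (hN : ACl R C N) :
    ACl R C ((C ⊗[R] N) →ₗ[R] I) := by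
  let e1 : C ⊗[R] ((C ⊗[R] N) →ₗ[R] I) ≃ₗ[R] ((C →ₗ[R] (C ⊗[R] N)) →ₗ[R] I) :=
    LinearEquiv.ofBijective (theta R C (C ⊗[R] N) I) ⟨theta_inj, theta_surj⟩
  let e2 : N ≃ₗ[R] (C →ₗ[R] (C ⊗[R] N)) := LinearEquiv.ofBijective (unM R C N) ⟨hN.inj, hN.surj⟩
  let e3 : ((C →ₗ[R] (C ⊗[R] N)) →ₗ[R] I) ≃ₗ[R] (N →ₗ[R] I) := LinearEquiv.congrLeft I R e2.symm
  let e := e1.trans e3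
  have he : ∀ c φ n, e (c ⊗ₜ φ) n = φ (c ⊗ₜ n) := by
    intro c φ n
    rfl
  refine ⟨TZ.L hN.xt, fun i => ?_, ?_, ?_⟩
  · have := hN.tz I hI i
    exact (pfE (i+1) C e).toEquiv.subsingleton
  · intro φ ψ h
    ext c n
    change φ (c ⊗ₜ n) = ψ (c ⊗ₜ n)
    rw [← he, ← he]
    exact congrArg (fun k => e (k c) n) h
  · intro φ
    refine ⟨TensorProduct.lift (e.toLinearMap ∘ₗ φ), ?_⟩
    ext c
    apply e.injective
    ext n
    rw [unM_apply, he]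
    rfl

end AC

end Part13

section Part14
open CategoryTheory IsLocalRing
open Opposite
open TensorProduct

section Claim
variable {R : Type u} [CommRing R] [IsNoetherianRing R]
variable {C : Type u} [AddCommGroup C] [Module R C] [Module.Finite R C]

lemma acl_cinj {N X : Type u} [AddCommGroup N] [Module R N] [AddCommGroup X] [Module R X]
    (hN : ACl R C N) (hX : IsCInjective R C X) : ACl R C (XT R 0 N X) := by
  obtain ⟨I, hI, ⟨e⟩⟩ := hX
  have e1 : (N →ₗ[R] (C →ₗ[R] I)) ≃ₗ[R] (C ⊗[R] N →ₗ[R] I) :=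
    LinearMap.lflip.trans (TensorProduct.lift.equiv (RingHom.id R) C N I)
  exact ACl.iso ((pfE 0 N e).trans (h0.symm.trans e1)) hN.dual

lemma acl_claim (hC : Module.annihilator R C = ⊥) {N : Type u} [AddCommGroup N] [Module R N]
    (hN : ACl R C N)
    (hN2 : ∀ (X : Type u) [AddCommGroup X] [Module R X], IsCInjective R C X →
      ∀ i, Subsingleton (XT R (i+1) N X)) (k : ℕ) :
    ∀ (M : ModuleCat.{u} R), CoresDimLE R (fun N => IsCInjective R C N) k M → ∀ e,
    (∀ i, i ≠ e → ACl R C (XT R i N M)) → ACl R C (XT R e N M) := by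
  induction k with
  | zero =>
    intro M hM e he
    have hM : IsCInjective R C M := hM
    cases e with
    | zero => exact acl_cinj hN hM
    | succ e =>
      have := hN2 M hM e
      exact ACl.of_sub
  | succ k ih =>
    intro M hM e he
    rcases hM with hM | ⟨X, f, hX, hf, hM⟩
    · exact ih M hM e he
    have hX : IsCInjective R C X := hX
    have hs := SES.of_inj f hf
    let q := (LinearMap.range f).mkQ
    have es : ∀ i, Nonempty (XT R (i+1) N (X ⧸ LinearMap.range f) ≃ₗ[R] XT R (i+2) N M) := fun i =>
      ⟨dCE hs (i+1) (hN2 X hX i) (hN2 X hX (i+1))⟩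
    have hX0 : ACl R C (XT R 0 N X) := acl_cinj hN hX
    have s1 : SES (pf 0 N f) (pf 0 N q).rangeRestrict := by
      refine ⟨?_, LinearMap.surjective_rangeRestrict _, ?_⟩
      · intro x y hxy
        obtain ⟨x, rfl⟩ := h0.surjective x
        obtain ⟨y, rfl⟩ := h0.surjective y
        rw [pf_h0, pf_h0] at hxy
        congr 1
        exact hs.comp_inj (h0.injective hxy)
      · intro x
        rw [← exC2 hs 0 x]
        exact Subtype.ext_iff
    have s2 : SES (LinearMap.range (pf 0 N q)).subtype (dC hs 0 N) := by
      refine ⟨Subtype.val_injective, surj_of_sub (exC1 hs 0) (hN2 X hX 0), ?_⟩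
      intro x
      rw [exC3 hs 0 x]
      simp only [Submodule.coe_subtype, Subtype.range_coe_subtype, LinearMap.mem_range, Set.mem_setOf_eq, Set.mem_range]
      exact Iff.rfl
    have ih' := ih _ hM
    match e, he with
    | 0, he =>
      have h1 : ACl R C (XT R 0 N (X ⧸ LinearMap.range f)) := ih' 0 (fun i hi => by
        obtain ⟨i, rfl⟩ := Nat.exists_eq_succ_of_ne_zero hi
        obtain ⟨e⟩ := es i
        exact ACl.iso e (he (i+2) (by omega)))
      exact ACl.ker s1 hX0 (ACl.ker s2 h1 (he 1 (by omega)))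
    | 1, he =>
      have h1 : ACl R C (XT R 0 N (X ⧸ LinearMap.range f)) := ih' 0 (fun i hi => by
        obtain ⟨i, rfl⟩ := Nat.exists_eq_succ_of_ne_zero hi
        obtain ⟨e⟩ := es i
        exact ACl.iso e (he (i+2) (by omega)))
      exact ACl.coker hC s2 (ACl.coker hC s1 (he 0 (by omega)) hX0) h1
    | e+2, he =>
      obtain ⟨e'⟩ := es e
      refine ACl.iso e'.symm (ih' (e+1) (fun i hi => ?_))
      cases i with
      | zero => exact ACl.ext s2 (ACl.coker hC s1 (he 0 (by omega)) hX0) (he 1 (by omega))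
      | succ i =>
        obtain ⟨e''⟩ := es i
        exact ACl.iso e'' (he (i+2) (by omega))

end Claim

section Good
variable {R : Type u} [CommRing R] [IsNoetherianRing R] [IsLocalRing R]
variable {C : Type u} [AddCommGroup C] [Module R C]

variable (R C) in
structure GoodN (d : ℕ) (N : Type u) [AddCommGroup N] [Module R N] : Prop where
  acl : ACl R C N
  hX : ∀ (I : Type u) [AddCommGroup I] [Module R I], Module.Injective R I →
      ∀ i, Subsingleton (XT R (i+1) N (C →ₗ[R] I))
  van : ∀ i, i ≠ d → Subsingleton (XT R i N C)
  top : Nonempty (XT R d N C ≃ₗ[R] C ⊗[R] N)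
  nu : ∃ ν : N →ₗ[R] (R ⧸ maximalIdeal R), Function.Surjective ν

lemma good_ring (hC : IsSemidualizing R C) : GoodN R C 0 R where
  acl := ACl.ring hC
  hX I _ _ _ i := xt_proj i
  van i hi := by
    obtain ⟨i, rfl⟩ := Nat.exists_eq_succ_of_ne_zero hi
    exact xt_proj i
  top := ⟨h0.symm.trans ((LinearMap.ringLmapEquivSelf R R C).trans (TensorProduct.rid R C).symm)⟩
  nu := ⟨(maximalIdeal R).mkQ, Submodule.mkQ_surjective _⟩

lemma smul_ses {N : Type u} [AddCommGroup N] [Module R N] {x : R} (hx : IsSMulRegular N x) :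
    SES (x • (LinearMap.id : N →ₗ[R] N)) (LinearMap.range (x • (LinearMap.id : N →ₗ[R] N))).mkQ :=
  SES.of_inj _ hx

lemma good_step (hC : IsSemidualizing R C) {d : ℕ} {N : Type u} [AddCommGroup N] [Module R N]
    (hN : GoodN R C d N) {x : R} (hxm : x ∈ maximalIdeal R) (hx : IsSMulRegular N x) :
    GoodN R C (d+1) (N ⧸ LinearMap.range (x • (LinearMap.id : N →ₗ[R] N))) := by
  have := hC.1
  have hs := smul_ses hx
  let m := (x • (LinearMap.id : N →ₗ[R] N))
  have hlT := ACl.coker_lT (semid_ann hC) hs.inj hN.acl hN.acl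
  have ht := hs.ten hlT
  have hm : ∀ z : C ⊗[R] N, m.lTensor C z = x • z := by
    intro z
    rw [LinearMap.lTensor_smul, LinearMap.lTensor_id]; rfl
  have hinj : ∀ z : C ⊗[R] N, x • z = 0 → z = 0 := by
    intro z hz
    apply hlT
    rw [map_zero]
    exact (hm z).trans hz
  have hpb : ∀ {i : ℕ} (z : XT R i N C), pb i C m z = x • z := by
    intro i z
    rw [pb_smul, pb_id]
  have hker : ∀ (i : ℕ) (z : XT R i N C), x • z = 0 → z = 0 := by
    intro i z hz
    by_cases hi : i = d
    · subst hi
      obtain ⟨e⟩ := hN.top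
      apply e.injective
      rw [map_zero]
      apply hinj
      rw [← map_smul, hz, map_zero]
    · have := hN.van i hi
      exact Subsingleton.elim _ _
  refine ⟨ACl.coker (semid_ann hC) hs hN.acl hN.acl, ?_, ?_, ?_, ?_⟩
  · intro I _ _ hI i
    cases i with
    | succ i => exact sub_mid (exV3 hs (i+1)) (hN.hX I hI i) (hN.hX I hI (i+1))
    | zero =>
      refine subsingleton_of_forall_eq 0 fun y => ?_
      have := hN.hX I hI 0
      obtain ⟨ξ, rfl⟩ := (exV3 hs 0 y).1 (Subsingleton.elim _ _)
      refine (exV1 hs 0 ξ).2 ?_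
      obtain ⟨φ, rfl⟩ := h0.surjective ξ
      obtain ⟨k, hk⟩ := inj_factor (R := R) (A := C ⊗[R] N) (B := C ⊗[R] N) (G := I)
        (m.lTensor C) (TensorProduct.lift φ.flip) (fun z hz => by
          rw [(injective_iff_map_eq_zero _).1 hlT z hz, map_zero])
      refine ⟨h0 (TensorProduct.curry k).flip, ?_⟩
      rw [pb_h0]
      congr 1
      ext n c
      exact hk (c ⊗ₜ n)
  · intro i hi
    have h1 : ∀ y : XT R i (N ⧸ LinearMap.range m) C, pb i C (LinearMap.range m).mkQ y = 0 := by
      intro y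
      apply hker
      rw [← hpb]
      exact (exV2 hs i _).2 ⟨y, rfl⟩
    refine subsingleton_of_forall_eq 0 fun y => ?_
    cases i with
    | zero =>
      have h2 := h1 y
      obtain ⟨y, rfl⟩ := h0.surjective y
      rw [pb_h0] at h2
      rw [LinearEquiv.map_eq_zero_iff] at h2 ⊢
      ext n
      exact congrArg (fun k => k n) h2
    | succ i =>
      obtain ⟨z, rfl⟩ := (exV3 hs i y).1 (h1 y)
      have := hN.van i (by omega)
      rw [Subsingleton.elim z 0, map_zero]
  · obtain ⟨e⟩ := hN.top
    have hv := hN.van (d+1) (by omega)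
    have hsurj := surj_of_sub (exV3 (M := C) hs d) hv
    obtain ⟨e', -⟩ := equiv_of_surj (R := R) (Z := XT R d N C)
      (A := XT R (d+1) (N ⧸ LinearMap.range m) C) (B := C ⊗[R] (N ⧸ LinearMap.range m))
      (dV hs d C) ((LinearMap.range m).mkQ.lTensor C ∘ₗ e.toLinearMap) hsurj
      (ht.surj.comp e.surjective) (fun z => by
        rw [exV1 hs d z]
        rw [LinearMap.comp_apply, ht.ex]
        constructor
        · rintro ⟨y, rfl⟩
          exact ⟨e y, by rw [LinearEquiv.coe_coe, hpb, map_smul]; exact hm _⟩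
        · rintro ⟨y, hy⟩
          refine ⟨e.symm y, e.injective ?_⟩
          rw [hpb, map_smul, LinearEquiv.apply_symm_apply]
          exact (hm y).symm.trans hy)
    exact ⟨e'⟩
  · obtain ⟨ν, hν⟩ := hN.nu
    refine ⟨(LinearMap.range m).liftQ ν ?_, ?_⟩
    · rintro _ ⟨y, rfl⟩
      change ν (x • y) = 0
      rw [map_smul]
      obtain ⟨r, hr⟩ := Submodule.mkQ_surjective _ (ν y)
      rw [← hr]
      exact (Submodule.Quotient.mk_eq_zero _).2 (Ideal.mul_mem_right r _ hxm)
    · intro k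
      obtain ⟨n, rfl⟩ := hν k
      exact ⟨Submodule.Quotient.mk n, rfl⟩

end Good

end Part14

section Part15
open CategoryTheory IsLocalRing
open Opposite
open TensorProduct

section Fin1
variable {R : Type u} [CommRing R] [IsNoetherianRing R] [IsLocalRing R]
variable {C : Type u} [AddCommGroup C] [Module R C]

open Pointwise in
lemma good_list (hC : IsSemidualizing R C) (rs : List R) :
    (∀ x ∈ rs, x ∈ maximalIdeal R) → ∀ (d : ℕ) (N : Type u) [AddCommGroup N] [Module R N]
      (J : Ideal R), GoodN R C d N → (∀ a ∈ J, ∀ y : N, a • y = 0) →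
      RingTheory.Sequence.IsWeaklyRegular N rs →
      ∃ (N' : Type u) (_ : AddCommGroup N') (_ : Module R N') (d' : ℕ), GoodN R C d' N' ∧
        ∀ a ∈ J ⊔ Ideal.ofList rs, ∀ y : N', a • y = 0 := by
  induction rs with
  | nil =>
    intro _ d N _ _ J hN hJ _
    refine ⟨N, _, _, d, hN, ?_⟩
    simpa using hJ
  | cons r rs ih =>
    intro hm d N _ _ J hN hJ hreg
    rw [RingTheory.Sequence.isWeaklyRegular_cons_iff] at hreg
    have hg := good_step hC hN (hm r (by simp)) hreg.1
    have heq : (r • (⊤ : Submodule R N)) = LinearMap.range (r • (LinearMap.id : N →ₗ[R] N)) := by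
      ext y
      rw [Submodule.mem_smul_pointwise_iff_exists]
      simp
    have hreg' : RingTheory.Sequence.IsWeaklyRegular
        (N ⧸ LinearMap.range (r • (LinearMap.id : N →ₗ[R] N))) rs :=
      (LinearEquiv.isWeaklyRegular_congr (Submodule.quotEquivOfEq _ _ heq) rs).1 hreg.2
    obtain ⟨N', i1, i2, d', h1, h2⟩ := ih (fun x hx => hm x (by simp [hx])) (d+1) _
      (J ⊔ Ideal.span {r}) hg (by
        intro a ha y
        obtain ⟨b, hb, c, hc, rfl⟩ := Submodule.mem_sup.1 ha
        obtain ⟨c, rfl⟩ := Ideal.mem_span_singleton'.1 hc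
        obtain ⟨y, rfl⟩ := Submodule.mkQ_surjective _ y
        rw [← map_smul, add_smul, hJ b hb, zero_add, mul_comm, mul_smul]
        exact (Submodule.Quotient.mk_eq_zero _).2 ⟨c • y, rfl⟩) hreg'
    refine ⟨N', i1, i2, d', h1, ?_⟩
    rw [Ideal.ofList_cons, ← sup_assoc]
    exact h2

lemma ann_ring_bot : Module.annihilator R R = ⊥ := by
  rw [eq_bot_iff]
  intro r hr
  have := Module.mem_annihilator.1 hr 1
  rwa [smul_eq_mul, mul_one] at this

lemma cm_seq (h : IsCohenMacaulayRing R) : ∃ rs : List R, (∀ x ∈ rs, x ∈ maximalIdeal R) ∧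
    RingTheory.Sequence.IsRegular R rs ∧ ∃ s, maximalIdeal R ^ s ≤ Ideal.ofList rs := by
  have h1 : (depth R R : WithBot ℕ∞) = ringKrullDim R := by
    have : (depth R R : WithBot ℕ∞) = moduleDim R R := h
    rw [this, moduleDim, ringKrullDim_eq_of_ringEquiv
      ((Ideal.quotEquivOfEq ann_ring_bot).trans (RingEquiv.quotientBot R))]
  have hlt : depth R R < ⊤ := by
    have := ringKrullDim_lt_top (R := R)
    rw [← h1] at this
    exact WithBot.coe_lt_coe.1 this
  have hmem : depth R R ∈ {n : ℕ∞ | ∃ rs : List R, (rs.length : ℕ∞) = n ∧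
      (∀ x ∈ rs, x ∈ maximalIdeal R) ∧ RingTheory.Sequence.IsRegular R rs} := by
    have : Nonempty {n : ℕ∞ | ∃ rs : List R, (rs.length : ℕ∞) = n ∧
      (∀ x ∈ rs, x ∈ maximalIdeal R) ∧ RingTheory.Sequence.IsRegular R rs} :=
      ⟨⟨0, [], by simp, by simp, RingTheory.Sequence.IsRegular.nil R R⟩⟩
    exact ENat.sSup_mem_of_nonempty_of_lt_top hlt
  obtain ⟨rs, hl, hm, hreg⟩ := hmem
  refine ⟨rs, hm, hreg, ?_⟩
  have h2 := ringKrullDim_add_length_eq_ringKrullDim_of_isRegular rs hreg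
  rw [← h1, ← hl] at h2
  have h3 : ringKrullDim (R ⧸ Ideal.ofList rs) ≤ 0 := by
    have h4 : ringKrullDim (R ⧸ Ideal.ofList rs) + (rs.length : WithBot ℕ∞) = 
      0 + (rs.length : WithBot ℕ∞) := by rw [zero_add, h2]; rfl
    generalize ringKrullDim (R ⧸ Ideal.ofList rs) = t at h4
    induction t with
    | bot => exact bot_le
    | coe t =>
      have h5 : t + (rs.length : ℕ∞) = 0 + (rs.length : ℕ∞) := by exact_mod_cast h4
      have h6 : t = 0 := by
        cases t with
        | top => simp at h5
        | coe t =>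
          have h7 : t + rs.length = 0 + rs.length := by exact_mod_cast h5
          have h8 : t = 0 := by omega
          rw [h8]; rfl
      rw [h6]; rfl
  have h4 : Ring.KrullDimLE 0 (R ⧸ Ideal.ofList rs) := Ring.krullDimLE_iff.2 h3
  rw [Ideal.krullDimLE_zero_quotient_iff_forall_minimalPrimes_isMaximal] at h4
  refine Ideal.exists_pow_le_of_le_radical_of_fg ?_ (IsNoetherian.noetherian _)
  rw [← Ideal.sInf_minimalPrimes]
  refine le_sInf fun P hP => ?_
  rw [IsLocalRing.eq_maximalIdeal (h4 P hP)]

/-- cyclic criterion -/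
lemma semid_cyclic (hC : IsSemidualizing R C) {N : Type u} [AddCommGroup N] [Module R N]
    (ν : N →ₗ[R] (R ⧸ maximalIdeal R)) (hν : Function.Surjective ν)
    (hW : ACl R C (C ⊗[R] N)) : Nonempty (C ≃ₗ[R] R) := by
  have := hC.1
  let k := R ⧸ maximalIdeal R
  obtain ⟨l, hl⟩ := exists_hom_quot_prime (C := C) (maximalIdeal R)
    (by rw [semid_ann hC]; exact bot_le)
  have hl' : ∃ c, l c ≠ 0 := by
    by_contra hc
    push Not at hc
    exact hl (LinearMap.ext hc)
  obtain ⟨c, hc⟩ := hl'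
  obtain ⟨n, hn⟩ := hν 1
  have key : ∀ μ : C →ₗ[R] k, μ c = 0 → μ = 0 := by
    intro μ hμ
    obtain ⟨w, hw⟩ := hW.surj (TensorProduct.mk R C (C ⊗[R] N) c ∘ₗ (TensorProduct.mk R C N).flip n)
    have hw' : ∀ y, y ⊗ₜ[R] w = c ⊗ₜ[R] (y ⊗ₜ[R] n) := fun y => congrArg (fun f => f y) hw
    let m : C ⊗[R] N →ₗ[R] k := TensorProduct.lift ((LinearMap.mul R k).compl₁₂ μ ν)
    let T : C ⊗[R] (C ⊗[R] N) →ₗ[R] k := TensorProduct.lift ((LinearMap.mul R k).compl₁₂ l m)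
    have hT : ∀ y, l y * m w = l c * (μ y * ν n) := fun y => congrArg T (hw' y)
    have h1 := hT c
    rw [hμ, zero_mul, mul_zero] at h1
    have hdom : ∀ a b : k, a * b = 0 → a = 0 ∨ b = 0 := fun a b hab => mul_eq_zero.1 hab
    have h2 : m w = 0 := (hdom _ _ h1).resolve_left hc
    ext y
    have h3 := hT y
    rw [h2, mul_zero, hn, mul_one] at h3
    exact (hdom _ _ h3.symm).resolve_left hc
  have hspan : Submodule.span R {c} = ⊤ := by
    by_contra hne
    have hnt : Nontrivial (C ⧸ Submodule.span R {c}) := Submodule.Quotient.nontrivial_iff.2 hne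
    obtain ⟨μ, hμ⟩ := exists_hom_quot_prime (C := C ⧸ Submodule.span R {c}) (maximalIdeal R)
      (IsLocalRing.le_maximalIdeal (by
        intro htop
        rw [Module.annihilator_eq_top_iff] at htop
        exact not_subsingleton _ htop))
    apply hμ
    have h1 := key (μ ∘ₗ (Submodule.span R {c}).mkQ) (by
      rw [LinearMap.comp_apply, Submodule.mkQ_apply,
        (Submodule.Quotient.mk_eq_zero _).2 (Submodule.mem_span_singleton_self c), map_zero])
    ext y
    exact congrArg (fun f => f y) h1
  refine ⟨(LinearEquiv.ofBijective (LinearMap.toSpanSingleton R C c) ⟨?_, ?_⟩).symm⟩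
  · rw [injective_iff_map_eq_zero]
    intro r hr
    have : r ∈ Module.annihilator R C := by
      rw [Module.mem_annihilator]
      intro y
      have hy : y ∈ Submodule.span R {c} := by rw [hspan]; trivial
      obtain ⟨s, rfl⟩ := Submodule.mem_span_singleton.1 hy
      rw [smul_comm]
      have : r • c = 0 := hr
      rw [this, smul_zero]
    rw [semid_ann hC] at this
    exact this
  · intro y
    have hy : y ∈ Submodule.span R {c} := by rw [hspan]; trivial
    exact Submodule.mem_span_singleton.1 hy

lemma cinj_iff (e : C ≃ₗ[R] R) (N : Type u) [AddCommGroup N] [Module R N] :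
    IsCInjective R C N ↔ Module.Injective R N := by
  constructor
  · rintro ⟨I, hI, ⟨e'⟩⟩
    exact inj_of_equiv (e'.trans ((LinearEquiv.congrLeft I R e).trans
      (LinearMap.ringLmapEquivSelf R R I)))
  · intro hN
    have e2 : N ≃ₗ[R] (C →ₗ[R] N) := ((LinearEquiv.congrLeft N R e).trans
      (LinearMap.ringLmapEquivSelf R R N)).symm
    exact ⟨ModuleCat.of R N, hN, ⟨e2⟩⟩

lemma cInjDim_eq (e : C ≃ₗ[R] R) (M : Type u) [AddCommGroup M] [Module R M] :
    cInjDim R C M = injDim R M := by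
  have : (fun N : ModuleCat.{u} R => IsCInjective R C N) =
      fun N : ModuleCat.{u} R => Module.Injective R N := by
    funext N
    exact propext (cinj_iff e N)
  rw [cInjDim, injDim, this]

lemma part1 (hC : IsSemidualizing R C) (hR : IsGorensteinRing R) (𝔞 : Ideal R) (n : ℕ)
    (h : IsRelCM R 𝔞 n R) : cInjDim R C (lcoh R 𝔞 n C) ≠ ⊤ := by
  have hR' : ∃ k, iD R k R := injDim_ne_top.1 hR
  obtain ⟨k, hk⟩ := hR'
  obtain ⟨e⟩ := semid_of_gor hC hk
  rw [cInjDim_eq e, injDim_ne_top]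
  obtain ⟨k', hk'⟩ := lc_iD n R h.1 ⟨k, hk⟩
  obtain ⟨e'⟩ := lc_iso (𝔞 := 𝔞) n e
  exact ⟨k', hk'.iso e'.symm⟩

lemma relcm_bot : IsRelCM R (⊥ : Ideal R) 0 R := by
  constructor
  · intro i hi
    obtain ⟨i, rfl⟩ := Nat.exists_eq_succ_of_ne_zero hi
    exact lc_bot i R
  · intro hs
    obtain ⟨e⟩ := lc0 (⊥ : Ideal R) R
    have h1 : Subsingleton (gam (⊥ : Ideal R) R) := e.symm.toEquiv.subsingleton
    have h2 : (1 : R) ∈ gam (⊥ : Ideal R) R := ⟨1, fun a ha => by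
      rw [pow_one] at ha
      have : a = 0 := ha
      rw [this, zero_smul]⟩
    have : (⟨1, h2⟩ : gam (⊥ : Ideal R) R) = 0 := Subsingleton.elim _ _
    exact one_ne_zero (congrArg Subtype.val this)

lemma part3a (hC : IsSemidualizing R C) (hCM : IsCohenMacaulayRing R) {𝔞 : Ideal R} {n : ℕ}
    (ha : 𝔞 ≠ ⊤) (h : IsRelCM R 𝔞 n R) (hd : cInjDim R C (lcoh R 𝔞 n C) ≠ ⊤) :
    Nonempty (C ≃ₗ[R] R) := by
  have := hC.1
  obtain ⟨rs, hm, hreg, s, hs⟩ := cm_seq hCM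
  obtain ⟨N, _, _, d, hN, hJ⟩ := good_list hC rs hm 0 R ⊥ (good_ring hC)
    (by intro a ha y; rw [Submodule.mem_bot] at ha; rw [ha, zero_smul]) hreg.toIsWeaklyRegular
  have hN' : ∀ a ∈ 𝔞 ^ s, ∀ x : N, a • x = 0 := fun a haa x => hJ a (by
    rw [bot_sup_eq]
    exact hs (Ideal.pow_right_mono (IsLocalRing.le_maximalIdeal ha) s haa)) x
  obtain ⟨hS1, hS2⟩ := S2 hN' n C (lc_semid hC h.1)
  obtain ⟨ν, hν⟩ := hN.nu
  refine semid_cyclic hC ν hν ?_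
  obtain ⟨e⟩ := hN.top
  by_cases hdn : d < n
  · have := hS2 d hdn
    have : Subsingleton (C ⊗[R] N) := e.symm.toEquiv.subsingleton
    exact ACl.of_sub
  · rw [cInjDim, coresDim_ne_top] at hd
    obtain ⟨k, hk⟩ := hd
    have hcl := acl_claim (semid_ann hC) hN.acl (fun X _ _ hX i => by
      obtain ⟨I, hI, ⟨eX⟩⟩ := hX
      have := hN.hX I hI i
      exact (pfE (i+1) N eX).toEquiv.subsingleton) k _ hk (d - n) (fun i hi => by
        obtain ⟨ei⟩ := hS1 i
        have := hN.van (i+n) (by omega)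
        have : Subsingleton (XT R i N (lcoh R 𝔞 n C)) := ei.toEquiv.subsingleton
        exact ACl.of_sub)
    obtain ⟨ei⟩ := hS1 (d - n)
    rw [Nat.sub_add_cancel (Nat.le_of_not_lt hdn)] at ei
    exact ACl.iso (e.symm.trans ei.symm) hcl

lemma part3 (hC : IsSemidualizing R C) (hCM : IsCohenMacaulayRing R) {𝔞 : Ideal R} {n : ℕ}
    (ha : 𝔞 ≠ ⊤) (h : IsRelCM R 𝔞 n R) (hd : cInjDim R C (lcoh R 𝔞 n C) ≠ ⊤) :
    IsGorensteinRing R := by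
  obtain ⟨e⟩ := part3a hC hCM ha h hd
  rw [cInjDim_eq e, injDim_ne_top] at hd
  obtain ⟨k, hk⟩ := hd
  obtain ⟨e'⟩ := lc_iso (𝔞 := 𝔞) n e
  have hk' : iD R k (lcoh R 𝔞 n R) := hk.iso e'
  obtain ⟨hS1, -⟩ := S2 (𝔞 := 𝔞) (N := R ⧸ maximalIdeal R) (s := 1) (by
    intro a haa x
    obtain ⟨x, rfl⟩ := Submodule.mkQ_surjective _ x
    rw [pow_one] at haa
    exact (Submodule.Quotient.mk_eq_zero _).2
      (Ideal.mul_mem_right x _ (IsLocalRing.le_maximalIdeal ha haa))) n R h.1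
  have hb := bass R (k+1+n) (fun i hi => by
    obtain ⟨j, rfl⟩ := Nat.exists_eq_add_of_le hi
    obtain ⟨ej⟩ := hS1 (k + j + 1)
    rw [show k + j + 1 + n = k + 1 + n + j by omega] at ej
    have := (hk'.mono (show k ≤ k + j by omega)) (R ⧸ maximalIdeal R)
    exact ej.symm.toEquiv.subsingleton)
  have hf : fD R (k+1+n) R := fun I => hb I (k+1+n+1) (by omega)
  exact (coresDim_ne_top _ _).2 ⟨_, cores_of_fD _ R hf⟩

end Fin1

end Part15

/-- **Proposition 3.7.** Let `C` be a semidualizing module over a Noetherian local ring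
`R`. If `R` is Gorenstein then `cid_R H^n_𝔞(C)` is finite for all proper ideals `𝔞` such
that `R` is relative Cohen-Macaulay with respect to `𝔞` with `ht_R 𝔞 = n`; the universal
statement implies the existential one; and if `R` is Cohen-Macaulay, the existential
statement implies that `R` is Gorenstein. -/
theorem gorenstein_cInjDim_localCohomology
    (R : Type u) [CommRing R] [IsNoetherianRing R] [IsLocalRing R]
    (C : Type u) [AddCommGroup C] [Module R C] (hC : IsSemidualizing R C) :
    (IsGorensteinRing R →
      ∀ (𝔞 : Ideal R) (n : ℕ), 𝔞 ≠ ⊤ → IsRelCM R 𝔞 n R →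
        cInjDim R C (lcoh R 𝔞 n C) ≠ ⊤) ∧
    ((∀ (𝔞 : Ideal R) (n : ℕ), 𝔞 ≠ ⊤ → IsRelCM R 𝔞 n R →
        cInjDim R C (lcoh R 𝔞 n C) ≠ ⊤) →
      ∃ (𝔞 : Ideal R) (n : ℕ), 𝔞 ≠ ⊤ ∧ IsRelCM R 𝔞 n R ∧
        cInjDim R C (lcoh R 𝔞 n C) ≠ ⊤) ∧
    (IsCohenMacaulayRing R →
      (∃ (𝔞 : Ideal R) (n : ℕ), 𝔞 ≠ ⊤ ∧ IsRelCM R 𝔞 n R ∧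
        cInjDim R C (lcoh R 𝔞 n C) ≠ ⊤) →
      IsGorensteinRing R) := by
  refine ⟨fun hR 𝔞 n _ h => part1 hC hR 𝔞 n h,
    fun H => ⟨⊥, 0, bot_ne_top, relcm_bot, H ⊥ 0 bot_ne_top relcm_bot⟩, ?_⟩
  rintro hCM ⟨𝔞, n, ha, h, hd⟩
  exact part3 hC hCM ha h hd
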